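/- There exists a single countable two-dimensional SFT X, deterministic in some direction, such that every finite poset order-embeds into the subpattern poset SP(X). -/

import Mathlib

/-- Translation of a two-dimensional configuration. -/
def shift2 {S : Type*} (n : ℤ × ℤ) (x : ℤ × ℤ → S) : ℤ × ℤ → S := fun m => x (n + m)

/-- The pattern with domain `D` and content `p` occurs in `x`. -/
def occurs2 {S : Type*} (D : Finset (ℤ × ℤ)) (p : ℤ × ℤ → S) (x : ℤ × ℤ → S) : Prop :=
  ∃ n : ℤ × ℤ, ∀ m ∈ D, x (n + m) = p m

/-- A two-dimensional subshift of finite type: the configurations in which no pattern from a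
fixed finite set of forbidden finite patterns occurs. -/
def IsSFT2 {S : Type*} (X : Set (ℤ × ℤ → S)) : Prop :=
  ∃ F : Set (Finset (ℤ × ℤ) × (ℤ × ℤ → S)), F.Finite ∧
    X = {x | ∀ P ∈ F, ¬ occurs2 P.1 P.2 x}

/-- `x ≤ y` in the subpattern preorder: every finite pattern occurring in `x` occurs in `y`. -/
def patLE2 {S : Type*} (x y : ℤ × ℤ → S) : Prop :=
  ∀ (D : Finset (ℤ × ℤ)) (n : ℤ × ℤ), ∃ n' : ℤ × ℤ, ∀ m ∈ D, y (n' + m) = x (n + m)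

/-- `x < y` in the subpattern preorder. -/
def patLT2 {S : Type*} (x y : ℤ × ℤ → S) : Prop := patLE2 x y ∧ ¬ patLE2 y x

/-- `X` is southward deterministic: two configurations of `X` agreeing on the upper half-plane
`{(a,b) : b ≥ 1}` are equal. -/
def SouthDet {S : Type*} (X : Set (ℤ × ℤ → S)) : Prop :=
  ∀ x ∈ X, ∀ y ∈ X, (∀ a b : ℤ, 1 ≤ b → x (a, b) = y (a, b)) → x = y

/-- Counterclockwise rotation by 90 degrees. -/
def rot90 (v : ℤ × ℤ) : ℤ × ℤ := (-v.2, v.1)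

/-- The action of an element of `SL₂(ℤ)` on integer vectors. -/
def sl2Vec (A : Matrix.SpecialLinearGroup (Fin 2) ℤ) (v : ℤ × ℤ) : ℤ × ℤ :=
  ((A : Matrix (Fin 2) (Fin 2) ℤ) 0 0 * v.1 + (A : Matrix (Fin 2) (Fin 2) ℤ) 0 1 * v.2,
   (A : Matrix (Fin 2) (Fin 2) ℤ) 1 0 * v.1 + (A : Matrix (Fin 2) (Fin 2) ℤ) 1 1 * v.2)

/-- The action of `SL₂(ℤ)` on configurations: `A(x)_n = x_{A⁻¹ n}`. -/
def confAct {S : Type*} (A : Matrix.SpecialLinearGroup (Fin 2) ℤ) (x : ℤ × ℤ → S) :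
    ℤ × ℤ → S := fun n => x (sl2Vec A⁻¹ n)

/-- `X` is deterministic in the direction `d`: the image of `X` under the element of `SL₂(ℤ)`
taking the 90°-counterclockwise rotation of `d` to `(1,0)` is southward deterministic. -/
def DetInDir {S : Type*} (d : ℤ × ℤ) (X : Set (ℤ × ℤ → S)) : Prop :=
  ∃ A : Matrix.SpecialLinearGroup (Fin 2) ℤ,
    sl2Vec A (rot90 d) = (1, 0) ∧ SouthDet ((confAct A) '' X)

/-- `X` is deterministic in some direction. -/
def DetSomeDir {S : Type*} (X : Set (ℤ × ℤ → S)) : Prop :=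
  ∃ d : ℤ × ℤ, IsCoprime d.1 d.2 ∧ DetInDir d X

namespace ChildSFT

/-- The kinds of horizontal marks of a level. -/
inductive Kd | J | N | B | E
  deriving DecidableEq

instance : Fintype Kd := ⟨{.J, .N, .B, .E}, fun x => by cases x <;> simp⟩

/-- Horizontal rows: the floor `Z` of a level, its ruler marks `K` and their mirror images `M`. -/
inductive Row | Z | K (k : Kd) | M (k : Kd)
  deriving DecidableEq, Fintype

/-- The pending action carried by a growth pointer. -/
inductive Pend | O | J | E | R
  deriving DecidableEq

instance : Fintype Pend := ⟨{.O, .J, .E, .R}, fun x => by cases x <;> simp⟩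

/-- Pointers, which travel in direction `(1, -1)`. -/
inductive Ptr | g (p : Pend) | q (b e : Bool) | c (b e : Bool)
  deriving DecidableEq, Fintype

/-- Contents of the messages sent by a level to its child. -/
inductive Iota | J | N | E | C | nop
  deriving DecidableEq

instance : Fintype Iota := ⟨{.J, .N, .E, .C, .nop}, fun x => by cases x <;> simp⟩

/-- Messages, which travel instantaneously upward. -/
inductive Msg
  | lam (i : Iota) | mu (k : Kd) | tick (d : Option Row) (l : Ptr) | kill (b : Bool)
  deriving DecidableEq, Fintype

/-- Letters of the vertical automaton. -/
inductive Letter | a | G | b (t : Fin 7) | o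
  deriving DecidableEq, Fintype

/-- States of the vertical automaton. -/
structure Zone where
  l : Letter
  i : Fin 7
  deriving DecidableEq, Fintype

/-- The alphabet. -/
inductive Cell
  | blank
  | sky (h : Option Row) (s : Option Ptr) (v : Option Msg) (z : Zone)
  | top (h : Option Row) (s : Option Ptr) (z : Zone)
  deriving DecidableEq, Fintype

inductive Kind | blank | sky | top
  deriving DecidableEq

namespace Cell

def kd : Cell → Kind
  | blank => .blank
  | sky .. => .sky
  | top .. => .top

def h : Cell → Option Row
  | blank => none
  | sky h _ _ _ => h
  | top h _ _ => h

def s : Cell → Option Ptr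
  | blank => none
  | sky _ s _ _ => s
  | top _ s _ => s

def v : Cell → Option Msg
  | sky _ _ v _ => v
  | _ => none

def z : Cell → Zone
  | blank => ⟨.a, 0⟩
  | sky _ _ _ z => z
  | top _ _ z => z

variable (r : Option Row) (P : Option Ptr) (m : Option Msg) (w : Zone)

@[simp] theorem kd_blank : blank.kd = .blank := rfl
@[simp] theorem kd_sky : (sky r P m w).kd = .sky := rfl
@[simp] theorem kd_top : (top r P w).kd = .top := rfl
@[simp] theorem h_blank : blank.h = none := rfl
@[simp] theorem h_sky : (sky r P m w).h = r := rfl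
@[simp] theorem h_top : (top r P w).h = r := rfl
@[simp] theorem s_blank : blank.s = none := rfl
@[simp] theorem s_sky : (sky r P m w).s = P := rfl
@[simp] theorem s_top : (top r P w).s = P := rfl
@[simp] theorem v_blank : blank.v = none := rfl
@[simp] theorem v_sky : (sky r P m w).v = m := rfl
@[simp] theorem v_top : (top r P w).v = none := rfl
@[simp] theorem z_sky : (sky r P m w).z = w := rfl
@[simp] theorem z_top : (top r P w).z = w := rfl

end Cell

/-- The index change of the vertical automaton at a row different from `Z`. -/
inductive Adv : Option Row → Fin 7 → Fin 7 → Prop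
  | idle (i : Fin 7) : Adv none i i
  | KJ : Adv (some (.K .J)) 0 1
  | KN : Adv (some (.K .N)) 1 2
  | KB : Adv (some (.K .B)) 0 2
  | KE : Adv (some (.K .E)) 2 3
  | ME : Adv (some (.M .E)) 3 4
  | MN : Adv (some (.M .N)) 4 5
  | MJ : Adv (some (.M .J)) 5 6
  | MB : Adv (some (.M .B)) 4 6

/-- The step of the vertical automaton at a cell without pointer. -/
inductive ZStep : Zone → Option Row → Zone → Prop
  | floor (i : Fin 7) : ZStep ⟨.o, i⟩ (some .Z) ⟨.a, 0⟩
  | adv (l : Letter) (r : Option Row) (i i' : Fin 7) (h : Adv r i i') : ZStep ⟨l, i⟩ r ⟨l, i'⟩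

/-- The letter above a pointer. -/
def Ptr.letter : Ptr → Fin 7 → Letter
  | .g _, _ => .G
  | .q _ _, i => .b i
  | .c _ _, _ => .o

def Ptr.isQ : Ptr → Bool
  | .q _ _ => true
  | _ => false

/-- The action of a growth tick. -/
def growTick : Pend → Option Iota → Msg
  | .E, _ => .tick (some (.K .E)) (.g .R)
  | .R, _ => .tick none (.q false false)
  | .J, some .N => .tick (some (.K .B)) (.g .O)
  | .J, some .J => .tick (some (.K .J)) (.g .J)
  | .J, some .E => .tick (some (.K .J)) (.g .E)
  | .J, some .C => .tick (some (.K .J)) (.g .E)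
  | .J, _ => .tick (some (.K .J)) (.g .O)
  | .O, some .N => .tick (some (.K .N)) (.g .O)
  | .O, some .C => .tick (some (.K .N)) (.g .E)
  | .O, some .J => .tick none (.g .J)
  | .O, some .E => .tick none (.g .E)
  | .O, _ => .tick none (.g .O)

/-- The action of a pointer arriving at the floor. -/
def Ptr.tick : Ptr → Option Iota → Msg
  | .g p, i => growTick p i
  | .q b e, _ => .tick (some .Z) (.c b e)
  | .c b _, _ => .tick none (.q (!b) false)

/-- The message sent to the child when a mirror mark is found. -/
def iota : Bool → Bool → Kd → Iota
  | _, false, .J => .J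
  | _, false, .N => .N
  | _, false, .E => .E
  | _, false, .B => .nop
  | false, true, .B => .N
  | false, true, .E => .E
  | true, true, .E => .C
  | _, true, _ => .nop

/-- What may be launched at the top by a tick. -/
inductive Launch : Option Row → Ptr → Fin 7 → Zone → Prop
  | g (d : Option Row) (p : Pend) (i i' : Fin 7) (hd : ∀ k, d ≠ some (.M k)) (h : Adv d i i') :
    Launch d (.g p) i ⟨.G, i'⟩
  | q (b e : Bool) : Launch none (.q b e) 3 ⟨.b 3, 3⟩
  | c (b e : Bool) : Launch (some .Z) (.c b e) 6 ⟨.a, 0⟩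

/-- The local rule. -/
inductive Rule (W NW SW S C : Cell) : Prop
  | blank (hW : W.kd = .blank) (hS : S.kd ≠ .sky) (hC : C = .blank)
  | topIdle (hSW : SW.kd = .top) (hW : W.kd = .blank) (hS : S.kd = .sky)
      (hZ : SW.h ≠ some .Z) (hv : S.v = none) (hC : C = .top none none S.z)
  | topFirst (b e : Bool) (hSW : SW.kd = .top) (hW : W.kd = .blank) (hS : S.kd = .sky)
      (hZ : SW.h = some .Z) (hs : SW.s = some (.c b e)) (hv : S.v = none) (hz : S.z = ⟨.a, 0⟩)
      (hC : C = .top none (some (.g (if e then .J else .O))) ⟨.G, 0⟩)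
  | topMu (k : Kd) (t i i' : Fin 7) (hSW : SW.kd = .top) (hW : W.kd = .blank)
      (hS : S.kd = .sky) (hZ : SW.h ≠ some .Z) (hv : S.v = some (.mu k)) (hz : S.z = ⟨.b t, i⟩)
      (ha : Adv (some (.M k)) i i') (hC : C = .top (some (.M k)) none ⟨.b t, i'⟩)
  | topTick (d : Option Row) (l : Ptr) (i : Fin 7) (z : Zone) (hSW : SW.kd = .top)
      (hW : W.kd = .blank) (hS : S.kd = .sky) (hZ : SW.h ≠ some .Z)
      (hv : S.v = some (.tick d l)) (hz : S.z = ⟨.a, i⟩) (hl : Launch d l i z)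
      (hC : C = .top d (some l) z)
  | topKill (b : Bool) (hSW : SW.kd = .top) (hW : W.kd = .blank) (hS : S.kd = .sky)
      (hZ : SW.h ≠ some .Z) (hv : S.v = some (.kill b)) (hz : S.z = ⟨.a, 3⟩)
      (hC : C = .top none (some (.q b false)) ⟨.b 3, 3⟩)
  | free (hW : W.kd ≠ .blank) (hS : S.kd = .sky) (hv : S.v = none) (hP : NW.s = none)
      (hz : ZStep S.z W.h W.z) (hC : C = .sky W.h none none W.z)
  | ptr (P : Ptr) (i i' : Fin 7) (hW : W.kd ≠ .blank) (hS : S.kd = .sky) (hv : S.v = none)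
      (hP : NW.s = some P) (hr : W.h = none ∨ ((∃ k, W.h = some (.K k)) ∧ P.isQ = false))
      (hz : S.z = ⟨.a, i⟩) (hWz : W.z = ⟨.a, i'⟩) (ha : Adv W.h i i')
      (hC : C = .sky W.h (some P) none ⟨P.letter i, i'⟩)
  | qK (b e : Bool) (k : Kd) (i i' : Fin 7) (hW : W.kd ≠ .blank) (hS : S.kd = .sky)
      (hv : S.v = none) (hP : NW.s = some (.q b e)) (hr : W.h = some (.K k))
      (hz : S.z = ⟨.a, i⟩) (hWz : W.z = ⟨.a, i'⟩) (ha : Adv W.h i i')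
      (hC : C = .sky W.h (some (.q b (e || decide (k = .B)))) (some (.mu k)) ⟨.b i, i'⟩)
  | cM (b e : Bool) (k : Kd) (i i' : Fin 7) (hW : W.kd ≠ .blank) (hS : S.kd = .sky)
      (hv : S.v = none) (hP : NW.s = some (.c b e)) (hr : W.h = some (.M k))
      (hz : S.z = ⟨.a, i⟩) (hWz : W.z = ⟨.a, i'⟩) (ha : Adv W.h i i')
      (hC : C = .sky none (some (.c b e)) (some (.lam (iota b e k))) ⟨.o, i⟩)
  | tick (P : Ptr) (i : Fin 7) (hW : W.kd ≠ .blank) (hS : S.kd = .sky)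
      (hv : S.v = none) (hP : NW.s = some P) (hr : W.h = some .Z) (hz : S.z = ⟨.o, i⟩)
      (hC : C = .sky (some .Z) none (some (P.tick none)) ⟨.a, 0⟩)
  | lamTick (ι : Iota) (p : Pend) (i : Fin 7) (hW : W.kd ≠ .blank) (hS : S.kd = .sky)
      (hv : S.v = some (.lam ι)) (hP : NW.s = some (.g p)) (hr : W.h = some .Z)
      (hz : S.z = ⟨.o, i⟩)
      (hC : C = .sky (some .Z) none (some (growTick p (some ι))) ⟨.a, 0⟩)
  | lam (ι : Iota) (i i' : Fin 7) (hW : W.kd ≠ .blank) (hS : S.kd = .sky)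
      (hv : S.v = some (.lam ι)) (hP : NW.s = none) (hr : W.h = none)
      (hz : S.z = ⟨.o, i⟩) (hWz : W.z = ⟨.o, i'⟩) (hi : i < i')
      (hC : C = .sky none none (some (.lam ι)) ⟨.o, i⟩)
  | mu (k : Kd) (t t' i i' j : Fin 7) (hW : W.kd ≠ .blank) (hS : S.kd = .sky)
      (hv : S.v = some (.mu k)) (hP : NW.s = none)
      (hz : S.z = ⟨.b t, i⟩) (hWz : W.z = ⟨.b t', j⟩) (ht : t < t') (ha : Adv W.h i i')
      (hC : C = .sky W.h none (some (.mu k)) ⟨.b t, i'⟩)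
  | tickPass (d : Option Row) (l : Ptr) (i i' : Fin 7) (hW : W.kd ≠ .blank) (hS : S.kd = .sky)
      (hv : S.v = some (.tick d l)) (hP : NW.s = none)
      (hz : S.z = ⟨.a, i⟩) (hWz : W.z.l ≠ .a) (ha : Adv W.h i i')
      (hC : C = .sky W.h none (some (.tick d l)) ⟨.a, i'⟩)
  | killStart (b : Bool) (i : Fin 7) (hW : W.kd ≠ .blank) (hS : S.kd = .sky)
      (hv : S.v = some (.tick none (.q b false))) (hP : NW.s ≠ none) (hr : W.h = some .Z)
      (hz : S.z = ⟨.a, i⟩) (hC : C = .sky none none (some (.kill b)) ⟨.a, i⟩)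
  | kill (b : Bool) (i : Fin 7) (hW : W.kd ≠ .blank) (hS : S.kd = .sky)
      (hv : S.v = some (.kill b)) (hr : W.z.l ≠ .a ∨ (W.h = some .Z ∧ NW.s ≠ none))
      (hz : S.z = ⟨.a, i⟩) (hC : C = .sky none none (some (.kill b)) ⟨.a, i⟩)

theorem Adv.unique {r : Option Row} {i j k : Fin 7} (h : Adv r i j) (h' : Adv r i k) : j = k := by
  cases h <;> cases h' <;> rfl

theorem Launch.unique {d : Option Row} {l : Ptr} {i : Fin 7} {z z' : Zone} (h : Launch d l i z)
    (h' : Launch d l i z') : z = z' := by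
  cases h with
  | g _ _ _ _ _ h => cases h' with
    | g _ _ _ _ _ h' => rw [h.unique h']
  | q => cases h'; rfl
  | c => cases h'; rfl

theorem Rule.unique {W NW SW S C C' : Cell} (hC : Rule W NW SW S C) (hC' : Rule W NW SW S C') :
    C = C' := by
  cases hC <;> cases hC' <;> simp_all <;> first
    | exact Adv.unique (by assumption) (by assumption)
    | exact Launch.unique (by assumption) (by assumption)
    | (subst_vars; simp_all [Ptr.isQ])

/-- The subshift. -/
def X : Set (ℤ × ℤ → Cell) :=
  {x | ∀ p q : ℤ, Rule (x (p - 1, q)) (x (p - 1, q + 1)) (x (p - 1, q - 1)) (x (p, q - 1)) (x (p, q))}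

theorem isSFT2_X : IsSFT2 X := by
  let D : Finset (ℤ × ℤ) := {(-1, 0), (-1, 1), (-1, -1), (0, -1), (0, 0)}
  let pat : Cell × Cell × Cell × Cell × Cell → ℤ × ℤ → Cell := fun c m =>
    if m = (-1, 0) then c.1 else if m = (-1, 1) then c.2.1 else if m = (-1, -1) then c.2.2.1
    else if m = (0, -1) then c.2.2.2.1 else c.2.2.2.2
  refine ⟨(fun c => (D, pat c)) '' {c | ¬ Rule c.1 c.2.1 c.2.2.1 c.2.2.2.1 c.2.2.2.2},
    (Set.toFinite _).image _, ?_⟩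
  ext x
  simp only [X, Set.mem_ofPred_eq, Set.forall_mem_image, occurs2, not_exists]
  constructor
  · intro hx c hc n hn
    apply hc
    have h := hx n.1 n.2
    have h1 := hn (-1, 0) (by simp [D])
    have h2 := hn (-1, 1) (by simp [D])
    have h3 := hn (-1, -1) (by simp [D])
    have h4 := hn (0, -1) (by simp [D])
    have h5 := hn (0, 0) (by simp [D])
    simp only [pat, Prod.mk.injEq] at h1 h2 h3 h4 h5
    norm_num at h1 h2 h3 h4 h5
    have e1 : n + (-1, 0) = (n.1 - 1, n.2) := by ext <;> simp [sub_eq_add_neg]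
    have e2 : n + (-1, 1) = (n.1 - 1, n.2 + 1) := by ext <;> simp [sub_eq_add_neg]
    have e3 : n + (-1, -1) = (n.1 - 1, n.2 - 1) := by ext <;> simp [sub_eq_add_neg]
    have e4 : n + (0, -1) = (n.1, n.2 - 1) := by ext <;> simp [sub_eq_add_neg]
    have e5 : n + (0, 0) = (n.1, n.2) := by ext <;> simp
    rw [e5] at h5; rw [e1] at h1; rw [e2] at h2; rw [e3] at h3; rw [e4] at h4
    rw [← h1, ← h2, ← h3, ← h4, ← h5]
    exact h
  · intro hx p q
    by_contra hR
    refine hx (x := (x (p - 1, q), x (p - 1, q + 1), x (p - 1, q - 1), x (p, q - 1), x (p, q)))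
      hR (p, q) ?_
    intro m hm
    simp only [D, Finset.mem_insert, Finset.mem_singleton] at hm
    rcases hm with rfl | rfl | rfl | rfl | rfl <;> simp [pat, sub_eq_add_neg]

theorem sl2Vec_inv (A : Matrix.SpecialLinearGroup (Fin 2) ℤ) (v : ℤ × ℤ) :
    sl2Vec A⁻¹ v = (A.1 1 1 * v.1 - A.1 0 1 * v.2, - A.1 1 0 * v.1 + A.1 0 0 * v.2) := by
  rw [sl2Vec, Matrix.SpecialLinearGroup.SL2_inv_expl]
  simp [sub_eq_add_neg]

theorem detSomeDir_X : DetSomeDir X := by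
  refine ⟨(2, 1), by norm_num, ⟨!![-1, 0; -2, -1], by simp [Matrix.det_fin_two]⟩, ?_, ?_⟩
  · simp [sl2Vec, rot90]
  have key : ∀ x y : ℤ × ℤ → Cell, x ∈ X → y ∈ X →
      (∀ p q : ℤ, 2 * p + q ≤ -1 → x (p, q) = y (p, q)) → x = y := by
    intro x y hx hy h
    have : ∀ (n : ℕ) (p q : ℤ), 2 * p + q ≤ n - 1 → x (p, q) = y (p, q) := by
      intro n
      induction n with
      | zero => intro p q hpq; exact h p q (by simpa using hpq)
      | succ n ih =>
        intro p q hpq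
        push_cast at hpq
        have h1 := hx p q
        rw [ih _ _ (by lia), ih _ _ (by lia), ih _ _ (by lia), ih _ _ (by lia)] at h1
        exact h1.unique (hy p q)
    funext ⟨p, q⟩
    exact this (2 * p + q + 1).toNat p q (by lia)
  have hA (v : ℤ × ℤ) : sl2Vec (⟨!![-1, 0; -2, -1], by simp [Matrix.det_fin_two]⟩ :
      Matrix.SpecialLinearGroup (Fin 2) ℤ)⁻¹ v = (-v.1, 2 * v.1 - v.2) :=
    (sl2Vec_inv _ v).trans (by ext <;> simp [sub_eq_add_neg])
  rintro _ ⟨x, hx, rfl⟩ _ ⟨y, hy, rfl⟩ h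
  rw [key x y hx hy]
  intro p q hpq
  have := h (-p) (-2 * p - q) (by lia)
  simp only [confAct, hA] at this
  ring_nf at this
  exact this

theorem Cell.ext_of {c d : Cell} (hk : c.kd = d.kd) (hh : c.h = d.h) (hs : c.s = d.s)
    (hv : c.v = d.v) (hz : c.z = d.z) : c = d := by
  cases c <;> cases d <;> simp_all

theorem Cell.eq_blank {c : Cell} (hk : c.kd = .blank) : c = .blank := by
  cases c <;> simp_all

section Local

variable {W NW SW S C : Cell}

theorem Rule.kd_blank (hR : Rule W NW SW S C) (h : C.kd = .blank) : W.kd = .blank ∧ S.kd ≠ .sky := by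
  cases hR <;> subst_vars <;> simp_all

theorem Rule.kd_sky (hR : Rule W NW SW S C) (h : C.kd = .sky) : W.kd ≠ .blank ∧ S.kd = .sky := by
  cases hR <;> subst_vars <;> simp_all

theorem Rule.kd_top (hR : Rule W NW SW S C) (h : C.kd = .top) :
    SW.kd = .top ∧ W.kd = .blank ∧ S.kd = .sky := by
  cases hR <;> subst_vars <;> simp_all

theorem Rule.row_left (hR : Rule W NW SW S C) (h : C.kd = .sky) {r : Row} (hr : C.h = some r) :
    W.h = some r := by
  cases hR <;> subst_vars <;> simp_all

theorem Rule.ptr_back (hR : Rule W NW SW S C) (h : C.kd = .sky) {P : Ptr} (hs : C.s = some P) :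
    W.h ≠ some .Z ∧ ∃ P', NW.s = some P' ∧ (P' = P ∨ ∃ b e e', P = .q b e ∧ P' = .q b e') := by
  cases hR <;> subst_vars <;> simp_all
  case ptr hr _ _ _ => rcases hr with hr | ⟨⟨k, hr⟩, -⟩ <;> simp_all
  case qK b e k _ _ _ _ _ _ _ _ _ => subst hs; cases b <;> cases e <;> cases k <;> simp

end Local

section Global

variable {x : ℤ × ℤ → Cell}

theorem top_succ (hx : x ∈ X) {p q : ℤ} (h : (x (p, q)).kd = .top) : (x (p + 1, q + 1)).kd = .top := by
  have h1 : (x (p, q + 1)).kd = .blank := by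
    have hR := hx p (q + 1)
    have e : q + 1 - 1 = q := by ring
    rw [e] at hR
    cases hk : (x (p, q + 1)).kd with
    | blank => rfl
    | sky => have := (hR.kd_sky hk).2; rw [h] at this; cases this
    | top => have := (hR.kd_top hk).2.2; rw [h] at this; cases this
  have h2 : (x (p + 1, q)).kd = .sky := by
    have hR := hx (p + 1) q
    have e : p + 1 - 1 = p := by ring
    rw [e] at hR
    cases hk : (x (p + 1, q)).kd with
    | blank => have := (hR.kd_blank hk).1; rw [h] at this; cases this
    | sky => rfl
    | top => have := (hR.kd_top hk).2.1; rw [h] at this; cases this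
  have hR := hx (p + 1) (q + 1)
  have e : p + 1 - 1 = p := by ring
  have e' : q + 1 - 1 = q := by ring
  rw [e, e'] at hR
  cases hk : (x (p + 1, q + 1)).kd with
  | blank => exact absurd h2 (hR.kd_blank hk).2
  | sky => exact absurd h1 (hR.kd_sky hk).1
  | top => rfl

/-- A column read as a bi-infinite word is eventually constant. -/
def EvConst (f : ℤ → Cell) : Prop :=
  ∃ N : ℕ, (∀ n : ℤ, N ≤ n → f n = f N) ∧ ∀ n : ℤ, n ≤ -N → f n = f (-N)

theorem countable_evConst : {f | EvConst f}.Countable := by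
  have : {f | EvConst f} = ⋃ N : ℕ, {f : ℤ → Cell | (∀ n : ℤ, N ≤ n → f n = f N) ∧
      ∀ n : ℤ, n ≤ -N → f n = f (-N)} := by
    ext f; simp [EvConst]
  rw [this]
  refine Set.countable_iUnion fun N => ?_
  refine Set.MapsTo.countable_of_injOn (t := Set.univ)
    (f := fun (f : ℤ → Cell) (i : Finset.Icc (-(N : ℤ)) N) => f i.1) (fun _ _ => trivial) ?_
    Set.countable_univ
  intro f hf g hg hfg
  have key : ∀ n : ℤ, -N ≤ n → n ≤ N → f n = g n := fun n h1 h2 =>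
    congrFun hfg ⟨n, Finset.mem_Icc.2 ⟨h1, h2⟩⟩
  funext n
  by_cases h1 : (N : ℤ) ≤ n
  · rw [hf.1 n h1, hg.1 n h1]; exact key _ (by lia) le_rfl
  by_cases h2 : n ≤ -N
  · rw [hf.2 n h2, hg.2 n h2]; exact key _ le_rfl (by lia)
  exact key n (by lia) (by lia)

/-- Configurations determined by finitely many eventually constant columns. -/
def Coded (x : ℤ × ℤ → Cell) (a b : ℤ) : Prop :=
  a ≤ b ∧ (∀ p ≤ a, ∀ q, (x (p, q)).v = none) ∧
  (∀ p, a ≤ p → p ≤ b → EvConst fun q => x (p, q)) ∧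
  ∀ p, b < p → ∃ Q : ℤ, ∀ q ≤ Q, x (p, q) = x (p - 1, q)

theorem column_succ {y : ℤ × ℤ → Cell} (hx : x ∈ X) (hy : y ∈ X) {p Q : ℤ}
    (h : ∀ q, x (p - 1, q) = y (p - 1, q)) (hQ : ∀ q ≤ Q, x (p, q) = y (p, q)) (q : ℤ) :
    x (p, q) = y (p, q) := by
  have : ∀ n : ℕ, ∀ q ≤ Q + n, x (p, q) = y (p, q) := by
    intro n
    induction n with
    | zero => simpa using hQ
    | succ n ih =>
      intro q hq
      have h1 := hx p q
      rw [h, h, h, ih (q - 1) (by push_cast at hq; lia)] at h1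
      exact h1.unique (hy p q)
  exact this (q - Q).toNat q (by lia)

theorem Rule.quiet {W NW SW S C : Cell} (hR : Rule W NW SW S C) (h : C.kd = .sky) (hv : C.v = none) :
    W.h = C.h ∧ NW.s = C.s ∧ W.z = if C.s = none then C.z else ⟨.a, C.z.i⟩ := by
  cases hR <;> subst_vars <;> simp_all

theorem column_pred {y : ℤ × ℤ → Cell} (hx : x ∈ X) (hy : y ∈ X) {p : ℤ}
    (h : ∀ q, x (p, q) = y (p, q)) (hv : ∀ q, (x (p, q)).v = none)
    (hv1 : ∀ q, (x (p - 1, q)).v = none) (hv2 : ∀ q, (y (p - 1, q)).v = none) (q : ℤ) :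
    x (p - 1, q) = y (p - 1, q) := by
  have hX := hx p q
  have hY := hy p q
  by_cases hk : (x (p, q)).kd = .sky
  · have hk' := hk
    rw [h] at hk'
    have kx (z : ℤ × ℤ → Cell) (hz : z ∈ X) : (z (p - 1, q)).kd = .top ↔ (z (p, q + 1)).kd = .top := by
      constructor
      · intro h; have := top_succ hz h; rwa [sub_add_cancel] at this
      · intro h
        have := ((hz p (q + 1)).kd_top h).1
        rwa [add_sub_cancel_right] at this
    have b1 := (hX.kd_sky hk).1
    have b2 := (hY.kd_sky hk').1
    have hS := (hX.kd_sky hk).2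
    have hS' := hS
    rw [h] at hS'
    have s1 := ((hx p (q - 1)).quiet hS (hv _)).2.1
    have s2 := ((hy p (q - 1)).quiet hS' (h (q - 1) ▸ hv _)).2.1
    rw [sub_add_cancel] at s1 s2
    have c1 := hX.quiet hk (hv _)
    have c2 := hY.quiet hk' (h q ▸ hv _)
    refine Cell.ext_of ?_ ?_ ?_ ?_ ?_
    · have k1 := kx x hx
      have k2 := kx y hy
      rw [h] at k1
      cases e1 : (x (p - 1, q)).kd <;> cases e2 : (y (p - 1, q)).kd <;> simp_all
    · rw [c1.1, c2.1, h]
    · rw [s1, s2, h]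
    · rw [hv1, hv2]
    · rw [c1.2.2, c2.2.2, h]
  · have nb (z : ℤ × ℤ → Cell) (hz : z ∈ X) (hk : (z (p, q)).kd ≠ .sky) : z (p - 1, q) = .blank := by
      apply Cell.eq_blank
      cases e : (z (p, q)).kd with
      | sky => exact absurd e hk
      | blank => exact ((hz p q).kd_blank e).1
      | top => exact ((hz p q).kd_top e).2.1
    rw [nb x hx hk, nb y hy (h q ▸ hk)]

theorem countable_coded : {x | x ∈ X ∧ ∃ a b, Coded x a b}.Countable := by
  have : {x | x ∈ X ∧ ∃ a b, Coded x a b} = ⋃ a : ℤ, ⋃ b : ℤ, {x | x ∈ X ∧ Coded x a b} := by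
    ext f; simp
  rw [this]
  refine Set.countable_iUnion fun a => Set.countable_iUnion fun b => ?_
  have hc : {F : Finset.Icc a b → ℤ → Cell | ∀ i, F i ∈ {f | EvConst f}}.Countable :=
    Set.countable_pi fun _ => countable_evConst
  refine Set.MapsTo.countable_of_injOn
    (f := fun (x : ℤ × ℤ → Cell) (i : Finset.Icc a b) (q : ℤ) => x (i.1, q)) ?_ ?_ hc
  · intro x hx i
    exact hx.2.2.2.1 i.1 (Finset.mem_Icc.1 i.2).1 (Finset.mem_Icc.1 i.2).2
  · intro x hx y hy hxy
    have mid : ∀ p, a ≤ p → p ≤ b → ∀ q, x (p, q) = y (p, q) := fun p h1 h2 q =>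
      congrFun (congrFun hxy ⟨p, Finset.mem_Icc.2 ⟨h1, h2⟩⟩) q
    have right : ∀ n : ℕ, ∀ q, x (b + n, q) = y (b + n, q) := by
      intro n
      induction n with
      | zero => simpa using mid b hx.2.1 le_rfl
      | succ n ih =>
        obtain ⟨Q, hQ⟩ := hx.2.2.2.2 (b + (n + 1 : ℕ)) (by push_cast; lia)
        obtain ⟨Q', hQ'⟩ := hy.2.2.2.2 (b + (n + 1 : ℕ)) (by push_cast; lia)
        have e : b + ((n + 1 : ℕ) : ℤ) - 1 = b + n := by push_cast; ring
        rw [e] at hQ hQ'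
        refine column_succ (Q := min Q Q') hx.1 hy.1 (by rwa [e]) fun q hq => ?_
        rw [hQ q (le_trans hq (min_le_left _ _)), hQ' q (le_trans hq (min_le_right _ _)), ih]
    have left : ∀ n : ℕ, ∀ q, x (a - n, q) = y (a - n, q) := by
      intro n
      induction n with
      | zero => simpa using mid a le_rfl hx.2.1
      | succ n ih =>
        have e : a - ((n + 1 : ℕ) : ℤ) = a - n - 1 := by push_cast; ring
        rw [e]
        exact column_pred hx.1 hy.1 ih (hx.2.2.1 _ (by lia)) (hx.2.2.1 _ (by lia))
          (hy.2.2.1 _ (by lia))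
    funext ⟨p, q⟩
    by_cases h1 : p < a
    · have := left (a - p).toNat q
      rwa [show a - ((a - p).toNat : ℤ) = p by lia] at this
    by_cases h2 : b < p
    · have := right (p - b).toNat q
      rwa [show b + ((p - b).toNat : ℤ) = p by lia] at this
    exact mid p (by lia) (by lia) q

end Global

/-- A rank that increases upward along a column, except at floors. -/
def Zone.vrank (z : Zone) : ℕ := (if z.l = .a then 0 else 7) + z.i

/-- A rank that decreases eastward along a row without pointers, at every message. -/
def Zone.hrank (z : Zone) : ℕ :=
  match z.l with
  | .a => 0
  | .G => 1
  | .b t => 2 + t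
  | .o => 10 + z.i

theorem Zone.vrank_le (z : Zone) : z.vrank ≤ 13 := by
  have := z.i.2
  unfold Zone.vrank; split_ifs <;> lia

theorem Zone.hrank_le (z : Zone) : z.hrank ≤ 16 := by
  unfold Zone.hrank
  split <;> lia

theorem Adv.le {r : Option Row} {i j : Fin 7} (h : Adv r i j) : i ≤ j := by
  cases h <;> decide +revert

theorem Adv.lt {r : Option Row} {i j : Fin 7} (h : Adv r i j) (hr : r ≠ none) : i < j := by
  cases h <;> first | exact absurd rfl hr | decide

theorem Adv.ne_floor {r : Option Row} {i j : Fin 7} (h : Adv r i j) : r ≠ some .Z := by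
  cases h <;> simp

section Local

variable {W NW SW S C : Cell}

theorem Rule.floor (hR : Rule W NW SW S C) (h : C.kd = .sky) (hr : C.h = some .Z) :
    C.s = none ∧ C.z = ⟨.a, 0⟩ ∧ S.z.l = .o := by
  cases hR <;> subst_vars <;> simp_all
  case free =>
    have hz := ‹ZStep _ _ _›
    generalize S.z = w at *; generalize W.z = w' at *
    cases hz <;> first | exact absurd rfl (Adv.ne_floor (by assumption)) | simp
  all_goals exact absurd rfl (Adv.ne_floor (by assumption))

theorem Rule.letter_up (hR : Rule W NW SW S C) (h : C.kd = .sky) (hs : C.s = none) :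
    C.z.l = S.z.l ∨ C.h = some .Z := by
  cases hR <;> subst_vars <;> simp_all
  case free =>
    have hz := ‹ZStep _ _ _›
    generalize W.h = r at *; generalize S.z = w at *; generalize W.z = w' at *; cases hz <;> simp_all

theorem Rule.mark (hR : Rule W NW SW S C) (h : C.kd = .sky) (hr : W.h ≠ some .Z) :
    (C.z = S.z ∧ C.v = S.v ∧ C.h = none ∧ C.s = none) ∨ S.z.vrank < C.z.vrank := by
  cases hR <;> subst_vars <;> simp_all
  case free =>
    have hz := ‹ZStep _ _ _›
    generalize S.z = w at *; generalize W.z = w' at *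
    generalize W.h = r at *
    cases hz with
    | floor => exact absurd rfl hr
    | adv _ _ _ _ ha =>
      by_cases hh : r = none
      · subst hh; cases ha; simp
      · right; have := ha.lt hh; simp only [Zone.vrank]; lia
  case ptr P i i' _ _ _ _ _ _ _ _ =>
    have := (‹Adv _ _ _›).le; cases P <;> simp [Zone.vrank, Ptr.letter] <;> lia
  case qK => have := (‹Adv _ _ _›).le; simp [Zone.vrank] ; lia
  case cM => simp [Zone.vrank]
  case mu =>
    have ha := ‹Adv _ _ _›
    by_cases hh : W.h = none
    · rw [hh] at ha ⊢; cases ha; simp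
    · right; have := ha.lt hh; simp only [Zone.vrank]; lia
  case tickPass =>
    have ha := ‹Adv _ _ _›
    by_cases hh : W.h = none
    · rw [hh] at ha ⊢; cases ha; simp
    · right; have := ha.lt hh; simp only [Zone.vrank]; lia

theorem Rule.msg_up (hR : Rule W NW SW S C) (h : C.kd = .sky) (hv : S.v ≠ none) :
    C.v ≠ none ∧ C.s = none := by
  cases hR <;> subst_vars <;> simp_all

theorem Rule.hrank_step (hR : Rule W NW SW S C) (h : C.kd = .sky) (hP : NW.s = none)
    (hZ : W.h ≠ some .Z) : (C.v = none → C.z = W.z) ∧ (C.v ≠ none → C.z.hrank < W.z.hrank) := by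
  cases hR <;> subst_vars <;> simp_all [Zone.hrank]
  case tickPass hW _ _ _ _ _ => split <;> simp_all
  case kill => split <;> simp_all

end Local

theorem stable_above {f : ℤ → ℕ} {B : ℕ} (hB : ∀ q, f q ≤ B) {q₀ : ℤ}
    (h : ∀ q, q₀ < q → f (q - 1) ≤ f q) : ∃ N : ℤ, q₀ ≤ N ∧ ∀ q, N ≤ q → f q = f N := by
  obtain ⟨N, hN, hmax⟩ : ∃ N, q₀ ≤ N ∧ ∀ q, q₀ ≤ q → f q ≤ f N := by
    by_contra hcon
    push Not at hcon
    have : ∀ n : ℕ, ∃ q, q₀ ≤ q ∧ n ≤ f q := by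
      intro n
      induction n with
      | zero => exact ⟨q₀, le_rfl, Nat.zero_le _⟩
      | succ n ih =>
        obtain ⟨q, h1, h2⟩ := ih
        obtain ⟨q', h3, h4⟩ := hcon q h1
        exact ⟨q', h3, by lia⟩
    obtain ⟨q, -, hq⟩ := this (B + 1)
    have := hB q
    lia
  refine ⟨N, hN, fun q hq => le_antisymm (hmax q (hN.trans hq)) ?_⟩
  induction q, hq using Int.leInduction with
  | base => exact le_rfl
  | succ q hq ih => have := h (q + 1) (by lia); rw [add_sub_cancel_right] at this; lia

theorem stable_below {f : ℤ → ℕ} {q₀ : ℤ} (h : ∀ q, q ≤ q₀ → f (q - 1) ≤ f q) :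
    ∃ N : ℤ, N ≤ q₀ ∧ ∀ q, q ≤ N → f q = f N := by
  obtain ⟨N, hN, hmin⟩ : ∃ N, N ≤ q₀ ∧ ∀ q, q ≤ q₀ → f N ≤ f q := by
    by_contra hcon
    push Not at hcon
    have : ∀ n : ℕ, ∃ q, q ≤ q₀ ∧ f q + n ≤ f q₀ := by
      intro n
      induction n with
      | zero => exact ⟨q₀, le_rfl, le_rfl⟩
      | succ n ih =>
        obtain ⟨q, h1, h2⟩ := ih
        obtain ⟨q', h3, h4⟩ := hcon q h1
        exact ⟨q', h3, by lia⟩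
    obtain ⟨q, -, hq⟩ := this (f q₀ + 1)
    lia
  refine ⟨N, hN, fun q hq => le_antisymm ?_ (hmin q (hq.trans hN))⟩
  induction q, hq using Int.leInductionDown with
  | base => exact le_rfl
  | pred q hq ih => have := h q (by lia); lia

theorem card_add_le {g : ℤ → ℕ} {a b : ℤ} (hab : a ≤ b) (F : Finset ℤ)
    (hF : ∀ p ∈ F, a < p ∧ p ≤ b) (h1 : ∀ p, a < p → p ≤ b → g p ≤ g (p - 1))
    (h2 : ∀ p ∈ F, g p < g (p - 1)) : F.card + g b ≤ g a := by
  induction b, hab using Int.leInduction generalizing F with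
  | base =>
    have : F = ∅ := Finset.eq_empty_of_forall_notMem fun p hp => by have := hF p hp; lia
    simp [this]
  | succ b hb ih =>
    have := ih (F.erase (b + 1))
      (fun p hp => ⟨(hF p (Finset.mem_of_mem_erase hp)).1, by
        have := (hF p (Finset.mem_of_mem_erase hp)).2
        have := Finset.ne_of_mem_erase hp
        lia⟩) (fun p h h' => h1 p h (by lia)) fun p hp => h2 p (Finset.mem_of_mem_erase hp)
    by_cases hm : b + 1 ∈ F
    · have h3 := h2 _ hm
      rw [add_sub_cancel_right] at h3
      have := Finset.card_erase_add_one hm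
      lia
    · rw [Finset.erase_eq_of_notMem hm] at this
      have := h1 (b + 1) (by lia) le_rfl
      rw [add_sub_cancel_right] at this
      lia

section Sky

variable {x : ℤ × ℤ → Cell}

theorem sky_row_left (hx : x ∈ X) (hk : ∀ p q, (x (p, q)).kd = .sky) {p q : ℤ} {r : Row}
    (h : (x (p, q)).h = some r) {p' : ℤ} (hp : p' ≤ p) : (x (p', q)).h = some r := by
  induction p', hp using Int.leInductionDown with
  | base => exact h
  | pred n hn ih => exact (hx n q).row_left (hk _ _) ih

theorem sky_ptr_back (hx : x ∈ X) (hk : ∀ p q, (x (p, q)).kd = .sky) {p q : ℤ}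
    (h : (x (p, q)).s ≠ none) (n : ℕ) : (x (p - n, q + n)).s ≠ none := by
  induction n with
  | zero => simpa using h
  | succ n ih =>
    obtain ⟨P, hP⟩ := Option.ne_none_iff_exists'.1 ih
    obtain ⟨-, P', hP', -⟩ := (hx _ _).ptr_back (hk _ _) hP
    have e : (p - ((n + 1 : ℕ) : ℤ), q + ((n + 1 : ℕ) : ℤ)) = (p - n - 1, q + n + 1) := by
      ext <;> push_cast <;> ring
    rw [e, hP']
    simp

theorem sky_no_ptr (hx : x ∈ X) (hk : ∀ p q, (x (p, q)).kd = .sky) {p q p' q' : ℤ}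
    (h : (x (p, q)).h = some .Z) (hp : p' ≤ p) (hq : q' < q) : (x (p', q')).s = none := by
  by_contra hs
  have := sky_ptr_back hx hk hs (q - q').toNat
  rw [show q' + ((q - q').toNat : ℤ) = q by lia] at this
  exact this ((hx _ _).floor (hk _ _) (sky_row_left hx hk h (by lia))).1

theorem sky_floor_unique (hx : x ∈ X) (hk : ∀ p q, (x (p, q)).kd = .sky) {p q q' : ℤ}
    (h : (x (p, q)).h = some .Z) (h' : (x (p, q')).h = some .Z) : ¬ q < q' := by
  intro hlt
  have : ∀ r, q ≤ r → r < q' → (x (p, r)).z.l = .a := by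
    intro r hr
    induction r, hr using Int.leInduction with
    | base => intro _; rw [((hx _ _).floor (hk _ _) h).2.1]
    | succ r hr ih =>
      intro hlt'
      have hR := hx p (r + 1)
      have e : r + 1 - 1 = r := by ring
      rw [e] at hR
      rcases hR.letter_up (hk _ _) (sky_no_ptr hx hk h' le_rfl hlt') with h1 | h1
      · rw [h1]; exact ih (by lia)
      · have := (hR.floor (hk _ _) h1).2.2
        rw [ih (by lia)] at this
        cases this
  have h1 := this (q' - 1) (by lia) (by lia)
  rw [((hx _ _).floor (hk _ _) h').2.2] at h1
  cases h1

theorem sky_floor_bound (hx : x ∈ X) (hk : ∀ p q, (x (p, q)).kd = .sky) (p : ℤ) :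
    ∃ q₀ : ℤ, ∀ q, q ≠ q₀ → (x (p, q)).h ≠ some .Z := by
  by_cases h : ∃ q, (x (p, q)).h = some .Z
  · obtain ⟨q₀, h⟩ := h
    refine ⟨q₀, fun q hq h' => ?_⟩
    rcases lt_or_gt_of_ne hq with hlt | hlt
    · exact sky_floor_unique hx hk h' h hlt
    · exact sky_floor_unique hx hk h h' hlt
  · push Not at h
    exact ⟨0, fun q _ => h q⟩

theorem sky_above (hx : x ∈ X) (hk : ∀ p q, (x (p, q)).kd = .sky) (p : ℤ) :
    ∃ N : ℤ, ∀ q, N < q → (x (p, q)).h = none ∧ (x (p, q)).s = none ∧ x (p, q) = x (p, N + 1) := by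
  obtain ⟨q₀, h0⟩ := sky_floor_bound hx hk (p - 1)
  have hm : ∀ q, q ≠ q₀ → _ := fun q hq => (hx p q).mark (hk _ _) (h0 q hq)
  obtain ⟨N, hN, hst⟩ := stable_above (f := fun q => (x (p, q)).z.vrank) (q₀ := q₀)
    (fun q => Zone.vrank_le _) (fun q hq => by
      rcases hm q (by lia) with h | h
      · simp only [h.1, le_refl]
      · exact h.le)
  have hm' : ∀ q, N < q → (x (p, q)).z = (x (p, q - 1)).z ∧ (x (p, q)).v = (x (p, q - 1)).v ∧
      (x (p, q)).h = none ∧ (x (p, q)).s = none := by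
    intro q hq
    rcases hm q (by lia) with h | h
    · exact h
    · have h1 := hst q (by lia)
      have h2 := hst (q - 1) (by lia)
      lia
  have hc : ∀ q, N + 1 ≤ q → x (p, q) = x (p, N + 1) := by
    intro q hq
    induction q, hq using Int.leInduction with
    | base => rfl
    | succ q hq ih =>
      rw [← ih]
      have h1 := hm' (q + 1) (by lia)
      have h2 := hm' q (by lia)
      rw [add_sub_cancel_right] at h1
      exact Cell.ext_of (by rw [hk, hk]) (by rw [h1.2.2.1, h2.2.2.1]) (by rw [h1.2.2.2, h2.2.2.2])
        h1.2.1 h1.1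
  exact ⟨N, fun q hq => ⟨(hm' q hq).2.2.1, (hm' q hq).2.2.2, hc q (by lia)⟩⟩

theorem sky_below (hx : x ∈ X) (hk : ∀ p q, (x (p, q)).kd = .sky) (p : ℤ) :
    ∃ N : ℤ, ∀ q, q ≤ N → (x (p, q)).h = none ∧ (x (p, q)).s = none ∧ x (p, q) = x (p, N) := by
  obtain ⟨q₀, h0⟩ := sky_floor_bound hx hk (p - 1)
  have hm : ∀ q, q ≠ q₀ → _ := fun q hq => (hx p q).mark (hk _ _) (h0 q hq)
  obtain ⟨N, hN, hst⟩ := stable_below (f := fun q => (x (p, q)).z.vrank) (q₀ := q₀ - 1)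
    (fun q hq => by
      rcases hm q (by lia) with h | h
      · simp only [h.1, le_refl]
      · exact h.le)
  have hm' : ∀ q, q ≤ N → (x (p, q)).z = (x (p, q - 1)).z ∧ (x (p, q)).v = (x (p, q - 1)).v ∧
      (x (p, q)).h = none ∧ (x (p, q)).s = none := by
    intro q hq
    rcases hm q (by lia) with h | h
    · exact h
    · have h1 := hst q (by lia)
      have h2 := hst (q - 1) (by lia)
      lia
  have hc : ∀ q, q ≤ N → x (p, q) = x (p, N) := by
    intro q hq
    induction q, hq using Int.leInductionDown with
    | base => rfl
    | pred q hq ih =>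
      rw [← ih]
      have h1 := hm' q (by lia)
      have h2 := hm' (q - 1) (by lia)
      exact Cell.ext_of (by rw [hk, hk]) (by rw [h1.2.2.1, h2.2.2.1]) (by rw [h1.2.2.2, h2.2.2.2])
        h1.2.1.symm h1.1.symm
  exact ⟨N, fun q hq => ⟨(hm' q hq).2.2.1, (hm' q hq).2.2.2, hc q (by lia)⟩⟩

theorem evConst_of {f : ℤ → Cell} {N M : ℤ} (h1 : ∀ q, N < q → f q = f (N + 1))
    (h2 : ∀ q, q ≤ M → f q = f M) : EvConst f := by
  refine ⟨N.natAbs + M.natAbs + 1, fun n hn => ?_, fun n hn => ?_⟩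
  · exact (h1 n (by lia)).trans (h1 _ (by lia)).symm
  · exact (h2 n (by lia)).trans (h2 _ (by lia)).symm

theorem sky_msg_above (hx : x ∈ X) (hk : ∀ p q, (x (p, q)).kd = .sky) {p q : ℤ}
    (h : (x (p, q)).v ≠ none) {q' : ℤ} (hq : q ≤ q') : (x (p, q')).v ≠ none := by
  induction q', hq using Int.leInduction with
  | base => exact h
  | succ n hn ih =>
    refine ((hx p (n + 1)).msg_up (hk _ _) ?_).1
    rwa [add_sub_cancel_right]

theorem exists_sup {ι : Type*} (F : Finset ι) (f : ι → ℤ) : ∃ N, ∀ i ∈ F, f i ≤ N := by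
  classical
  induction F using Finset.induction_on with
  | empty => exact ⟨0, by simp⟩
  | insert a s _ ih =>
    obtain ⟨N, hN⟩ := ih
    refine ⟨max N (f a), fun i hi => ?_⟩
    rcases Finset.mem_insert.1 hi with rfl | hi
    · exact le_max_right _ _
    · exact (hN i hi).trans (le_max_left _ _)

theorem sky_finite_msg (hx : x ∈ X) (hk : ∀ p q, (x (p, q)).kd = .sky) :
    {p | ∃ q, (x (p, q)).v ≠ none}.Finite := by
  by_contra hinf
  obtain ⟨F, hF, hcard⟩ := Set.Infinite.exists_subset_card_eq hinf 18
  have hne : F.Nonempty := Finset.card_pos.1 (by lia)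
  set a := F.min' hne with ha
  have haF : a ∈ F := Finset.min'_mem _ _
  have hF' : ∀ p : ℤ, ∃ q, p ∈ F → (x (p, q)).v ≠ none := fun p => by
    by_cases hp : p ∈ F
    · obtain ⟨q, hq⟩ := hF hp; exact ⟨q, fun _ => hq⟩
    · exact ⟨0, fun h => absurd h hp⟩
  choose f hf using hF'
  obtain ⟨N, hN⟩ := exists_sup F f
  obtain ⟨q₀, h0⟩ := sky_floor_bound hx hk a
  obtain ⟨b, hb⟩ := exists_sup F id
  set Q := max (N + 1) (q₀ + 1) with hQ
  have hv : ∀ p ∈ F, (x (p, Q)).v ≠ none := fun p hp =>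
    sky_msg_above hx hk (hf p hp) (by have := hN p hp; lia)
  have hs : ∀ p, a ≤ p → (x (p, Q + 1)).s = none := by
    intro p hp
    by_contra h
    have h1 := sky_ptr_back hx hk h (p - a).toNat
    rw [show p - ((p - a).toNat : ℤ) = a by lia] at h1
    refine h1 ((hx a _).msg_up (hk _ _) (sky_msg_above hx hk (hf a haF) ?_)).2
    have := hN a haF
    lia
  have hh : ∀ p, a ≤ p → (x (p, Q)).h ≠ some .Z := fun p hp h =>
    h0 Q (by lia) (sky_row_left hx hk h hp)
  have step : ∀ p, a < p → _ := fun p hp =>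
    (hx p Q).hrank_step (hk _ _) (hs (p - 1) (by lia)) (hh (p - 1) (by lia))
  have := card_add_le (g := fun p => (x (p, Q)).z.hrank) (hb a haF) (F.erase a) (fun p hp =>
      ⟨lt_of_le_of_ne (Finset.min'_le _ _ (Finset.mem_of_mem_erase hp))
        (Finset.ne_of_mem_erase hp).symm, hb p (Finset.mem_of_mem_erase hp)⟩)
    (fun p hp _ => by
      by_cases h : (x (p, Q)).v = none
      · simp only [(step p hp).1 h, le_refl]
      · exact ((step p hp).2 h).le)
    (fun p hp => (step p (lt_of_le_of_ne (Finset.min'_le _ _ (Finset.mem_of_mem_erase hp))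
        (Finset.ne_of_mem_erase hp).symm)).2 (hv p (Finset.mem_of_mem_erase hp)))
  rw [Finset.card_erase_of_mem haF] at this
  have h2 := Zone.hrank_le (x (a, Q)).z
  simp only [id] at this
  lia

theorem sky_coded (hx : x ∈ X) (hk : ∀ p q, (x (p, q)).kd = .sky) : ∃ a b, Coded x a b := by
  have hfin := sky_finite_msg hx hk
  obtain ⟨b, hb⟩ := exists_sup hfin.toFinset id
  obtain ⟨a, ha⟩ := exists_sup hfin.toFinset (fun p => -p)
  have hb' : ∀ p, b < p → ∀ q, (x (p, q)).v = none := fun p hp q => by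
    by_contra h
    have := hb p (hfin.mem_toFinset.2 ⟨q, h⟩)
    simp only [id] at this
    lia
  refine ⟨min (-a - 1) b, b + 1, by lia, ?_, ?_, ?_⟩
  · intro p hp q
    by_contra h
    have := ha p (hfin.mem_toFinset.2 ⟨q, h⟩)
    lia
  · intro p _ _
    obtain ⟨N, hN⟩ := sky_above hx hk p
    obtain ⟨M, hM⟩ := sky_below hx hk p
    exact evConst_of (fun q hq => (hN q hq).2.2) (fun q hq => (hM q hq).2.2)
  · intro p hp
    obtain ⟨M, hM⟩ := sky_below hx hk p
    obtain ⟨M', hM'⟩ := sky_below hx hk (p - 1)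
    refine ⟨min M M', fun q hq => ?_⟩
    have h1 := hM q (by lia)
    have h2 := hM' q (by lia)
    have h3 := (hx p q).quiet (hk _ _) (hb' p (by lia) q)
    refine Cell.ext_of (by rw [hk, hk]) h3.1.symm (by rw [h1.2.1, h2.2.1])
      (by rw [hb' p (by lia), hb' (p - 1) (by lia)]) ?_
    rw [h3.2.2, if_pos h1.2.1]

end Sky

/-- Ticks and kills. -/
def isTick : Option Msg → Bool
  | some (.tick _ _) => true
  | some (.kill _) => true
  | _ => false

@[simp] theorem isTick_none : isTick none = false := rfl
@[simp] theorem isTick_lam (i : Iota) : isTick (some (.lam i)) = false := rfl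
@[simp] theorem isTick_mu (k : Kd) : isTick (some (.mu k)) = false := rfl
@[simp] theorem isTick_tick (d : Option Row) (l : Ptr) : isTick (some (.tick d l)) = true := rfl
@[simp] theorem isTick_kill (b : Bool) : isTick (some (.kill b)) = true := rfl

theorem growTick_eq (p : Pend) (i : Option Iota) : ∃ d l, growTick p i = .tick d l ∧
    d ≠ some .Z ∧ (d = some (.K .E) → p = .E) ∧ (l = .g .E → i = some .E ∨ i = some .C) ∧
    (∀ b e, l ≠ .c b e) ∧ ∀ k, d ≠ some (.M k) := by
  rcases p with _ | _ | _ | _ <;> rcases i with _ | _ | _ | _ | _ | _ <;> simp [growTick]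

theorem Ptr.tick_eq (P : Ptr) : ∃ d l, P.tick none = .tick d l ∧
    (d = some .Z → ∃ b e, P = .q b e) ∧ (d = some (.K .E) → P = .g .E) ∧ l ≠ .g .E := by
  rcases P with p | _ | _
  · rcases p with _ | _ | _ | _ <;> simp [Ptr.tick, growTick]
  · simp [Ptr.tick]
  · simp [Ptr.tick]

@[simp] theorem growTick_ne_lam (p : Pend) (i : Option Iota) (j : Iota) :
    growTick p i ≠ .lam j := by
  obtain ⟨d, l, e, -⟩ := growTick_eq p i; simp [e]

@[simp] theorem growTick_ne_mu (p : Pend) (i : Option Iota) (k : Kd) : growTick p i ≠ .mu k := by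
  obtain ⟨d, l, e, -⟩ := growTick_eq p i; simp [e]

@[simp] theorem growTick_ne_kill (p : Pend) (i : Option Iota) (b : Bool) :
    growTick p i ≠ .kill b := by
  obtain ⟨d, l, e, -⟩ := growTick_eq p i; simp [e]

@[simp] theorem Ptr.tick_ne_lam (P : Ptr) (j : Iota) : P.tick none ≠ .lam j := by
  obtain ⟨d, l, e, -⟩ := P.tick_eq; simp [e]

@[simp] theorem Ptr.tick_ne_mu (P : Ptr) (k : Kd) : P.tick none ≠ .mu k := by
  obtain ⟨d, l, e, -⟩ := P.tick_eq; simp [e]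

@[simp] theorem Ptr.tick_ne_kill (P : Ptr) (b : Bool) : P.tick none ≠ .kill b := by
  obtain ⟨d, l, e, -⟩ := P.tick_eq; simp [e]

section Local

variable {W NW SW S C : Cell}

theorem Rule.tick_cell (hR : Rule W NW SW S C) (h : isTick C.v = true) :
    C.s = none ∧ C.z.l = .a := by
  cases hR <;> subst_vars <;> simp_all

theorem Rule.tick_up (hR : Rule W NW SW S C) (h : isTick S.v = true) (hC : C.kd = .sky) :
    isTick C.v = true := by
  cases hR <;> subst_vars <;> simp_all

theorem Rule.kill_up (hR : Rule W NW SW S C) {b : Bool} (h : S.v = some (.kill b))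
    (hC : C.kd = .sky) : C.v = some (.kill b) := by
  cases hR <;> subst_vars <;> simp_all

theorem Rule.kill_cell (hR : Rule W NW SW S C) {b : Bool} (h : C.v = some (.kill b)) :
    C.h = none ∧ C.s = none := by
  cases hR <;> subst_vars <;> simp_all

theorem Rule.tick_down (hR : Rule W NW SW S C) (h : isTick C.v = true) :
    isTick S.v = true ∨ C.h = some .Z := by
  cases hR <;> subst_vars <;> simp_all

theorem Rule.tick_foot (hR : Rule W NW SW S C) (h : isTick C.v = true) (hZ : C.h = some .Z) :
    isTick S.v = false ∧ C.z = ⟨.a, 0⟩ ∧ ∃ P, NW.s = some P ∧ (C.v = some (P.tick none) ∨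
      ∃ ι p, P = .g p ∧ S.v = some (.lam ι) ∧ C.v = some (growTick p (some ι))) := by
  cases hR <;> subst_vars <;> simp_all
  exact absurd rfl (Adv.ne_floor (by assumption))

theorem Rule.tick_carry (hR : Rule W NW SW S C) {d : Option Row} {l : Ptr}
    (h : C.v = some (.tick d l)) (hZ : C.h ≠ some .Z) : S.v = some (.tick d l) := by
  cases hR <;> subst_vars <;> simp_all

theorem Rule.killed (hR : Rule W NW SW S C) (hC : C.kd = .sky) (hW : W.h = some .Z)
    (hZ : C.h ≠ some .Z) : ∃ b, C.v = some (.kill b) := by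
  cases hR <;> subst_vars <;> simp_all

theorem Rule.tick_E (hR : Rule W NW SW S C) (h : isTick C.v = true) (hZ : C.h ≠ some .Z)
    (hi : C.z.i = 3) : S.z.i = 3 ∨ C.h = some (.K .E) := by
  cases hR <;> subst_vars <;> simp_all
  case tickPass =>
    have ha := ‹Adv _ _ _›
    generalize W.h = r at *
    cases ha <;> simp_all

theorem Rule.ptr_next (hR : Rule W NW SW S C) (h : NW.s ≠ none) (hC : C.kd = .sky) :
    C.s ≠ none ∨ C.h = some .Z ∨ ∃ b, C.v = some (.kill b) := by
  cases hR <;> subst_vars <;> simp_all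

theorem Rule.lam_down (hR : Rule W NW SW S C) {ι : Iota} (h : C.v = some (.lam ι)) :
    C.h = none ∧ (S.v = some (.lam ι) ∨ ∃ b e k, NW.s = some (.c b e) ∧ W.h = some (.M k) ∧
      C.s = some (.c b e) ∧ ι = iota b e k) := by
  cases hR <;> subst_vars <;> simp_all
  case cM b e k _ _ _ _ _ _ _ _ _ _ => subst ι; cases b <;> cases e <;> simp

theorem Rule.mu_down (hR : Rule W NW SW S C) {k : Kd} (h : C.v = some (.mu k)) :
    C.h ≠ some .Z ∧ (S.v = some (.mu k) ∨ C.s ≠ none ∧ C.h = some (.K k)) := by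
  cases hR <;> subst_vars <;> simp_all
  exact Adv.ne_floor (by assumption)

theorem Rule.top_floor (hR : Rule W NW SW S C) (h : C.kd = .top) (hZ : C.h = some .Z) :
    ∃ l, S.v = some (.tick (some .Z) l) := by
  cases hR <;> subst_vars <;> simp_all

theorem Rule.top_K (hR : Rule W NW SW S C) {k : Kd} (h : C.kd = .top) (hZ : C.h = some (.K k)) :
    ∃ l, S.v = some (.tick (some (.K k)) l) := by
  cases hR <;> subst_vars <;> simp_all

theorem Rule.top_q (hR : Rule W NW SW S C) {b e : Bool} (h : C.kd = .top)
    (hs : C.s = some (.q b e)) : isTick S.v = true ∧ S.z.i = 3 := by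
  cases hR <;> subst_vars <;> simp_all
  case topTick => have hl := ‹Launch _ _ _ _›; cases hl; rfl

theorem Rule.top_g (hR : Rule W NW SW S C) (h : C.kd = .top)
    (hs : C.s = some (.g .E)) : ∃ d, S.v = some (.tick d (.g .E)) := by
  cases hR <;> subst_vars <;> simp_all
  all_goals (split at hs <;> simp_all)

theorem Rule.top_c (hR : Rule W NW SW S C) {b e : Bool} (h : C.kd = .top)
    (hs : C.s = some (.c b e)) : C.h = some .Z := by
  cases hR <;> subst_vars <;> simp_all
  case topTick => have hl := ‹Launch _ _ _ _›; cases hl; rfl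

theorem Rule.top_mark (hR : Rule W NW SW S C) {k : Kd} (h : C.kd = .top)
    (hh : C.h = some (.M k)) : S.v = some (.mu k) := by
  cases hR <;> subst_vars <;> simp_all
  case topTick =>
    have hl := ‹Launch _ _ _ _›
    cases hl with
    | g _ _ _ _ hd => exact hd k rfl

theorem Rule.top_quiet (hR : Rule W NW SW S C) (h : C.kd = .top) (hv : isTick S.v = false)
    (hZ : SW.h ≠ some .Z) : C.s = none ∧ (C.h = none ∨ ∃ k, C.h = some (.M k) ∧ S.v = some (.mu k)) := by
  cases hR <;> subst_vars <;> simp_all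

end Local
/-- A configuration whose top cells form the main diagonal. -/
structure Based (x : ℤ × ℤ → Cell) : Prop where
  mem : x ∈ X
  top : ∀ p, (x (p, p)).kd = .top
  sky : ∀ p q, q < p → (x (p, q)).kd = .sky
  blank : ∀ p q, p < q → x (p, q) = .blank

namespace Based

variable {x : ℤ × ℤ → Cell} (hb : Based x)

include hb

theorem row_left {p q : ℤ} {r : Row} (h : (x (p, q)).h = some r) {p' : ℤ} (hq : q ≤ p')
    (hp : p' ≤ p) : (x (p', q)).h = some r := by
  induction p', hp using Int.leInductionDown with
  | base => exact h
  | pred n hn ih => exact (hb.mem n q).row_left (hb.sky _ _ (by lia)) (ih (by lia))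

theorem ptr_line {p q : ℤ} {P : Ptr} (h : (x (p, q)).s = some P) :
    ∃ t P', p + q = 2 * t ∧ t ≤ p ∧ (x (t, t)).s = some P' ∧
      (P' = P ∨ ∃ b e e', P = .q b e ∧ P' = .q b e') ∧
      ∀ p', t < p' → p' ≤ p → (x (p', 2 * t - p')).s ≠ none ∧
        (x (p' - 1, 2 * t - p')).h ≠ some .Z := by
  suffices H : ∀ n : ℕ, ∀ (p q : ℤ) (P : Ptr), p - q ≤ n → (x (p, q)).s = some P → ∃ t P', p + q = 2 * t ∧
      t ≤ p ∧ (x (t, t)).s = some P' ∧ (P' = P ∨ ∃ b e e', P = .q b e ∧ P' = .q b e') ∧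
      ∀ p', t < p' → p' ≤ p → (x (p', 2 * t - p')).s ≠ none ∧
        (x (p' - 1, 2 * t - p')).h ≠ some .Z from H (p - q).toNat p q P (by lia) h
  intro n
  induction n using Nat.strong_induction_on with
  | _ n ih =>
    intro p q P hn h
    rcases lt_trichotomy p q with hpq | rfl | hpq
    · rw [hb.blank _ _ hpq] at h; cases h
    · exact ⟨p, P, by ring, le_rfl, h, .inl rfl, fun p' h1 h2 => by lia⟩
    · obtain ⟨hW, P₁, h1, h2⟩ := (hb.mem p q).ptr_back (hb.sky _ _ hpq) h
      by_cases hn2 : n < 2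
      · rw [hb.blank _ _ (by lia)] at h1; cases h1
      obtain ⟨t, P', e, ht, hs, hP, hl⟩ := ih (n - 2) (by lia) (p - 1) (q + 1) P₁ (by lia) h1
      refine ⟨t, P', by lia, by lia, hs, ?_, ?_⟩
      · rcases h2 with rfl | ⟨b, e, e', rfl, rfl⟩
        · exact hP
        · rcases hP with rfl | ⟨b, e, e', h3, rfl⟩
          · exact .inr ⟨_, _, _, rfl, rfl⟩
          · cases h3; exact .inr ⟨_, _, _, rfl, rfl⟩
      · intro p' h3 h4
        rcases eq_or_lt_of_le h4 with rfl | h4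
        · have e2 : 2 * t - p' = q := by lia
          rw [e2, h]
          exact ⟨by simp, hW⟩
        · exact hl p' h3 (by lia)

theorem tick_above {p q q' : ℤ} (h : isTick (x (p, q)).v = true) (h1 : q ≤ q') (h2 : q' < p) :
    isTick (x (p, q')).v = true := by
  induction q', h1 using Int.leInduction with
  | base => exact h
  | succ n hn ih =>
    refine (hb.mem p (n + 1)).tick_up ?_ (hb.sky _ _ h2)
    rw [add_sub_cancel_right]
    exact ih (by lia)

theorem kill_above {p q q' : ℤ} {b : Bool} (h : (x (p, q)).v = some (.kill b)) (h1 : q ≤ q')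
    (h2 : q' < p) : (x (p, q')).v = some (.kill b) := by
  induction q', h1 using Int.leInduction with
  | base => exact h
  | succ n hn ih =>
    refine (hb.mem p (n + 1)).kill_up ?_ (hb.sky _ _ h2)
    rw [add_sub_cancel_right]
    exact ih (by lia)

theorem tick_no_floor {p q q' : ℤ} (h : isTick (x (p, q)).v = true) (h1 : q < q') (h2 : q' < p) :
    (x (p, q')).h ≠ some .Z := by
  intro hZ
  have h3 := ((hb.mem p q').tick_foot (hb.tick_above h h1.le h2) hZ).1
  rw [hb.tick_above h (by lia) (by lia)] at h3
  cases h3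

theorem tick_root {p : ℤ} (h : isTick (x (p, p - 1)).v = true) :
    (∀ q < p, isTick (x (p, q)).v = true) ∨
      ∃ T < p, isTick (x (p, T)).v = true ∧ (x (p, T)).h = some .Z := by
  by_contra hcon
  push Not at hcon
  obtain ⟨⟨q, hq, hv⟩, h2⟩ := hcon
  have : ∀ r ≤ p - 1, isTick (x (p, r)).v = true := by
    intro r hr
    induction r, hr using Int.leInductionDown with
    | base => exact h
    | pred n hn ih => exact ((hb.mem p n).tick_down ih).resolve_right (h2 n (by lia) ih)
  exact hv (this q (by lia))

theorem tick_value {p T q : ℤ} {d : Option Row} {l : Ptr}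
    (h : (x (p, p - 1)).v = some (.tick d l)) (hT : isTick (x (p, T)).v = true) (h1 : T ≤ q)
    (h2 : q < p) : (x (p, q)).v = some (.tick d l) := by
  have : ∀ r ≤ p - 1, T ≤ r → (x (p, r)).v = some (.tick d l) := by
    intro r hr
    induction r, hr using Int.leInductionDown with
    | base => exact fun _ => h
    | pred n hn ih =>
      exact fun h3 => (hb.mem p n).tick_carry (ih (by lia))
        (hb.tick_no_floor hT (by lia) (by lia))
  exact this q (by lia) h1

theorem killed {T p₁ p₂ : ℤ} (h : (x (p₁, T)).h = some .Z) (hT : T ≤ p₁) (hp : p₁ ≤ p₂)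
    (h2 : (x (p₂, T)).h ≠ some .Z) : ∃ p₀ b, p₁ < p₀ ∧ p₀ ≤ p₂ ∧
      ∀ q, T ≤ q → q < p₀ → (x (p₀, q)).v = some (.kill b) := by
  by_contra hcon
  push Not at hcon
  refine h2 ?_
  clear h2
  have : ∀ p ≥ p₁, p ≤ p₂ → (x (p, T)).h = some .Z := by
    intro p hp
    induction p, hp using Int.leInduction with
    | base => exact fun _ => h
    | succ p hp ih =>
      intro h3
      by_contra h4
      have hR := hb.mem (p + 1) T
      rw [add_sub_cancel_right] at hR
      obtain ⟨b, hv⟩ := hR.killed (hb.sky _ _ (by lia)) (ih (by lia)) h4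
      obtain ⟨q, h5, h6, h7⟩ := hcon (p + 1) b (by lia) h3
      exact h7 (hb.kill_above hv h5 h6)
  exact this p₂ hp le_rfl

/-- A row above a floor ends when the floor is killed. -/
theorem floor_persists {T p₁ p₂ r : ℤ} (h : (x (p₁, T)).h = some .Z) (hT : T < r) (hr : r ≤ p₁)
    (hp : p₁ ≤ p₂) (h2 : (x (p₂, r)).h ≠ none) : (x (p₂, T)).h = some .Z := by
  by_contra h3
  obtain ⟨p₀, b, h4, h5, h6⟩ := hb.killed h (by lia) hp h3
  obtain ⟨R, hR⟩ := Option.ne_none_iff_exists'.1 h2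
  have h7 := hb.row_left hR (p' := p₀) (by lia) h5
  rw [((hb.mem p₀ r).kill_cell (h6 r hT.le (by lia))).1] at h7
  cases h7

/-- A pointer does not cross a floor. -/
theorem ptr_floor {τ T p q : ℤ} (h : (x (τ, T)).h = some .Z) (hT : T < τ) (hpq : p + q = 2 * τ)
    (hp : τ < p) (hs : (x (p, q)).s ≠ none) : T < q := by
  by_contra hq
  push Not at hq
  obtain ⟨P, hP⟩ := Option.ne_none_iff_exists'.1 hs
  obtain ⟨t, P', e, ht, -, -, hl⟩ := hb.ptr_line hP
  obtain rfl : t = τ := by lia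
  obtain ⟨p₀, b, h1, h2, h3⟩ := hb.killed h hT.le (p₂ := 2 * t - T - 1) (by lia) (by
    have := (hl (2 * t - T) (by lia) (by lia)).2
    rwa [show 2 * t - (2 * t - T) = T by ring] at this)
  exact (hl p₀ h1 (by lia)).1 ((hb.mem _ _).kill_cell (h3 (2 * t - p₀) (by lia) (by lia))).2

theorem lam_root {p T q : ℤ} {ι : Iota} (h : (x (p, q)).v = some (.lam ι)) (hT : T ≤ q)
    (hZ : (x (p, T)).h = some .Z) : ∃ y, T < y ∧ y ≤ q ∧
      (∀ r, y ≤ r → r ≤ q → (x (p, r)).h = none) ∧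
      ∃ b e k, (x (p - 1, y)).h = some (.M k) ∧ (x (p, y)).s = some (.c b e) ∧ ι = iota b e k := by
  by_contra hcon
  push Not at hcon
  have : ∀ r ≤ q, T ≤ r → (x (p, r)).v = some (.lam ι) ∧
      ∀ r', r ≤ r' → r' ≤ q → (x (p, r')).h = none := by
    intro r hr
    induction r, hr using Int.leInductionDown with
    | base =>
      refine fun _ => ⟨h, fun r' h1 h2 => ?_⟩
      rw [show r' = q by lia]
      exact ((hb.mem p q).lam_down h).1
    | pred n hn ih =>
      intro h3
      obtain ⟨h4, h5⟩ := ih (by lia)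
      rcases ((hb.mem p n).lam_down h4).2 with h6 | ⟨b, e, k, -, h7, h8, h9⟩
      · refine ⟨h6, fun r' h1 h2 => ?_⟩
        rcases eq_or_lt_of_le h1 with rfl | h1
        · exact ((hb.mem p _).lam_down h6).1
        · exact h5 r' (by lia) h2
      · exact absurd h9 (hcon n (by lia) hn h5 b e k h7 h8)
  rw [(this T hT le_rfl).2 T le_rfl hT] at hZ
  cases hZ

theorem mu_root {p T q : ℤ} {k : Kd} (h : (x (p, q)).v = some (.mu k)) (hT : T ≤ q)
    (hZ : (x (p, T)).h = some .Z) :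
    ∃ y, T < y ∧ y ≤ q ∧ (x (p, y)).s ≠ none ∧ (x (p, y)).h = some (.K k) := by
  by_contra hcon
  push Not at hcon
  have : ∀ r ≤ q, T ≤ r → (x (p, r)).v = some (.mu k) := by
    intro r hr
    induction r, hr using Int.leInductionDown with
    | base => exact fun _ => h
    | pred n hn ih =>
      intro h3
      have h4 := ih (by lia)
      rcases ((hb.mem p n).mu_down h4).2 with h6 | ⟨h7, h8⟩
      · exact h6
      · exact absurd h8 (hcon n (by lia) hn h7)
  exact ((hb.mem p T).mu_down (this T hT le_rfl)).1 hZ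

end Based
namespace Based

theorem iota_E {b e : Bool} {k : Kd} (h : iota b e k = .E ∨ iota b e k = .C) : k = .E := by
  revert h; cases b <;> cases e <;> cases k <;> simp [iota]

variable {x : ℤ × ℤ → Cell} (hb : Based x)

include hb

theorem floor_tick {T : ℤ} (h : (x (T, T)).h = some .Z) :
    ∃ l, (x (T, T - 1)).v = some (.tick (some .Z) l) :=
  (hb.mem T T).top_floor (hb.top T) h

/-- The tick column of a floor starts at the floor of the parent level. -/
theorem parent_floor {T : ℤ} (h : (x (T, T)).h = some .Z)
    (hT : ¬ ∀ q < T, isTick (x (T, q)).v = true) :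
    ∃ T₂ < T, (x (T, T₂)).h = some .Z ∧ isTick (x (T, T₂)).v = true ∧
      ∃ b e, (x (T - 1, T₂ + 1)).s = some (.q b e) := by
  obtain ⟨l, hl⟩ := hb.floor_tick h
  obtain ⟨T₂, h1, h2, h3⟩ := (hb.tick_root (p := T) (by rw [hl]; rfl)).resolve_left hT
  have hv := hb.tick_value hl h2 le_rfl h1
  obtain ⟨-, -, P, hP, hf⟩ := (hb.mem T T₂).tick_foot h2 h3
  refine ⟨T₂, h1, h3, h2, ?_⟩
  rcases hf with hf | ⟨ι, p, rfl, -, hf⟩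
  · obtain ⟨d, l', e1, e2, -⟩ := P.tick_eq
    rw [hv, e1] at hf
    cases hf
    obtain ⟨b, e, rfl⟩ := e2 rfl
    exact ⟨b, e, hP⟩
  · obtain ⟨d, l', e1, e2, -⟩ := growTick_eq p (some ι)
    rw [hv, e1] at hf
    cases hf
    exact absurd rfl e2

/-- A level that has a child has a mark `E`. -/
theorem parent_E {T T₂ : ℤ} (hT : T₂ < T) (h : (x (T, T₂)).h = some .Z) {b e : Bool}
    (hs : (x (T - 1, T₂ + 1)).s = some (.q b e)) :
    ∃ p, T₂ < p ∧ p < T ∧ ((∀ q < p, isTick (x (p, q)).v = true) ∨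
      ∃ κ, T₂ < κ ∧ κ < p ∧ (x (p, κ)).h = some (.K .E) ∧
        ∀ q, T₂ < q → q ≤ κ → (x (p, q)).h ≠ some .Z) := by
  obtain ⟨t, P', e1, ht, hs', hP, hl⟩ := hb.ptr_line hs
  obtain ⟨b', e', rfl⟩ : ∃ b' e', P' = .q b' e' := by
    rcases hP with rfl | ⟨b', _, e', -, rfl⟩ <;> exact ⟨_, _, rfl⟩
  obtain ⟨h1, h2⟩ := (hb.mem t t).top_q (hb.top t) hs'
  refine ⟨t, by lia, by lia, ?_⟩
  rcases hb.tick_root h1 with h3 | ⟨T₃, h3, h4, h5⟩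
  · exact .inl h3
  have hZ := hb.row_left h (p' := t) (by lia) (by lia)
  have h6 : T₃ = T₂ := by
    rcases lt_trichotomy T₃ T₂ with hlt | rfl | hlt
    · exact absurd hZ (hb.tick_no_floor h4 hlt (by lia))
    · rfl
    · rcases eq_or_lt_of_le ht with heq | hlt'
      · lia
      · have := hb.ptr_floor h5 h3 (by lia : T - 1 + (T₂ + 1) = 2 * t) hlt' (by simp [hs])
        lia
  subst h6
  right
  by_contra hcon
  push Not at hcon
  have : ∀ r ≤ t - 1, T₃ ≤ r → (x (t, r)).z.i = 3 := by
    intro r hr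
    induction r, hr using Int.leInductionDown with
    | base => exact fun _ => h2
    | pred n hn ih =>
      intro h7
      have hZ' : ∀ q, T₃ < q → q < t → (x (t, q)).h ≠ some .Z := fun q h8 h9 =>
        hb.tick_no_floor h4 h8 h9
      refine ((hb.mem t n).tick_E (hb.tick_above h4 (by lia) (by lia))
        (hZ' n (by lia) (by lia)) (ih (by lia))).resolve_right fun h8 => ?_
      obtain ⟨q, h9, h10, h11⟩ := hcon n (by lia) (by lia) h8
      exact hZ' q h9 (by lia) h11
  have h7 := this T₃ (by lia) le_rfl
  rw [((hb.mem t T₃).tick_foot h4 h5).2.1] at h7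
  cases h7

set_option maxHeartbeats 1000000 in
/-- Descent to a column of ticks that has no beginning. -/
theorem descent : ∀ (n : ℕ) (T κ p : ℤ), κ - T ≤ n → T < κ → κ ≤ p → (x (p, T)).h = some .Z →
    (x (p, κ)).h = some (.K .E) → (∀ q, T < q → q ≤ κ → (x (p, q)).h ≠ some .Z) →
    ∃ e ≤ T, ∀ q < e, isTick (x (e, q)).v = true := by
  intro n
  induction n using Nat.strong_induction_on with
  | _ n ih =>
  intro T κ p hn hTκ hκ hZ hE hno
  by_cases hTinf : ∀ q < T, isTick (x (T, q)).v = true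
  · exact ⟨T, le_rfl, hTinf⟩
  -- the column of `κ`
  obtain ⟨l, hl⟩ := (hb.mem κ κ).top_K (hb.top κ) (hb.row_left hE le_rfl hκ)
  have hκZ := hb.row_left hZ hTκ.le hκ
  have hvκ : ∃ T₁ < κ, isTick (x (κ, T₁)).v = true ∧ (x (κ, T₁)).h = some .Z := by
    refine (hb.tick_root (p := κ) (by rw [hl]; rfl)).resolve_left fun h => ?_
    exact hb.tick_no_floor (h (T - 1) (by lia)) (by lia) hTκ hκZ
  obtain ⟨T₁, h1, h2, h3⟩ := hvκ
  have h4 : T₁ = T := by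
    rcases lt_trichotomy T₁ T with hlt | rfl | hlt
    · exact absurd hκZ (hb.tick_no_floor h2 hlt hTκ)
    · rfl
    · exact absurd (hb.floor_persists h3 h1 le_rfl hκ (by simp [hE])) (hno T₁ hlt h1.le)
  subst h4
  have hgE : (x (κ - 1, T₁ + 1)).s = some (.g .E) := by
    obtain ⟨-, -, P, hP, hf⟩ := (hb.mem κ T₁).tick_foot h2 h3
    rw [hb.tick_value hl h2 le_rfl h1] at hf
    rcases hf with hf | ⟨ι, p, rfl, -, hf⟩
    · obtain ⟨d, l', e1, -, e2, -⟩ := P.tick_eq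
      rw [e1] at hf
      cases hf
      rw [hP, e2 rfl]
    · obtain ⟨d, l', e1, -, e2, -⟩ := growTick_eq p (some ι)
      rw [e1] at hf
      cases hf
      rw [hP, e2 rfl]
  -- its pointer
  obtain ⟨t, P', e1, ht, hs', hP, hl'⟩ := hb.ptr_line hgE
  obtain rfl : P' = .g .E := by simpa using hP
  obtain ⟨d, hd⟩ := (hb.mem t t).top_g (hb.top t) hs'
  have htZ := hb.row_left hZ (p' := t) (by lia) (by lia)
  have htv : ∃ T₃ < t, isTick (x (t, T₃)).v = true ∧ (x (t, T₃)).h = some .Z := by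
    refine (hb.tick_root (p := t) (by rw [hd]; rfl)).resolve_left fun h => ?_
    exact hb.tick_no_floor (h (T₁ - 1) (by lia)) (by lia) (by lia) htZ
  obtain ⟨T₃, h5, h6, h7⟩ := htv
  have h8 : T₃ = T₁ := by
    rcases lt_trichotomy T₃ T₁ with hlt | rfl | hlt
    · exact absurd htZ (hb.tick_no_floor h6 hlt (by lia))
    · rfl
    · rcases eq_or_lt_of_le ht with heq | hlt'
      · lia
      · have := hb.ptr_floor h7 h5 (by lia : κ - 1 + (T₁ + 1) = 2 * t) hlt' (by rw [hgE]; simp)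
        lia
  subst h8
  obtain ⟨ι, hι, hιv⟩ : ∃ ι, (ι = .E ∨ ι = .C) ∧ (x (t, T₃ - 1)).v = some (.lam ι) := by
    obtain ⟨-, -, P, -, hf⟩ := (hb.mem t T₃).tick_foot h6 h7
    rw [hb.tick_value hd h6 le_rfl h5] at hf
    rcases hf with hf | ⟨ι, p, -, hι, hf⟩
    · obtain ⟨d, l', e1, -, -, e2⟩ := P.tick_eq
      rw [e1] at hf
      cases hf
      exact absurd rfl e2
    · obtain ⟨d, l', e1, -, -, e2, -⟩ := growTick_eq p (some ι)
      rw [e1] at hf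
      cases hf
      exact ⟨ι, by simpa using e2 rfl, hι⟩
  -- the message comes from the parent level
  obtain ⟨T₂, hT₂, hT₂Z, hT₂v, -⟩ := hb.parent_floor (hb.row_left hZ le_rfl (by lia)) hTinf
  have htT₂ := hb.floor_persists (r := T₃) hT₂Z hT₂ le_rfl (p₂ := t) (by lia)
          (by rw [h7]; simp)
  obtain ⟨y, hy1, hy2, hyn, b, e, k, hyM, hyc, hyι⟩ := hb.lam_root hιv (by lia) htT₂
  obtain rfl : k = .E := by
    exact iota_E (hyι ▸ hι)
  obtain ⟨τ, P', e2, hτ, hτs, hP, hτl⟩ := hb.ptr_line hyc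
  obtain rfl : P' = .c b e := by simpa using hP
  have hτZ := (hb.mem τ τ).top_c (hb.top τ) hτs
  have hτT : τ = T₃ := by
    rcases lt_trichotomy τ T₃ with hlt | rfl | hlt
    · exfalso
      by_cases hcase : (x (T₃, τ)).h = some .Z
      · have := hb.floor_persists hcase hlt le_rfl (p₂ := t) (by lia)
          (by rw [h7]; simp)
        rw [hyn τ (by lia) (by lia)] at this
        cases this
      · obtain ⟨p₀, b', g1, g2, g3⟩ := hb.killed hτZ le_rfl hlt.le hcase
        have hk := hb.tick_root (p := p₀) (by rw [g3 (p₀ - 1) (by lia) (by lia)]; rfl)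
        have hs0 := (hτl p₀ g1 (by lia)).1
        rcases hk with hk | ⟨F, f1, f2, f3⟩
        · exact hs0 ((hb.mem _ _).tick_cell (hk _ (by lia))).1
        · by_cases hF : F ≤ 2 * τ - p₀
          · exact hs0 ((hb.mem _ _).tick_cell (hb.tick_above f2 hF (by lia))).1
          · by_cases hF' : F < τ
            · have := hb.ptr_floor (hb.row_left f3 (p' := τ) (by lia) (by lia)) hF'
                (by ring : p₀ + (2 * τ - p₀) = 2 * τ) g1 hs0
              lia
            · have := (hb.mem p₀ F).kill_cell (g3 F (by lia) (by lia))
              rw [this.1] at f3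
              cases f3
    · rfl
    · have := hb.ptr_floor (hb.row_left hZ (p' := τ) (by lia) (by lia)) hlt e2
        (by lia) (by rw [hyc]; simp)
      lia
  subst hτT
  -- the mirror mark of the parent level
  have hyy : (x (y, y)).h = some (.M .E) := hb.row_left hyM le_rfl (by lia)
  have hyT₂ := hb.row_left hT₂Z (p' := y) (by lia) (by lia)
  have hyv : (x (y, y - 1)).v = some (.mu .E) := (hb.mem y y).top_mark (hb.top y) hyy
  obtain ⟨κ', k1, k2, k3, k4⟩ := hb.mu_root hyv (by lia) hyT₂
  have hno' : ∀ q, T₂ < q → q ≤ κ' → (x (y, q)).h ≠ some .Z := by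
    intro q q1 q2 hq
    have := hb.floor_persists hq (r := y) (by lia) le_rfl (p₂ := τ) (by lia)
      (by rw [hb.row_left hyM (p' := τ) (by lia) (by lia)]; simp)
    exact hb.tick_no_floor hT₂v q1 (by lia) this
  have hptr : ∀ i : ℕ, y + i ≤ τ → T₂ < κ' - i → (x (y + i, κ' - i)).s ≠ none := by
    intro i
    induction i with
    | zero => intro _ _; rw [Nat.cast_zero, add_zero, sub_zero]; exact k3
    | succ i ihi =>
      intro i1 i2
      have i3 := ihi (by push_cast at i1; lia) (by push_cast at i2; lia)
      have hR := hb.mem (y + (i + 1 : ℕ)) (κ' - (i + 1 : ℕ))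
      rw [show y + ((i + 1 : ℕ) : ℤ) - 1 = y + i by push_cast; ring,
        show κ' - ((i + 1 : ℕ) : ℤ) + 1 = κ' - i by push_cast; ring] at hR
      rcases hR.ptr_next i3 (hb.sky _ _ (by lia)) with j1 | j1 | ⟨b', j1⟩
      · exact j1
      · exact absurd (hb.row_left j1 (p' := y) (by lia) (by lia)) (hno' _ i2 (by lia))
      · have j2 := (hb.mem _ _).kill_cell (hb.kill_above j1 (q' := y) (by lia) (by lia))
        rw [hb.row_left hyM (by lia) (by lia)] at j2
        cases j2.1
  have hdec : κ' - (τ - y) ≤ T₂ := by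
    by_contra hcon
    have := hptr (τ - y).toNat (by lia) (by lia)
    rw [show y + ((τ - y).toNat : ℤ) = τ by lia] at this
    exact this ((hb.mem _ _).tick_cell (hb.tick_above hT₂v (by lia) (by lia))).1
  obtain ⟨e, he, hinf⟩ := ih (κ' - T₂).toNat (by lia) T₂ κ' y (by lia) k1 (by lia) hyT₂ k4 hno'
  exact ⟨e, by lia, hinf⟩

/-- Every tick is preceded by a column of ticks that has no beginning. -/
theorem exists_endless {p : ℤ} (h : isTick (x (p, p - 1)).v = true) :
    ∃ e ≤ p, ∀ q < e, isTick (x (e, q)).v = true := by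
  rcases hb.tick_root h with h1 | ⟨T, h1, -, h2⟩
  · exact ⟨p, le_rfl, h1⟩
  by_cases hT : ∀ q < T, isTick (x (T, q)).v = true
  · exact ⟨T, h1.le, hT⟩
  obtain ⟨T₂, g1, g2, -, b, e, g3⟩ := hb.parent_floor (hb.row_left h2 le_rfl h1.le) hT
  obtain ⟨t, t1, t2, t3 | ⟨κ, t3, t4, t5, t6⟩⟩ := hb.parent_E g1 g2 g3
  · exact ⟨t, by lia, t3⟩
  · obtain ⟨e, e1, e2⟩ := hb.descent (κ - T₂).toNat T₂ κ t (by lia) t3 t4.le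
      (hb.row_left g2 t1.le t2.le) t5 t6
    exact ⟨e, by lia, e2⟩

end Based
section Local

variable {W NW SW S C : Cell}

theorem Rule.letter_a (hR : Rule W NW SW S C) (hC : C.kd = .sky) (hs : NW.s = none)
    (hz : W.z.l = .a) : C.z.l = .a ∧ isTick C.v = false := by
  cases hR <;> subst_vars <;> simp_all

theorem Rule.deep (hR : Rule W NW SW S C) (hC : C.kd = .sky) (hs : NW.s = none) :
    C.v = S.v ∧ C.s = none ∧ (C.h = none → C.v = none → C.z = W.z) := by
  cases hR <;> subst_vars <;> simp_all

end Local

namespace Based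

variable {x : ℤ × ℤ → Cell} (hb : Based x)

include hb

theorem endless_unique {e e' : ℤ} (h : ∀ q < e, isTick (x (e, q)).v = true)
    (h' : ∀ q < e', isTick (x (e', q)).v = true) : ¬ e < e' := by
  intro hlt
  have hs : ∀ p q, e ≤ p → p + q < 2 * e → (x (p, q)).s = none := by
    intro p q hp hpq
    by_contra hs
    obtain ⟨P, hP⟩ := Option.ne_none_iff_exists'.1 hs
    obtain ⟨t, P', h1, h2, -, -, h3⟩ := hb.ptr_line hP
    exact (h3 e (by lia) hp).1 ((hb.mem _ _).tick_cell (h _ (by lia))).1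
  set Q := 2 * e - e' - 1 with hQ
  have hR : ∀ p, e < p → p ≤ e' → (x (p - 1, Q)).z.l = .a → _ := fun p h1 h2 h3 =>
    (hb.mem p Q).letter_a (hb.sky _ _ (by lia)) (hs (p - 1) (Q + 1) (by lia) (by lia)) h3
  have ha : ∀ p ≥ e, p < e' → (x (p, Q)).z.l = .a := by
    intro p hp
    induction p, hp using Int.leInduction with
    | base => exact fun _ => ((hb.mem _ _).tick_cell (h _ (by lia))).2
    | succ p hp ih =>
      intro h3
      exact (hR (p + 1) (by lia) h3.le (by rw [add_sub_cancel_right]; exact ih (by lia))).1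
  have := (hR e' hlt le_rfl (ha (e' - 1) (by lia) (by lia))).2
  rw [h' Q (by lia)] at this
  cases this

theorem exists_quiet : ∃ p₁, ∀ p ≤ p₁, isTick (x (p, p - 1)).v = false := by
  by_cases h : ∀ p, isTick (x (p, p - 1)).v = false
  · exact ⟨0, fun p _ => h p⟩
  push Not at h
  obtain ⟨p, hp⟩ := h
  obtain ⟨e, -, he⟩ := hb.exists_endless (Bool.eq_true_of_not_eq_false hp)
  refine ⟨e - 1, fun p' hp' => ?_⟩
  by_contra h
  obtain ⟨e', h1, h2⟩ := hb.exists_endless (Bool.eq_true_of_not_eq_false h)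
  exact hb.endless_unique h2 he (by lia)

theorem coded : ∃ a b, Coded x a b := by
  obtain ⟨p₁, hq⟩ := hb.exists_quiet
  have hZ : ∀ p ≤ p₁, (x (p, p)).h ≠ some .Z := by
    intro p hp h
    obtain ⟨l, hl⟩ := hb.floor_tick h
    have := hq p hp
    rw [hl] at this
    cases this
  have htop : ∀ p ≤ p₁, _ := fun p hp =>
    (hb.mem p p).top_quiet (hb.top p) (hq p hp) (hZ _ (by lia))
  have hZ' : ∀ p q, q ≤ p₁ → q < p → (x (p, q)).h ≠ some .Z := fun p q h1 h2 h3 =>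
    hZ q h1 (hb.row_left h3 le_rfl h2.le)
  have hs : ∀ p q, p + q ≤ 2 * p₁ → (x (p, q)).s = none := by
    intro p q hpq
    by_contra hs
    obtain ⟨P, hP⟩ := Option.ne_none_iff_exists'.1 hs
    obtain ⟨t, P', h1, h2, h3, -⟩ := hb.ptr_line hP
    rw [(htop t (by lia)).1] at h3
    cases h3
  have deep : ∀ p q, q < p → p + q ≤ 2 * p₁ → _ := fun p q h1 h2 =>
    (hb.mem p q).deep (hb.sky _ _ h1) (hs _ _ (by lia))
  have down : ∀ p q q', q < p → p + q ≤ 2 * p₁ → q' ≤ q → (x (p, q')).v = (x (p, q)).v := by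
    intro p q q' h1 h2 h3
    induction q', h3 using Int.leInductionDown with
    | base => rfl
    | pred n hn ih => rw [← (deep p n (by lia) (by lia)).1, ih]
  -- finitely many columns carry messages
  let V : Set ℤ := {p | ∃ q < p, p + q ≤ 2 * p₁ ∧ (x (p, q)).v ≠ none}
  have hV : ∀ p ∈ V, ∀ q < p, p + q ≤ 2 * p₁ → (x (p, q)).v ≠ none := by
    rintro p ⟨q', h1, h2, h3⟩ q h4 h5
    rcases le_total q q' with h | h
    · rwa [down p q' q h1 h2 h]
    · rwa [← down p q q' h4 h5 h]
  have hfin : V.Finite := by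
    by_contra hinf
    obtain ⟨F, hF, hcard⟩ := Set.Infinite.exists_subset_card_eq hinf 18
    have hne : F.Nonempty := Finset.card_pos.1 (by lia)
    set a := F.min' hne with ha
    have haF : a ∈ F := Finset.min'_mem _ _
    obtain ⟨b, hB⟩ := exists_sup F id
    simp only [id] at hB
    set Q := min (a - 1) (2 * p₁ - b) with hQ
    have step : ∀ p, a < p → p ≤ b → _ := fun p hp hp' =>
      (hb.mem p Q).hrank_step (hb.sky _ _ (by lia)) (hs _ _ (by lia)) (by
        refine hZ' _ _ ?_ (by lia)
        have := hB a haF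
        lia)
    have hFa : ∀ p ∈ F.erase a, a < p := fun p hp =>
      lt_of_le_of_ne (Finset.min'_le _ _ (Finset.mem_of_mem_erase hp))
        (Finset.ne_of_mem_erase hp).symm
    have := card_add_le (g := fun p => (x (p, Q)).z.hrank) (hB a haF) (F.erase a)
      (fun p hp => ⟨hFa p hp, hB p (Finset.mem_of_mem_erase hp)⟩)
      (fun p hp hp' => by
        by_cases h : (x (p, Q)).v = none
        · simp only [(step p hp hp').1 h, le_refl]
        · exact ((step p hp hp').2 h).le)
      (fun p hp => by
        have h1 := hB p (Finset.mem_of_mem_erase hp)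
        have h2 := hFa p hp
        exact (step p h2 h1).2 (hV p (hF (Finset.mem_of_mem_erase hp)) Q (by lia) (by lia)))
    rw [Finset.card_erase_of_mem haF] at this
    have h2 := Zone.hrank_le (x (a, Q)).z
    lia
  obtain ⟨b, hB⟩ := exists_sup hfin.toFinset id
  obtain ⟨a, hA⟩ := exists_sup hfin.toFinset (fun p => -p)
  simp only [Set.Finite.mem_toFinset, id] at hA hB
  obtain ⟨a', ha1, ha2, ha3⟩ : ∃ a', a' < -a ∧ a' < p₁ ∧ a' ≤ b := ⟨min (-a - 1) (min (p₁ - 1) b),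
    by lia, by lia, by lia⟩
  have hv : ∀ p ≤ a', ∀ q, (x (p, q)).v = none := by
    intro p hp q
    rcases lt_trichotomy p q with h | rfl | h
    · rw [hb.blank _ _ h]; rfl
    · have := hb.top p
      cases hc : x (p, p) <;> simp_all
    · by_contra h1
      have := hA p ⟨q, h, by lia, h1⟩
      lia
  have hrow : ∀ p q, q ≤ a' → (x (p, q)).h = none := by
    intro p q hqa
    rcases lt_or_ge p q with h | h
    · rw [hb.blank _ _ h]; rfl
    · by_contra hne
      obtain ⟨r, hr⟩ := Option.ne_none_iff_exists'.1 hne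
      have h1 := hb.row_left hr le_rfl h
      rcases (htop q (by lia)).2 with h2 | ⟨k, -, h2⟩
      · rw [h2] at h1; cases h1
      · rw [hv q hqa] at h2; cases h2
  refine ⟨a', b + 1, by lia, hv, ?_, ?_⟩
  · intro p _ _
    set q₀ := min (p - 1) (min a' (2 * p₁ - p)) with hq₀
    have hm : ∀ q ≤ q₀, _ := fun q hq => (hb.mem p q).mark (hb.sky p q (by lia))
      (by rw [hrow _ _ (by lia)]; simp)
    obtain ⟨N, hN, hst⟩ := stable_below (f := fun q => (x (p, q)).z.vrank) (q₀ := q₀)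
      (fun q hq => by
        rcases hm q hq with h | h
        · simp only [h.1, le_refl]
        · exact h.le)
    refine evConst_of (N := p) (M := N) (fun q hq => ?_) (fun q hq => ?_)
    · rw [hb.blank _ _ hq, hb.blank _ _ (by lia)]
    · have hm' : ∀ q ≤ N, (x (p, q)).z = (x (p, q - 1)).z := by
        intro q hq
        rcases hm q (by lia) with h | h
        · exact h.1
        · have h1 := hst q (by lia)
          have h2 := hst (q - 1) (by lia)
          lia
      induction q, hq using Int.leInductionDown with
      | base => rfl
      | pred q hq ih =>
        rw [← ih]
        refine Cell.ext_of ?_ ?_ ?_ ?_ (hm' q hq).symm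
        · rw [hb.sky _ _ (by lia), hb.sky _ _ (by lia)]
        · rw [hrow _ _ (by lia), hrow _ _ (by lia)]
        · rw [hs _ _ (by lia), hs _ _ (by lia)]
        · exact down p q (q - 1) (by lia) (by lia) (by lia)
  · intro p hp
    refine ⟨min (p - 2) (min a' (2 * p₁ - p)), fun q hq => ?_⟩
    have hv' : ∀ p' ≥ p - 1, q < p' → p' + q ≤ 2 * p₁ → (x (p', q)).v = none := by
      intro p' h1 h2 h3
      by_contra h4
      have := hB p' ⟨q, h2, h3, h4⟩
      lia
    have hd := deep p q (by lia) (by lia)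
    refine Cell.ext_of ?_ ?_ ?_ ?_ (hd.2.2 (hrow _ _ (by lia)) (hv' p (by lia) (by lia) (by lia)))
    · rw [hb.sky _ _ (by lia), hb.sky _ _ (by lia)]
    · rw [hrow _ _ (by lia), hrow _ _ (by lia)]
    · rw [hs _ _ (by lia), hs _ _ (by lia)]
    · rw [hv' p (by lia) (by lia) (by lia), hv' (p - 1) (by lia) (by lia) (by lia)]

end Based

section Kinds

variable {x : ℤ × ℤ → Cell}

theorem above_top (hx : x ∈ X) {p q : ℤ} (h : (x (p, q)).kd ≠ .sky) {q' : ℤ} (hq : q < q') :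
    x (p, q') = .blank := by
  have key : ∀ r, (x (p, r - 1)).kd ≠ .sky → (x (p, r)).kd = .blank := by
    intro r hr
    cases hk : (x (p, r)).kd with
    | blank => rfl
    | sky => exact absurd ((hx p r).kd_sky hk).2 hr
    | top => exact absurd ((hx p r).kd_top hk).2.2 hr
  have : ∀ r ≥ q + 1, (x (p, r)).kd = .blank := by
    intro r hr
    induction r, hr using Int.leInduction with
    | base => exact key _ (by rwa [add_sub_cancel_right])
    | succ n hn ih => exact key _ (by rw [add_sub_cancel_right, ih]; simp)
  exact Cell.eq_blank (this q' hq)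

theorem below_sky (hx : x ∈ X) {p q : ℤ} (h : (x (p, q)).kd = .sky) {q' : ℤ} (hq : q' ≤ q) :
    (x (p, q')).kd = .sky := by
  induction q', hq using Int.leInductionDown with
  | base => exact h
  | pred n hn ih => exact ((hx p n).kd_sky ih).2

theorem based_of_top (hx : x ∈ X) {p₀ : ℤ} (h : (x (p₀, p₀)).kd = .top) : Based x := by
  have htop : ∀ p, (x (p, p)).kd = .top := by
    intro p
    rcases le_total p₀ p with hp | hp
    · induction p, hp using Int.leInduction with
      | base => exact h
      | succ p hp ih => exact top_succ hx ih
    · induction p, hp using Int.leInductionDown with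
      | base => exact h
      | pred p hp ih => exact ((hx p p).kd_top ih).1
  exact ⟨hx, htop, fun p q hq => below_sky hx ((hx p p).kd_top (htop p)).2.2 (by lia),
    fun p q hq => above_top hx (by rw [htop]; simp) hq⟩

theorem kd_const (hx : x ∈ X) (h : ∀ p q, (x (p, q)).kd ≠ .top) :
    (∀ p q, (x (p, q)).kd = .sky) ∨ ∀ p q, x (p, q) = .blank := by
  have hb : ∀ {p q}, (x (p, q)).kd ≠ .sky → (x (p, q)).kd = .blank := by
    intro p q hk
    have := h p q
    cases hc : (x (p, q)).kd <;> simp_all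
  have hcol : ∀ {p q}, (x (p, q)).kd = .blank → ∀ q', (x (p, q')).kd = .blank := by
    intro p q hk q'
    refine hb fun hs => ?_
    rcases le_total q q' with hq | hq
    · rw [below_sky hx hs hq] at hk; cases hk
    · have : ∀ r ≤ q, (x (p, r)).kd = .blank := by
        intro r hr
        induction r, hr using Int.leInductionDown with
        | base => exact hk
        | pred n hn ih => exact hb ((hx p n).kd_blank ih).2
      rw [this q' hq] at hs; cases hs
  by_cases hsky : ∃ p q, (x (p, q)).kd = .blank
  · right
    obtain ⟨p, q, hpq⟩ := hsky
    intro p' q'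
    refine Cell.eq_blank ?_
    rcases le_total p p' with hp | hp
    · induction p', hp using Int.leInduction generalizing q' with
      | base => exact hcol hpq q'
      | succ n hn ih =>
        refine hb fun hs => ?_
        have := ((hx (n + 1) q').kd_sky hs).1
        rw [add_sub_cancel_right] at this
        exact this (ih q')
    · induction p', hp using Int.leInductionDown generalizing q' with
      | base => exact hcol hpq q'
      | pred n hn ih => exact ((hx n q').kd_blank (ih q')).1
  · left
    push Not at hsky
    intro p q
    by_contra hc
    exact hsky p q (hb hc)

end Kinds

theorem countable_X : X.Countable := by
  refine ((Set.countable_univ (α := ℤ)).biUnion (t := fun c _ =>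
    (fun (x : ℤ × ℤ → Cell) (v : ℤ × ℤ) => x (v.1, v.2 + c)) '' {x | x ∈ X ∧ ∃ a b, Coded x a b})
    fun c _ => countable_coded.image _).mono ?_
  intro x hx
  simp only [Set.mem_iUnion, Set.mem_image]
  by_cases h : ∃ p q, (x (p, q)).kd = .top
  · obtain ⟨p, q, h⟩ := h
    let y : ℤ × ℤ → Cell := fun v => x (v.1, v.2 + (q - p))
    have hy : y ∈ X := by
      intro a b
      have := hx a (b + (q - p))
      simp only [y]
      rw [show b + 1 + (q - p) = b + (q - p) + 1 by ring,
        show b - 1 + (q - p) = b + (q - p) - 1 by ring]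
      exact this
    have hb : Based y := based_of_top hy (p₀ := p) (by simpa [y] using h)
    exact ⟨p - q, trivial, y, ⟨hy, hb.coded⟩, by
      funext v; simp only [y, add_assoc, sub_add_sub_cancel, sub_self, add_zero]⟩
  · push Not at h
    refine ⟨0, trivial, x, ⟨hx, ?_⟩, by simp⟩
    rcases kd_const hx h with h | h
    · exact sky_coded hx h
    · exact ⟨0, 0, le_rfl, by simp [h], fun p _ _ => ⟨0, by simp [h]⟩,
        fun p _ => ⟨0, by simp [h]⟩⟩

/-- A label of a level: the logarithms of the distances of its three marks. -/
structure Label where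
  j : ℕ
  n : ℕ
  m : ℕ
  hj : 1 ≤ j
  hn : j ≤ n
  hm : n < m

namespace Label

def α (L : Label) : ℤ := 2 ^ L.j

def β (L : Label) : ℤ := 2 ^ L.n

def γ (L : Label) : ℤ := 2 ^ L.m

variable (L : Label)

theorem two_le_α : 2 ≤ L.α := by
  have := pow_le_pow_right₀ (show (1 : ℤ) ≤ 2 by norm_num) L.hj
  simpa [α] using this

theorem α_le_β : L.α ≤ L.β := pow_le_pow_right₀ (by norm_num) L.hn

theorem two_mul_β_le : 2 * L.β ≤ L.γ := by
  have := pow_le_pow_right₀ (show (1 : ℤ) ≤ 2 by norm_num) (show L.n + 1 ≤ L.m from L.hm)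
  simp only [β, γ]
  linarith [pow_succ (2 : ℤ) L.n]

theorem pow_inj {a b : ℕ} : (2 : ℤ) ^ a = 2 ^ b ↔ a = b :=
  pow_right_inj₀ (by norm_num) (by norm_num)

theorem α_eq_β_iff : L.α = L.β ↔ L.j = L.n := pow_inj

/-- The last step of the cycle through the marks. -/
def last : Bool := decide (L.j = L.n)

/-- The mark at a given distance. -/
def mark (d : ℤ) : Option Kd :=
  if d = L.α then (if L.α = L.β then some .B else some .J)
  else if d = L.β then some .N else if d = L.γ then some .E else none

def up (y : ℤ) : Fin 7 := if y < L.α then 0 else if y < L.β then 1 else if y < L.γ then 2 else 3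

def dn (d : ℤ) : Fin 7 := if L.γ < d then 3 else if L.β < d then 4 else if L.α < d then 5 else 6

theorem adv_up (y : ℤ) : Adv ((L.mark y).map .K) (L.up (y - 1)) (L.up y) := by
  have h1 := L.two_le_α; have h2 := L.α_le_β; have h3 := L.two_mul_β_le
  unfold mark up
  split_ifs <;> first | lia | (simp; constructor)

theorem adv_dn (d : ℤ) : Adv ((L.mark d).map .M) (L.dn (d + 1)) (L.dn d) := by
  have h1 := L.two_le_α; have h2 := L.α_le_β; have h3 := L.two_mul_β_le
  unfold mark dn
  split_ifs <;> first | lia | (simp; constructor)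

theorem adv_up' {y : ℤ} {k : Kd} (h : L.mark y = some k) :
    Adv (some (.K k)) (L.up (y - 1)) (L.up y) := by simpa [h] using L.adv_up y

theorem adv_dn' {y : ℤ} {k : Kd} (h : L.mark y = some k) :
    Adv (some (.M k)) (L.dn (y + 1)) (L.dn y) := by simpa [h] using L.adv_dn y

theorem up_lt {y : ℤ} {k : Kd} (h : L.mark y = some k) : L.up (y - 1) < L.up y := by
  have := L.adv_up' h
  revert this
  generalize L.up (y - 1) = u
  generalize L.up y = v
  rintro ⟨⟩ <;> decide

theorem dn_lt {y : ℤ} {k : Kd} (h : L.mark y = some k) : L.dn (y + 1) < L.dn y := by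
  have := L.adv_dn' h
  revert this
  generalize L.dn (y + 1) = u
  generalize L.dn y = v
  rintro ⟨⟩ <;> decide

theorem up_eq {y : ℤ} (h : L.mark y = none) : L.up (y - 1) = L.up y := by
  have := L.adv_up y
  rw [h] at this
  revert this
  generalize L.up (y - 1) = u
  generalize L.up y = v
  rintro ⟨⟩; rfl

theorem dn_eq {y : ℤ} (h : L.mark y = none) : L.dn (y + 1) = L.dn y := by
  have := L.adv_dn y
  rw [h] at this
  revert this
  generalize L.dn (y + 1) = u
  generalize L.dn y = v
  rintro ⟨⟩; rfl

theorem mark_big {y : ℤ} (h : L.γ < y) : L.mark y = none := by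
  have h1 := L.two_le_α; have h2 := L.α_le_β; have h3 := L.two_mul_β_le
  simp [mark, show y ≠ L.α by lia, show y ≠ L.β by lia, show y ≠ L.γ by lia]

theorem up_big {y : ℤ} (h : L.γ ≤ y) : L.up y = 3 := by
  have h1 := L.two_le_α; have h2 := L.α_le_β; have h3 := L.two_mul_β_le
  simp [up, show ¬ y < L.α by lia, show ¬ y < L.β by lia, show ¬ y < L.γ by lia]

theorem dn_big {y : ℤ} (h : L.γ < y) : L.dn y = 3 := by simp [dn, h]

theorem mark_one : L.mark 1 = none := by
  have h1 := L.two_le_α; have h2 := L.α_le_β; have h3 := L.two_mul_β_le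
  simp [mark, show 1 ≠ L.α by lia, show 1 ≠ L.β by lia, show 1 ≠ L.γ by lia]

theorem up_zero : L.up 0 = 0 := by
  have h1 := L.two_le_α
  simp [up, show 0 < L.α by lia]

theorem dn_one : L.dn 1 = 6 := by
  have h1 := L.two_le_α; have h2 := L.α_le_β; have h3 := L.two_mul_β_le
  simp [dn, show ¬ L.α < 1 by lia, show ¬ L.β < 1 by lia, show ¬ L.γ < 1 by lia]

theorem mark_pow {y : ℤ} {k : Kd} (h : L.mark y = some k) : ∃ i : ℕ, 1 ≤ i ∧ y = 2 ^ i := by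
  have h1 := L.hj; have h2 := L.hn; have h3 := L.hm
  unfold mark at h
  split_ifs at h with h1 _ h2 h3
  · exact ⟨L.j, by lia, h1⟩
  · exact ⟨L.j, by lia, h1⟩
  · exact ⟨L.n, by lia, h2⟩
  · exact ⟨L.m, by lia, h3⟩

theorem mark_eq_pow (k : ℕ) : L.mark (2 ^ k) =
    if k = L.j then (if L.j = L.n then some .B else some .J)
    else if k = L.n then some .N else if k = L.m then some .E else none := by
  simp only [mark, α_eq_β_iff]
  simp only [α, β, γ, pow_inj]

theorem pow_le_γ {k : ℕ} (h : k ≤ L.m) : (2 : ℤ) ^ k ≤ L.γ := pow_le_pow_right₀ (by norm_num) h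

theorem γ_le_pow {k i : ℕ} (h : L.m + i ≤ k) : 2 ^ i * L.γ ≤ (2 : ℤ) ^ k := by
  rw [γ, ← pow_add]
  exact pow_le_pow_right₀ (by norm_num) (by lia)

/-- The label of a child. -/
def child (b : Bool) : Label :=
  if h : L.j < L.n then ⟨L.j + 1, L.n, L.m + 1, by lia, by lia, by have := L.hm; lia⟩
  else if b then ⟨1, L.m, L.m + 1, by lia, by have := L.hm; lia, by lia⟩
  else ⟨1, L.n, L.m + 1, by lia, by have := L.hj; have := L.hn; lia, by have := L.hm; lia⟩

/-- The pending action of the growth pointer in the `k`-th period. -/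
def pend (k : ℕ) : Pend :=
  if k + 1 = L.j then .J else if k + 1 = L.m then .E else if k = L.m then .R else .O

/-- The bit carried by the pointer in the `k`-th period. -/
def bit (k : ℕ) : Bool := decide ((k - L.m - 1) / 2 % 2 = 1)

/-- The pointer at height `H` in the `k`-th period. -/
def ptr (k : ℕ) (H : ℤ) : Ptr :=
  if k ≤ L.m then .g (L.pend k)
  else if (k - L.m - 1) % 2 = 0 then .q (L.bit k) (L.last && decide (H ≤ L.α))
  else .c (L.bit k) L.last

/-- The message at the start of the `k`-th period. -/
def msg (k : ℕ) : Msg :=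
  if k ≤ L.m then .tick ((L.mark (2 ^ k)).map .K) (.g (L.pend k))
  else if (k - L.m - 1) % 2 = 0 then .tick none (.q (L.bit k) false)
  else .tick (some .Z) (.c (L.bit k) L.last)

/-- The row of the own marks of a level. -/
def row (y : ℤ) : Option Row := if y = 0 then some .Z else (L.mark y).map .K

/-- The pointers determined by the own marks of a level. -/
def lowS (k : ℕ) (t y : ℤ) : Option Ptr :=
  if y = 2 * 2 ^ k - t then some (L.ptr k (2 * 2 ^ k - t)) else none

def lowZ (k : ℕ) (t y : ℤ) : Zone :=
  ⟨if y < 2 * 2 ^ k - t then .a else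
    (L.ptr k (2 * 2 ^ k - t)).letter (L.up (2 * 2 ^ k - t - 1)), L.up y⟩

def lowV (k : ℕ) (t y : ℤ) : Option Msg :=
  if t = 2 ^ k then
    if k = 0 then none
    else if L.m + 2 ≤ k ∧ (k - L.m - 1) % 2 = 0 ∧ 2 ^ k ≤ 2 * y then some (.kill (L.bit k))
    else some (L.msg k)
  else if (L.ptr k (2 * 2 ^ k - t)).isQ ∧ 2 * 2 ^ k - t ≤ y then
    (L.mark (2 * 2 ^ k - t)).map .mu
  else none

/-- The part of a column determined by the own marks of a level. -/
def low (k : ℕ) (t y : ℤ) : Cell :=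
  if t < y then .blank
  else if y = t then .top (L.row y) (L.lowS k t y) (L.lowZ k t y)
  else .sky (L.row y) (L.lowS k t y) (L.lowV k t y) (L.lowZ k t y)

/-- The configuration around a birth, where `c` is the cell inside the child. -/
def around (b : Bool) (p q : ℤ) (c : Cell) : Cell :=
  if p < q then .blank
  else if p < 0 then
    if q = p then .top ((L.mark (-p)).map .M) none ⟨.b (L.up (-p - 1)), L.dn (-q)⟩
    else .sky ((L.mark (-q)).map .M) none ((L.mark (-p)).map .mu) ⟨.b (L.up (-p - 1)), L.dn (-q)⟩
  else if p = 0 then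
    if q = 0 then .top (some .Z) (some (.c b L.last)) ⟨.a, 0⟩
    else .sky ((L.mark (-q)).map .M) none (some (.tick (some .Z) (.c b L.last))) ⟨.a, L.dn (-q)⟩
  else if q < 0 then
    if p < -q then .sky ((L.mark (-q)).map .M) none none ⟨.a, L.dn (-q)⟩
    else .sky none (if p = -q then some (.c b L.last) else none)
      ((L.mark p).map fun k => .lam (iota b L.last k)) ⟨.o, L.dn (p + 1)⟩
  else c

end Label

/-- The column of a level at age `t`. -/
def lev (L : Label) (t y : ℤ) : Cell :=
  let k := Nat.log 2 t.toNat
  if k ≤ L.m then L.low k t y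
  else if (k - L.m - 1) % 2 = 0 then
    if y ≤ 2 ^ k then L.low k t y else L.around (L.bit k) (t - 2 * 2 ^ k) (y - 2 * 2 ^ k) .blank
  else if 2 * y < 2 ^ k then L.low k t y
  else L.around (L.bit k) (t - 2 ^ k) (y - 2 ^ k)
    (if _h : 0 < t - 2 ^ k then lev (L.child (L.bit k)) (t - 2 ^ k) (y - 2 ^ k) else .blank)
termination_by t.toNat
decreasing_by
  have : (0 : ℤ) < 2 ^ Nat.log 2 t.toNat := by positivity
  lia

namespace Label

variable (L : Label)

/-- The infinite configuration around a birth. -/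
def cell (b : Bool) (p q : ℤ) : Cell := L.around b p q (lev (L.child b) p q)

theorem log_eq {k : ℕ} {t : ℤ} (h1 : 2 ^ k ≤ t) (h2 : t < 2 * 2 ^ k) :
    Nat.log 2 t.toNat = k := by
  have h0 : (0 : ℤ) < 2 ^ k := by positivity
  obtain ⟨n, rfl⟩ := Int.eq_ofNat_of_zero_le (show 0 ≤ t by lia)
  rw [Int.toNat_natCast]
  apply (Nat.log_eq_iff (Or.inr ⟨by norm_num, by lia⟩)).2
  constructor
  · exact_mod_cast h1
  · rw [pow_succ]; zify; linarith

theorem exists_period {t : ℤ} (h : 1 ≤ t) : ∃ k : ℕ, 2 ^ k ≤ t ∧ t < 2 * 2 ^ k := by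
  obtain ⟨n, rfl⟩ := Int.eq_ofNat_of_zero_le (show 0 ≤ t by lia)
  refine ⟨Nat.log 2 n, ?_, ?_⟩
  · exact_mod_cast Nat.pow_log_le_self 2 (by lia)
  · have := Nat.lt_pow_succ_log_self (b := 2) (by norm_num) n
    rw [pow_succ] at this
    zify at this
    linarith

theorem around_congr (b : Bool) {p q : ℤ} (h : p ≤ 0 ∨ q < 0 ∨ p < q) (c c' : Cell) :
    L.around b p q c = L.around b p q c' := by
  unfold around
  split_ifs <;> first | rfl | lia

/-- The type of the `k`-th period. -/
inductive Ty (L : Label) (k : ℕ) : Prop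
  | g (h : k ≤ L.m)
  | q (h : L.m < k) (h' : (k - L.m - 1) % 2 = 0)
  | c (h : L.m < k) (h' : (k - L.m - 1) % 2 = 1)

theorem ty (k : ℕ) : L.Ty k := by
  by_cases h : k ≤ L.m
  · exact .g h
  · rcases Nat.mod_two_eq_zero_or_one (k - L.m - 1) with h' | h'
    · exact .q (by lia) h'
    · exact .c (by lia) h'

variable {L} {k : ℕ} {t y : ℤ}

theorem lev_g (h1 : 2 ^ k ≤ t) (h2 : t < 2 * 2 ^ k) (h : k ≤ L.m) : lev L t y = L.low k t y := by
  rw [lev]; simp [log_eq h1 h2, h]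

theorem lev_q_low (h1 : 2 ^ k ≤ t) (h2 : t < 2 * 2 ^ k)
    (h' : (k - L.m - 1) % 2 = 0) (hy : y ≤ 2 ^ k) : lev L t y = L.low k t y := by
  rw [lev]; simp [log_eq h1 h2, h', hy]

theorem lev_q_cell (h1 : 2 ^ k ≤ t) (h2 : t < 2 * 2 ^ k) (h : L.m < k)
    (h' : (k - L.m - 1) % 2 = 0) (hy : 2 ^ k < y) (b : Bool) :
    lev L t y = L.cell b (t - 2 * 2 ^ k) (y - 2 * 2 ^ k) := by
  rw [lev]; simp only [log_eq h1 h2, h', if_neg h.not_ge, if_true, if_neg hy.not_ge, cell]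
  unfold around
  split_ifs <;> first | rfl | lia

theorem lev_c_low (h1 : 2 ^ k ≤ t) (h2 : t < 2 * 2 ^ k)
    (h' : (k - L.m - 1) % 2 = 1) (hy : 2 * y < 2 ^ k) : lev L t y = L.low k t y := by
  rw [lev]; simp [log_eq h1 h2, h', hy]

theorem lev_c_cell (h1 : 2 ^ k ≤ t) (h2 : t < 2 * 2 ^ k) (h : L.m < k)
    (h' : (k - L.m - 1) % 2 = 1) (hy : 2 ^ k ≤ 2 * y) :
    lev L t y = L.cell (L.bit k) (t - 2 ^ k) (y - 2 ^ k) := by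
  rw [lev]; simp only [log_eq h1 h2, h', if_neg h.not_ge, if_neg hy.not_gt, cell, one_ne_zero,
    if_false]
  by_cases h0 : 0 < t - 2 ^ k
  · rw [dif_pos h0]
  · exact around_congr _ _ (Or.inl (by lia)) _ _

end Label
theorem Ptr.letter_ne (P : Ptr) (i : Fin 7) : P.letter i ≠ .a := by cases P <;> simp [letter]

theorem Rule.congr_SW {W NW SW SW' S C : Cell} (h : Rule W NW SW S C) (h1 : SW'.kd = SW.kd)
    (h2 : SW'.h = SW.h) (h3 : SW.h ≠ some .Z) : Rule W NW SW' S C := by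
  cases h with
  | blank hW hS hC => exact .blank hW hS hC
  | topIdle hSW hW hS hZ hv hC => exact .topIdle (h1.trans hSW) hW hS (h2 ▸ hZ) hv hC
  | topFirst b e hSW hW hS hZ hs hv hz hC => exact absurd hZ h3
  | topMu k t i i' hSW hW hS hZ hv hz ha hC =>
    exact .topMu k t i i' (h1.trans hSW) hW hS (h2 ▸ hZ) hv hz ha hC
  | topTick d l i z hSW hW hS hZ hv hz hl hC =>
    exact .topTick d l i z (h1.trans hSW) hW hS (h2 ▸ hZ) hv hz hl hC
  | topKill b hSW hW hS hZ hv hz hC => exact .topKill b (h1.trans hSW) hW hS (h2 ▸ hZ) hv hz hC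
  | free hW hS hv hP hz hC => exact .free hW hS hv hP hz hC
  | ptr P i i' hW hS hv hP hr hz hWz ha hC => exact .ptr P i i' hW hS hv hP hr hz hWz ha hC
  | qK b e k i i' hW hS hv hP hr hz hWz ha hC => exact .qK b e k i i' hW hS hv hP hr hz hWz ha hC
  | cM b e k i i' hW hS hv hP hr hz hWz ha hC => exact .cM b e k i i' hW hS hv hP hr hz hWz ha hC
  | tick P i hW hS hv hP hr hz hC => exact .tick P i hW hS hv hP hr hz hC
  | lamTick ι p i hW hS hv hP hr hz hC => exact .lamTick ι p i hW hS hv hP hr hz hC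
  | lam ι i i' hW hS hv hP hr hz hWz hi hC => exact .lam ι i i' hW hS hv hP hr hz hWz hi hC
  | mu k t t' i i' j hW hS hv hP hz hWz ht ha hC =>
    exact .mu k t t' i i' j hW hS hv hP hz hWz ht ha hC
  | tickPass d l i i' hW hS hv hP hz hWz ha hC => exact .tickPass d l i i' hW hS hv hP hz hWz ha hC
  | killStart b i hW hS hv hP hr hz hC => exact .killStart b i hW hS hv hP hr hz hC
  | kill b i hW hS hv hr hz hC => exact .kill b i hW hS hv hr hz hC

namespace Label

variable {L : Label} {k : ℕ} {t y : ℤ}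

theorem low_blank (h : t < y) : L.low k t y = .blank := by simp [low, h]

theorem low_top (h : y = t) :
    L.low k t y = .top (L.row y) (L.lowS k t y) (L.lowZ k t y) := by simp [low, h]

theorem low_sky (h : y < t) :
    L.low k t y = .sky (L.row y) (L.lowS k t y) (L.lowV k t y) (L.lowZ k t y) := by
  simp [low, h.not_gt, h.ne]

theorem low_kd_ne (h : y ≤ t) : (L.low k t y).kd ≠ .blank := by
  rcases h.lt_or_eq with h | h
  · simp [low_sky h]
  · simp [low_top h]

theorem low_h (h : y ≤ t) : (L.low k t y).h = L.row y := by
  rcases h.lt_or_eq with h | h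
  · simp [low_sky h]
  · simp [low_top h]

theorem low_z (h : y ≤ t) : (L.low k t y).z = L.lowZ k t y := by
  rcases h.lt_or_eq with h | h
  · simp [low_sky h]
  · simp [low_top h]

theorem low_s (h : 2 ^ k ≤ t) : (L.low k t y).s = L.lowS k t y := by
  rcases lt_trichotomy y t with h' | h' | h'
  · simp [low_sky h']
  · simp [low_top h']
  · rw [low_blank h', lowS, if_neg (by lia)]; rfl

theorem row_pos (h : 1 ≤ y) : L.row y = (L.mark y).map .K := by
  rw [row, if_neg (by lia)]

theorem lowZ_lt (h : y < 2 * 2 ^ k - t) : L.lowZ k t y = ⟨.a, L.up y⟩ := by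
  rw [lowZ, if_pos h]

theorem lowZ_ge (h : 2 * 2 ^ k - t ≤ y) : L.lowZ k t y =
    ⟨(L.ptr k (2 * 2 ^ k - t)).letter (L.up (2 * 2 ^ k - t - 1)), L.up y⟩ := by
  rw [lowZ, if_neg h.not_gt]

/-- Two successive columns of the same period. -/
theorem rule_low (h1 : 2 ^ k < t) (h2 : t < 2 * 2 ^ k) (hy : 1 ≤ y) (hk : y < t ∨ k ≤ L.m) :
    Rule (L.low k (t - 1) y) (L.low k (t - 1) (y + 1)) (L.low k (t - 1) (y - 1))
      (L.low k t (y - 1)) (L.low k t y) := by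
  have hD : (0 : ℤ) < 2 ^ k := by positivity
  rcases lt_trichotomy y t with hyt | hyt | hyt
  · have hW := low_kd_ne (L := L) (k := k) (show y ≤ t - 1 by lia)
    have hS : (L.low k t (y - 1)).kd = .sky := by simp [low_sky (show y - 1 < t by lia)]
    have hWh := low_h (L := L) (k := k) (show y ≤ t - 1 by lia)
    have hWz := low_z (L := L) (k := k) (show y ≤ t - 1 by lia)
    rw [row_pos hy] at hWh
    have hNs := low_s (L := L) (k := k) (y := y + 1) (show 2 ^ k ≤ t - 1 by lia)
    rw [lowS] at hNs
    have hSv : (L.low k t (y - 1)).v = L.lowV k t (y - 1) := by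
      simp [low_sky (show y - 1 < t by lia)]
    have hSz := low_z (L := L) (k := k) (show y - 1 ≤ t by lia)
    have hC := low_sky (L := L) (k := k) hyt
    rw [row_pos hy] at hC
    rw [lowV, if_neg h1.ne'] at hSv
    rw [lowV, if_neg h1.ne', lowS] at hC
    rcases lt_trichotomy y (2 * 2 ^ k - t) with hH | hH | hH
    · rw [if_neg (by lia)] at hNs
      rw [if_neg (by lia)] at hSv
      rw [if_neg (by lia), if_neg (by lia), lowZ_lt hH] at hC
      rw [lowZ_lt (by lia)] at hSz hWz
      refine .free hW hS hSv hNs ?_ (by rw [hC, hWh, hWz])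
      rw [hSz, hWz, hWh]
      exact .adv _ _ _ _ (L.adv_up y)
    · rw [if_pos (by lia), show 2 * 2 ^ k - (t - 1) = y + 1 by lia] at hNs
      rw [if_neg (by lia)] at hSv
      rw [if_pos (by lia), lowZ_ge (by lia), ← hH] at hC
      rw [lowZ_lt (by lia)] at hSz hWz
      rcases hm : L.mark y with _ | m
      · have hP : L.ptr k (y + 1) = L.ptr k y := by
          have : y ≠ L.α := by
            rintro rfl
            simp only [mark, if_true] at hm
            split_ifs at hm
          have hd : decide (y + 1 ≤ L.α) = decide (y ≤ L.α) := by
            rw [decide_eq_decide]; lia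
          simp only [ptr, hd]
        rw [hP] at hNs
        refine .ptr (L.ptr k y) (L.up (y - 1)) (L.up y) hW hS hSv hNs (Or.inl ?_) hSz hWz ?_ ?_
        · rw [hWh, hm]; rfl
        · rw [hWh]; exact L.adv_up y
        · rw [hC, hWh, hm]; simp
      · rcases L.ty k with h | ⟨h, h'⟩ | ⟨h, h'⟩
        · have hP : L.ptr k (y + 1) = L.ptr k y := by simp [ptr, h]
          rw [hP] at hNs
          have hQ : (L.ptr k y).isQ = false := by simp [ptr, h, Ptr.isQ]
          refine .ptr (L.ptr k y) (L.up (y - 1)) (L.up y) hW hS hSv hNs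
            (Or.inr ⟨⟨m, ?_⟩, hQ⟩) hSz hWz ?_ ?_
          · rw [hWh, hm]; rfl
          · rw [hWh]; exact L.adv_up y
          · rw [hC, hWh, hm]; simp [hQ]
        · have hP : L.ptr k (y + 1) = .q (L.bit k) (L.last && decide (y + 1 ≤ L.α)) := by
            simp [ptr, h.not_ge, h']
          have hP' : L.ptr k y = .q (L.bit k) (L.last && decide (y ≤ L.α)) := by
            simp [ptr, h.not_ge, h']
          have he : (L.last && decide (y ≤ L.α)) =
              ((L.last && decide (y + 1 ≤ L.α)) || decide (m = .B)) := by
            have e := L.α_eq_β_iff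
            have e2 := L.α_le_β
            have e3 := L.two_mul_β_le
            have e4 := L.two_le_α
            unfold mark at hm
            unfold last
            by_cases hj : L.j = L.n
            · have := e.2 hj
              simp only [hj, this, if_true] at hm ⊢
              split_ifs at hm <;> simp at hm <;> subst hm <;> simp <;> lia
            · have : L.α ≠ L.β := fun h => hj (e.1 h)
              simp only [this, if_false] at hm
              split_ifs at hm <;> simp at hm <;> subst hm <;> simp [hj]
          rw [hP] at hNs
          refine .qK _ _ m (L.up (y - 1)) (L.up y) hW hS hSv hNs ?_ hSz hWz ?_ ?_
          · rw [hWh, hm]; rfl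
          · rw [hWh]; exact L.adv_up y
          · rw [hC, hWh, hP', hm, he]; simp [Ptr.isQ, Ptr.letter]
        · have hP (y) : L.ptr k y = .c (L.bit k) L.last := by
            simp [ptr, h.not_ge, h']
          rw [hP] at hNs
          refine .ptr _ (L.up (y - 1)) (L.up y) hW hS hSv hNs
            (Or.inr ⟨⟨m, ?_⟩, ?_⟩) hSz hWz ?_ ?_
          · rw [hWh, hm]; rfl
          · rfl
          · rw [hWh]; exact L.adv_up y
          · rw [hC, hWh, hm]; simp [hP, Ptr.isQ]
    · rw [if_neg (by lia)] at hNs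
      rw [if_neg (by lia), lowZ_ge (by lia)] at hC
      rw [lowZ_ge (by lia)] at hSz hWz
      have hup : 2 * 2 ^ k - (t - 1) - 1 = 2 * 2 ^ k - t := by ring
      have hb : (2 * 2 ^ k - t ≤ y - 1) = True := by simp; lia
      have hb' : (2 * 2 ^ k - t ≤ y) = True := by simp; lia
      rw [hup] at hWz
      simp only [hb, hb', and_true] at hSv hC
      rcases L.ty k with h | ⟨h, h'⟩ | ⟨h, h'⟩
      · have hP (H) : L.ptr k H = .g (L.pend k) := by simp [ptr, h]
        rw [hP] at hSv hC hSz hWz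
        simp only [Ptr.isQ, Ptr.letter, Bool.false_eq_true, if_false] at hSv hC hSz hWz
        refine .free hW hS hSv hNs ?_ (by rw [hC, hWh, hWz])
        rw [hSz, hWz, hWh]
        exact .adv _ _ _ _ (L.adv_up y)
      · have hP (H) : L.ptr k H = .q (L.bit k) (L.last && decide (H ≤ L.α)) := by
          simp [ptr, h.not_ge, h']
        rw [hP] at hSv hC hSz hWz
        simp only [Ptr.isQ, Ptr.letter, if_true] at hSv hC hSz hWz
        rcases hm : L.mark (2 * 2 ^ k - t) with _ | m
        · rw [hm] at hSv hC
          refine .free hW hS hSv hNs ?_ (by rw [hC, hWh, hWz, L.up_eq hm]; rfl)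
          rw [hSz, hWz, hWh, L.up_eq hm]
          exact .adv _ _ _ _ (L.adv_up y)
        · rw [hm] at hSv hC
          refine .mu m _ _ _ _ _ hW hS hSv hNs hSz hWz (L.up_lt hm) ?_ (by rw [hC, hWh]; rfl)
          rw [hWh]; exact L.adv_up y
      · have hP (H) : L.ptr k H = .c (L.bit k) L.last := by simp [ptr, h.not_ge, h']
        rw [hP] at hSv hC hSz hWz
        simp only [Ptr.isQ, Ptr.letter, Bool.false_eq_true, if_false] at hSv hC hSz hWz
        refine .free hW hS hSv hNs ?_ (by rw [hC, hWh, hWz])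
        rw [hSz, hWz, hWh]
        exact .adv _ _ _ _ (L.adv_up y)
  · have h : k ≤ L.m := by lia
    have hP (H) : L.ptr k H = .g (L.pend k) := by simp [ptr, h]
    have hc : L.mark y = none := by
      rcases hm : L.mark y with _ | m
      · rfl
      · obtain ⟨i, hi, rfl⟩ := L.mark_pow hm
        have a1 : k < i := (pow_lt_pow_iff_right₀ (show (1 : ℤ) < 2 by norm_num)).1 (by lia)
        have a2 : i < k + 1 :=
          (pow_lt_pow_iff_right₀ (show (1 : ℤ) < 2 by norm_num)).1 (by rw [pow_succ]; lia)
        lia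
    refine .topIdle ?_ ?_ ?_ ?_ ?_ ?_
    · simp [low_top (show y - 1 = t - 1 by lia)]
    · simp [low_blank (show t - 1 < y by lia)]
    · simp [low_sky (show y - 1 < t by lia)]
    · rw [low_h (by lia), row_pos (by lia)]
      cases L.mark (y - 1) <;> simp
    · simp [low_sky (show y - 1 < t by lia), lowV, hP, Ptr.isQ, h1.ne']
    · rw [low_z (by lia), low_top hyt, row_pos hy, hc, lowS, if_neg (by lia), lowZ_ge (by lia),
        lowZ_ge (by lia), L.up_eq hc]
      rfl
  · refine .blank ?_ ?_ (low_blank hyt)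
    · simp [low_blank (show t - 1 < y by lia)]
    · rcases (show t ≤ y - 1 by lia).lt_or_eq with h | h
      · simp [low_blank h]
      · simp [low_top h.symm]

/-- The passage from one period to the next below the top. -/
theorem rule_low_tick {NW SW : Cell} (h1 : 1 ≤ y) (h2 : y < 2 * 2 ^ k) (hN : NW.s = none)
    (hk : L.m + 1 ≤ k → (k - L.m) % 2 = 0 → y < 2 ^ k) :
    Rule (L.low k (2 * 2 ^ k - 1) y) NW SW
      (L.low (k + 1) (2 * 2 ^ k) (y - 1)) (L.low (k + 1) (2 * 2 ^ k) y) := by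
  have hD : (1 : ℤ) ≤ 2 ^ k := one_le_pow₀ (by norm_num)
  have hS := low_sky (L := L) (k := k + 1) (show y - 1 < 2 * 2 ^ k by lia)
  have hC := low_sky (L := L) (k := k + 1) (show y < 2 * 2 ^ k by lia)
  have e : (2 : ℤ) ^ (k + 1) = 2 * 2 ^ k := by ring
  have hv (y' : ℤ) (h : y' ≤ y) : L.lowV (k + 1) (2 * 2 ^ k) y' = some (L.msg (k + 1)) := by
    rw [lowV, if_pos (by rw [e]), if_neg (by simp), if_neg]
    rintro ⟨a, b, c⟩
    have := hk (by lia) (by simpa [show k + 1 - L.m - 1 = k - L.m by lia] using b)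
    lia
  have hz (y' : ℤ) (h : y' ≤ y) : L.lowZ (k + 1) (2 * 2 ^ k) y' = ⟨.a, L.up y'⟩ :=
    lowZ_lt (by lia)
  have hs : L.lowS (k + 1) (2 * 2 ^ k) y = none := by rw [lowS, if_neg (by lia)]
  rw [hv _ (by lia), hz _ (by lia)] at hS
  rw [hv _ (by lia), hz _ (by lia), hs] at hC
  have hm : ∃ d l, L.msg (k + 1) = .tick d l := by
    unfold msg; split_ifs <;> exact ⟨_, _, rfl⟩
  obtain ⟨d, l, hm⟩ := hm
  rw [hm] at hC hS
  refine .tickPass d l (L.up (y - 1)) (L.up y) (low_kd_ne (by lia)) (by rw [hS]; rfl)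
    (by rw [hS]; rfl) hN (by rw [hS]; rfl) ?_ ?_ ?_
  · rw [low_z (by lia), lowZ_ge (by lia)]
    exact Ptr.letter_ne _ _
  · rw [low_h (by lia), row_pos h1]
    exact L.adv_up y
  · rw [low_h (by lia), hC]

/-- The passage from one growth period to the next at the top. -/
theorem rule_low_tick_top (hk : k ≤ L.m) :
    Rule (L.low k (2 * 2 ^ k - 1) (2 * 2 ^ k)) (L.low k (2 * 2 ^ k - 1) (2 * 2 ^ k + 1))
      (L.low k (2 * 2 ^ k - 1) (2 * 2 ^ k - 1))
      (L.low (k + 1) (2 * 2 ^ k) (2 * 2 ^ k - 1)) (L.low (k + 1) (2 * 2 ^ k) (2 * 2 ^ k)) := by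
  have hD : (1 : ℤ) ≤ 2 ^ k := one_le_pow₀ (by norm_num)
  have e : (2 : ℤ) ^ (k + 1) = 2 * 2 ^ k := by ring
  have hS := low_sky (L := L) (k := k + 1) (show 2 * 2 ^ k - 1 < 2 * 2 ^ k by lia)
  have hC := low_top (L := L) (k := k + 1) (t := 2 * 2 ^ k) rfl
  have hv : L.lowV (k + 1) (2 * 2 ^ k) (2 * 2 ^ k - 1) = some (L.msg (k + 1)) := by
    rw [lowV, if_pos (by rw [e]), if_neg (by simp), if_neg]
    lia
  rw [hv, lowZ_lt (by lia)] at hS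
  rw [lowS, if_pos (by lia), lowZ_ge (by lia), row_pos (by lia),
    show 2 * 2 ^ (k + 1) - 2 * 2 ^ k = (2 : ℤ) * 2 ^ k by lia] at hC
  have hg := L.two_mul_β_le
  have hg1 := L.two_le_α
  have hg2 := L.α_le_β
  have key : ∃ d l, L.msg (k + 1) = .tick d l ∧ L.ptr (k + 1) (2 * 2 ^ k) = l ∧
      (L.mark (2 * 2 ^ k)).map .K = d ∧
      Launch d l (L.up (2 * 2 ^ k - 1)) ⟨l.letter (L.up (2 * 2 ^ k - 1)), L.up (2 * 2 ^ k)⟩ := by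
    rcases hk.lt_or_eq with h | h
    · refine ⟨_, _, ?_, rfl, rfl, ?_⟩
      · simp [msg, ptr, show k + 1 ≤ L.m from h, e]
      · simp only [ptr, show k + 1 ≤ L.m from h, if_true]
        refine .g _ _ _ _ ?_ (L.adv_up _)
        intro k
        cases L.mark (2 * 2 ^ _) <;> simp
    · have hγ : L.γ = 2 ^ k := by rw [h]; rfl
      refine ⟨none, _, ?_, rfl, ?_, ?_⟩
      · simp [msg, ptr, ← h, show ¬ 2 * 2 ^ k ≤ L.α by lia]
      · rw [L.mark_big (by lia)]; rfl
      · have : L.ptr (k + 1) (2 * 2 ^ k) = .q (L.bit (k + 1)) false := by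
          simp [ptr, ← h, show ¬ 2 * 2 ^ k ≤ L.α by lia]
        rw [this, L.up_big (y := 2 * 2 ^ k - 1) (by lia), L.up_big (y := 2 * 2 ^ k) (by lia)]
        exact .q _ _
  obtain ⟨d, l, hm, hl, hd, hL⟩ := key
  rw [hm] at hS
  rw [hl, hd] at hC
  refine .topTick d l _ _ ?_ ?_ ?_ ?_ ?_ ?_ hL hC
  · simp [low_top]
  · simp [low_blank (show (2 : ℤ) * 2 ^ k - 1 < 2 * 2 ^ k by lia)]
  · rw [hS]; rfl
  · rw [low_h (by lia), row_pos (by lia)]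
    cases L.mark (2 * 2 ^ k - 1) <;> simp
  · rw [hS]; rfl
  · rw [hS]; rfl

end Label
namespace Label

variable {L : Label} {b : Bool} {k : ℕ} {t y p q : ℤ}

theorem cell_blank (h : p < q) : L.cell b p q = .blank := by simp [cell, around, h]

theorem cell_neg_top (h : p < 0) (hq : q = p) : L.cell b p q =
    .top ((L.mark (-p)).map .M) none ⟨.b (L.up (-p - 1)), L.dn (-q)⟩ := by
  simp [cell, around, h, hq]

theorem cell_neg (h : p < 0) (hq : q < p) : L.cell b p q = .sky ((L.mark (-q)).map .M) none
    ((L.mark (-p)).map .mu) ⟨.b (L.up (-p - 1)), L.dn (-q)⟩ := by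
  simp [cell, around, h, hq.not_gt, hq.ne]

theorem cell_zero_top : L.cell b 0 0 = .top (some .Z) (some (.c b L.last)) ⟨.a, 0⟩ := by
  simp [cell, around]

theorem cell_zero (h : q < 0) : L.cell b 0 q = .sky ((L.mark (-q)).map .M) none
    (some (.tick (some .Z) (.c b L.last))) ⟨.a, L.dn (-q)⟩ := by
  simp [cell, around, h.not_gt, h.ne]

theorem cell_a (h : 0 < p) (hq : p < -q) :
    L.cell b p q = .sky ((L.mark (-q)).map .M) none none ⟨.a, L.dn (-q)⟩ := by
  simp [cell, around, h.not_gt, h.ne', hq, show ¬ p < q by lia, show q < 0 by lia]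

theorem cell_o (h : 0 < p) (hq : q < 0) (hpq : -q ≤ p) : L.cell b p q =
    .sky none (if p = -q then some (.c b L.last) else none)
      ((L.mark p).map fun k => .lam (iota b L.last k)) ⟨.o, L.dn (p + 1)⟩ := by
  simp [cell, around, h.not_gt, h.ne', hq, show ¬ p < q by lia, show ¬ p < -q by lia]

theorem cell_lev (h : 0 < p) (hq : 0 ≤ q) (hpq : q ≤ p) :
    L.cell b p q = lev (L.child b) p q := by
  simp [cell, around, h.not_gt, h.ne', hq.not_gt, hpq.not_gt]

theorem eight_le (h : L.m < k) : 8 ≤ (2 : ℤ) ^ k := by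
  have := L.γ_le_pow (k := k) (i := 1) (by lia)
  have := L.two_le_α; have := L.α_le_β; have := L.two_mul_β_le
  lia

theorem lev_blank (h0 : 1 ≤ t) (h : t < y) : lev L t y = .blank := by
  obtain ⟨k, h1, h2⟩ := exists_period h0
  rcases L.ty k with h' | ⟨h', h''⟩ | ⟨h', h''⟩
  · rw [lev_g h1 h2 h', low_blank h]
  · rw [lev_q_cell h1 h2 h' h'' (by lia) false, cell_blank (by lia)]
  · rw [lev_c_cell h1 h2 h' h'' (by lia), cell_blank (by lia)]

theorem lev_low (h1 : 2 ^ k ≤ t) (h2 : t < 2 * 2 ^ k) (hy : y ≤ 1) : lev L t y = L.low k t y := by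
  have : (1 : ℤ) ≤ 2 ^ k := one_le_pow₀ (by norm_num)
  rcases L.ty k with h' | ⟨h', h''⟩ | ⟨h', h''⟩
  · rw [lev_g h1 h2 h']
  · rw [lev_q_low h1 h2 h'' (by lia)]
  · have := eight_le h'
    rw [lev_c_low h1 h2 h'' (by lia)]

theorem lev_zero (h1 : 2 ^ k ≤ t) (h2 : t < 2 * 2 ^ k) : lev L t 0 = .sky (some .Z) none
    (if t = 2 ^ k ∧ k ≠ 0 then some (L.msg k) else none) ⟨.a, 0⟩ := by
  have h0 : (1 : ℤ) ≤ 2 ^ k := one_le_pow₀ (by norm_num)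
  rw [lev_low h1 h2 (by lia), low_sky (by lia), lowZ_lt (by lia), lowS, if_neg (by lia), L.up_zero,
    lowV, row, if_pos rfl]
  congr 1
  split_ifs <;> first | rfl | lia

theorem lev_one_s (h1 : 2 ^ k ≤ t) (h2 : t < 2 * 2 ^ k) : (lev L t 1).s =
    if t = 2 * 2 ^ k - 1 then some (L.ptr k 1) else none := by
  rw [lev_low h1 h2 (by lia), low_s h1, lowS]
  by_cases h : t = 2 * 2 ^ k - 1
  · rw [if_pos (by lia), if_pos h, show 2 * 2 ^ k - t = 1 by lia]
  · rw [if_neg (by lia), if_neg h]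

theorem lev_one (hL : y ≤ 1) : lev L 1 y = L.low 0 1 y := lev_low (by norm_num) (by norm_num) hL

theorem child_cases (L : Label) (b : Bool) :
    (L.j < L.n ∧ (L.child b).j = L.j + 1 ∧ (L.child b).n = L.n ∧ (L.child b).m = L.m + 1) ∨
    (L.j = L.n ∧ b = true ∧ (L.child b).j = 1 ∧ (L.child b).n = L.m ∧ (L.child b).m = L.m + 1) ∨
    (L.j = L.n ∧ b = false ∧ (L.child b).j = 1 ∧ (L.child b).n = L.n ∧
      (L.child b).m = L.m + 1) := by
  have h2 := L.hn
  unfold child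
  split_ifs with h hb
  · simp [h]
  · exact Or.inr (Or.inl ⟨by lia, hb, rfl, rfl, rfl⟩)
  · exact Or.inr (Or.inr ⟨by lia, by simpa using hb, rfl, rfl, rfl⟩)

theorem bit_succ (h : L.m < k) (h' : (k - L.m - 1) % 2 = 0) : L.bit (k + 1) = L.bit k := by
  simp only [bit, decide_eq_decide]; lia

theorem bit_succ' (h : L.m < k) (h' : (k - L.m - 1) % 2 = 1) : L.bit (k + 1) = !L.bit k := by
  rw [bit, bit, ← decide_not, decide_eq_decide]; lia

theorem tick_ptr (hm : L.mark (2 ^ (k + 1)) = none) :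
    ((L.child b).ptr k 1).tick none = (L.child b).msg (k + 1) := by
  rw [mark_eq_pow] at hm
  have h1 := L.hj; have h2 := L.hn; have h3 := L.hm
  have hL := L.child_cases b
  generalize L.child b = L' at hL ⊢
  have g1 := L'.hj; have g2 := L'.hn; have g3 := L'.hm
  have hα : decide (1 ≤ L'.α) = true := by
    have := L'.two_le_α
    simp; lia
  simp only [ptr, hα, msg, mark_eq_pow]
  rcases L'.ty k with h | ⟨h, h'⟩ | ⟨h, h'⟩
  · rcases h.lt_or_eq with h | h
    · simp only [h.le, show k + 1 ≤ L'.m from h, if_true, Ptr.tick, pend, h.ne, if_false]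
      split_ifs at hm
      split_ifs <;> first | rfl | (exfalso; lia)
    · subst h
      simp [pend, Ptr.tick, growTick, bit, show L'.m + 1 ≠ L'.j by lia]
  · simp only [h.not_ge, show ¬ k + 1 ≤ L'.m by lia, show ¬ (k + 1 - L'.m - 1) % 2 = 0 by lia, h',
      if_true, if_false, Ptr.tick, bit_succ h h', Bool.and_true]
  · simp only [h.not_ge, show ¬ k + 1 ≤ L'.m by lia, show (k + 1 - L'.m - 1) % 2 = 0 by lia, h',
      if_true, if_false, Ptr.tick, bit_succ' h h', one_ne_zero]

theorem tick_ptr_some {c : Kd} (hm : L.mark (2 ^ (k + 1)) = some c) :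
    ∃ P, (L.child b).ptr k 1 = .g P ∧
      growTick P (some (iota b L.last c)) = (L.child b).msg (k + 1) := by
  rw [mark_eq_pow] at hm
  have h1 := L.hj; have h2 := L.hn; have h3 := L.hm
  have hL := L.child_cases b
  generalize L.child b = L' at hL ⊢
  have g1 := L'.hj; have g2 := L'.hn; have g3 := L'.hm
  have hk : k < L'.m := by
    split_ifs at hm <;> lia
  refine ⟨L'.pend k, by simp [ptr, hk.le], ?_⟩
  simp only [msg, mark_eq_pow, show k + 1 ≤ L'.m from hk, if_true, pend, hk.ne, if_false, last]
  rcases hL with ⟨a1, a2, a3, a4⟩ | ⟨a1, rfl, a2, a3, a4⟩ | ⟨a1, rfl, a2, a3, a4⟩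
  · simp only [a1.ne, a2, a3, a4, if_false, decide_false] at hm ⊢
    split_ifs at hm <;> simp only [Option.some.injEq] at hm <;> subst hm <;>
      split_ifs <;> first | (exfalso; lia) | (cases b <;> rfl)
  · simp only [a1, a2, a3, a4, if_true, decide_true] at hm ⊢
    split_ifs at hm <;> simp only [Option.some.injEq] at hm <;> subst hm <;>
      split_ifs <;> first | rfl | (exfalso; lia)
  · simp only [a1, a2, a3, a4, if_true, decide_true] at hm ⊢
    split_ifs at hm <;> simp only [Option.some.injEq] at hm <;> subst hm <;>
      split_ifs <;> first | rfl | (exfalso; lia)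

end Label
/-- The local rule at age `t` and height `y` of a level. -/
def LevRule (L : Label) (t y : ℤ) : Prop :=
  Rule (lev L (t - 1) y) (lev L (t - 1) (y + 1)) (lev L (t - 1) (y - 1)) (lev L t (y - 1))
    (lev L t y)

namespace Label

variable {L : Label} {b : Bool} {k : ℕ} {t y p q : ℤ}

theorem map_M_ne (m : Option Kd) : m.map Row.M ≠ some .Z := by cases m <;> simp

theorem map_K_ne (m : Option Kd) : m.map Row.K ≠ some .Z := by cases m <;> simp

theorem cell_lev' (h : 0 < p) (hq : 0 ≤ q) : L.cell b p q = lev (L.child b) p q := by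
  rcases le_or_gt q p with hpq | hpq
  · exact cell_lev h hq hpq
  · rw [cell_blank hpq, lev_blank (by lia) hpq]

theorem low_kd : (L.low k t y).kd = if t < y then .blank else if y = t then .top else .sky := by
  unfold low
  split_ifs <;> rfl

theorem cell_kd_aux (h : 0 < p → (lev (L.child b) p q).kd =
      if p < q then .blank else if q = p then .top else .sky) :
    (L.cell b p q).kd = if p < q then .blank else if q = p then .top else .sky := by
  by_cases h0 : 0 < p ∧ 0 ≤ q
  · rw [cell_lev' h0.1 h0.2, h h0.1]
  · simp only [cell, around]
    split_ifs <;> first | rfl | lia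

theorem lev_kd (ht : 1 ≤ t) :
    (lev L t y).kd = if t < y then .blank else if y = t then .top else .sky := by
  obtain ⟨n, hn⟩ : ∃ n : ℕ, t.toNat = n := ⟨_, rfl⟩
  induction n using Nat.strong_induction_on generalizing L t y with
  | _ n ih =>
    obtain ⟨k, h1, h2⟩ := exists_period ht
    have h0 : (1 : ℤ) ≤ 2 ^ k := one_le_pow₀ (by norm_num)
    rcases L.ty k with h | ⟨h, h'⟩ | ⟨h, h'⟩
    · rw [lev_g h1 h2 h, low_kd]
    · rcases le_or_gt y (2 ^ k) with hy | hy
      · rw [lev_q_low h1 h2 h' hy, low_kd]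
      · rw [lev_q_cell h1 h2 h h' hy false, cell_kd_aux (fun _ => by lia)]
        simp
    · rcases le_or_gt (2 ^ k) (2 * y) with hy | hy
      · rw [lev_c_cell h1 h2 h h' hy,
          cell_kd_aux (fun hp => ih (t - 2 ^ k).toNat (by lia) (by lia) rfl)]
        simp
      · rw [lev_c_low h1 h2 h' hy, low_kd]

theorem cell_kd : (L.cell b p q).kd = if p < q then .blank else if q = p then .top else .sky :=
  cell_kd_aux fun h => lev_kd (by lia)

/-- The local rule around a birth. -/
theorem rule_cell (h : 2 ≤ p → ∀ y, 1 ≤ y → LevRule (L.child b) p y) :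
    Rule (L.cell b (p - 1) q) (L.cell b (p - 1) (q + 1)) (L.cell b (p - 1) (q - 1))
      (L.cell b p (q - 1)) (L.cell b p q) := by
  rcases lt_or_ge p q with hpq | hpq
  · refine .blank ?_ ?_ (cell_blank hpq)
    · rw [cell_blank (by lia)]; rfl
    · rw [cell_kd]
      split_ifs <;> first | (exfalso; lia) | simp
  rcases lt_trichotomy p 0 with h0 | rfl | h0
  · rcases hpq.lt_or_eq with hpq | rfl
    · have hW : L.cell b (p - 1) q ≠ .blank ∧ (L.cell b (p - 1) q).kd ≠ .blank ∧
          (L.cell b (p - 1) q).h = (L.mark (-q)).map .M ∧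
          (L.cell b (p - 1) q).z = ⟨.b (L.up (-p)), L.dn (-q)⟩ := by
        rcases (show q ≤ p - 1 by lia).lt_or_eq with h' | h'
        · rw [cell_neg (by lia) h']; simp
        · rw [cell_neg_top (by lia) h']; simp [h']
      obtain ⟨-, hW, hWh, hWz⟩ := hW
      have hNs : (L.cell b (p - 1) (q + 1)).s = none := by
        rcases lt_trichotomy (q + 1) (p - 1) with h' | h' | h'
        · simp [cell_neg (show p - 1 < 0 by lia) h']
        · simp [cell_neg_top (show p - 1 < 0 by lia) h']
        · simp [cell_blank h']
      have hS := cell_neg (L := L) (b := b) h0 (show q - 1 < p by lia)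
      have hC := cell_neg (L := L) (b := b) h0 hpq
      rw [show -(q - 1) = -q + 1 by ring] at hS
      rcases hm : L.mark (-p) with _ | m
      · rw [hm] at hS hC
        refine .free hW (by rw [hS]; rfl) (by rw [hS]; rfl) hNs ?_ ?_
        · rw [hS, hWh, hWz, L.up_eq hm]
          exact .adv _ _ _ _ (L.adv_dn _)
        · rw [hC, hWh, hWz, L.up_eq hm]; rfl
      · rw [hm] at hS hC
        refine .mu m _ _ _ _ _ hW (by rw [hS]; rfl) (by rw [hS]; rfl) hNs (by rw [hS]; rfl) hWz
          (L.up_lt hm) ?_ (by rw [hC, hWh]; rfl)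
        rw [hWh]; exact L.adv_dn _
    · have hSW := cell_neg_top (L := L) (b := b) (show q - 1 < 0 by lia) rfl
      have hS := cell_neg (L := L) (b := b) h0 (show q - 1 < q by lia)
      have hC := cell_neg_top (L := L) (b := b) h0 (show q = q from rfl)
      rw [show -(q - 1) = -q + 1 by ring] at hS
      have hZ : (L.cell b (q - 1) (q - 1)).h ≠ some .Z := by rw [hSW]; exact map_M_ne _
      have hW : (L.cell b (q - 1) q).kd = .blank := by rw [cell_blank (by lia)]; rfl
      rcases hm : L.mark (-q) with _ | m
      · rw [hm] at hS hC
        refine .topIdle (by rw [hSW]; rfl) hW (by rw [hS]; rfl) hZ (by rw [hS]; rfl) ?_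
        rw [hC, hS, L.dn_eq hm]; rfl
      · rw [hm] at hS hC
        exact .topMu m _ _ _ (by rw [hSW]; rfl) hW (by rw [hS]; rfl) hZ (by rw [hS]; rfl)
          (by rw [hS]; rfl) (L.adv_dn' hm) hC
  · rcases hpq.lt_or_eq with hq | rfl
    · have hW : (L.cell b (0 - 1) q).kd ≠ .blank ∧
          (L.cell b (0 - 1) q).h = (L.mark (-q)).map .M ∧
          (L.cell b (0 - 1) q).z = ⟨.b (L.up 0), L.dn (-q)⟩ := by
        rcases (show q ≤ 0 - 1 by lia).lt_or_eq with h' | h'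
        · rw [cell_neg (by lia) h']; simp
        · rw [cell_neg_top (by lia) h']; simp [h']
      obtain ⟨hW, hWh, hWz⟩ := hW
      have hNs : (L.cell b (0 - 1) (q + 1)).s = none := by
        rw [zero_sub]
        rcases lt_trichotomy (q + 1) (-1) with h' | h' | h'
        · simp [cell_neg (show (-1 : ℤ) < 0 by lia) h']
        · simp [cell_neg_top (show (-1 : ℤ) < 0 by lia) h']
        · simp [cell_blank h']
      have hS := cell_zero (L := L) (b := b) (show q - 1 < 0 by lia)
      have hC := cell_zero (L := L) (b := b) hq
      rw [show -(q - 1) = -q + 1 by ring] at hS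
      refine .tickPass _ _ _ _ hW (by rw [hS]; rfl) (by rw [hS]; rfl) hNs (by rw [hS]; rfl)
        (by rw [hWz]; simp) ?_ (by rw [hC, hWh])
      rw [hWh]; exact L.adv_dn _
    · have hSW := cell_neg_top (L := L) (b := b) (show (0 : ℤ) - 1 < 0 by lia) rfl
      have hS := cell_zero (L := L) (b := b) (show (0 : ℤ) - 1 < 0 by lia)
      have hZ : (L.cell b (0 - 1) (0 - 1)).h ≠ some .Z := by rw [hSW]; exact map_M_ne _
      have hW : (L.cell b (0 - 1) 0).kd = .blank := by rw [cell_blank (by lia)]; rfl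
      refine .topTick _ _ _ _ (by rw [hSW]; rfl) hW (by rw [hS]; rfl) hZ (by rw [hS]; rfl)
          (by rw [hS]; rfl) ?_ cell_zero_top
      rw [show -((0 : ℤ) - 1) = 1 by ring, L.dn_one]
      exact .c _ _
  rcases lt_or_ge q 0 with hq | hq
  · rcases lt_or_ge p (-q) with hd | hd
    · have hW : (L.cell b (p - 1) q).kd ≠ .blank ∧
          (L.cell b (p - 1) q).h = (L.mark (-q)).map .M ∧
          (L.cell b (p - 1) q).z = ⟨.a, L.dn (-q)⟩ := by
        rcases (show 0 ≤ p - 1 by lia).lt_or_eq with h' | h'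
        · rw [cell_a h' (by lia)]; simp
        · rw [← h', cell_zero hq]; simp
      obtain ⟨hW, hWh, hWz⟩ := hW
      have hNs : (L.cell b (p - 1) (q + 1)).s = none := by
        rcases (show 0 ≤ p - 1 by lia).lt_or_eq with h' | h'
        · rw [cell_a h' (by lia)]; simp
        · rw [← h', cell_zero (by lia)]; simp
      have hS := cell_a (L := L) (b := b) h0 (show p < -(q - 1) by lia)
      have hC := cell_a (L := L) (b := b) h0 hd
      rw [show -(q - 1) = -q + 1 by ring] at hS
      refine .free hW (by rw [hS]; rfl) (by rw [hS]; rfl) hNs ?_ ?_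
      · rw [hS, hWh, hWz]
        exact .adv _ _ _ _ (L.adv_dn _)
      · rw [hC, hWh, hWz]
    rcases hd.lt_or_eq with hd | hd
    · have hW := cell_o (L := L) (b := b) (show 0 < p - 1 by lia) hq (by lia)
      rw [show p - 1 + 1 = p by ring] at hW
      have hNs : (L.cell b (p - 1) (q + 1)).s = none := by
        rcases (show q + 1 ≤ 0 by lia).lt_or_eq with h' | h'
        · rw [cell_o (by lia) h' (by lia), if_neg (by lia)]; rfl
        · rw [h', cell_lev (by lia) le_rfl (by lia)]
          obtain ⟨k, h1, h2⟩ := exists_period (t := p - 1) (by lia)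
          rw [lev_zero h1 h2]; rfl
      have hS := cell_o (L := L) (b := b) h0 (show q - 1 < 0 by lia) (by lia)
      have hC := cell_o (L := L) (b := b) h0 hq hd.le
      rw [if_neg (by lia)] at hC
      rcases hm : L.mark p with _ | m
      · rw [hm] at hS hC
        refine .free (by rw [hW]; simp) (by rw [hS]; rfl) (by rw [hS]; rfl) hNs ?_ ?_
        · rw [hS, hW, L.dn_eq hm]
          exact .adv _ _ _ _ (.idle _)
        · rw [hC, hW, L.dn_eq hm]; rfl
      · rw [hm] at hS hC
        exact .lam _ _ _ (by rw [hW]; simp) (by rw [hS]; rfl) (by rw [hS]; rfl) hNs (by rw [hW]; rfl)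
          (by rw [hS]; rfl) (by rw [hW]; rfl) (L.dn_lt hm) hC
    · obtain rfl : q = -p := by lia
      have hW : (L.cell b (p - 1) (-p)).kd ≠ .blank ∧
          (L.cell b (p - 1) (-p)).h = (L.mark p).map .M ∧
          (L.cell b (p - 1) (-p)).z = ⟨.a, L.dn p⟩ := by
        rcases (show 0 ≤ p - 1 by lia).lt_or_eq with h' | h'
        · rw [cell_a h' (by lia)]; simp
        · rw [← h', cell_zero hq]; simp
      obtain ⟨hW, hWh, hWz⟩ := hW
      have hNs : (L.cell b (p - 1) (-p + 1)).s = some (.c b L.last) := by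
        rcases (show 0 ≤ p - 1 by lia).lt_or_eq with h' | h'
        · rw [cell_o h' (by lia) (by lia), if_pos (by lia)]; rfl
        · rw [← h', show -p + 1 = 0 by lia, cell_zero_top]; rfl
      have hS := cell_a (L := L) (b := b) h0 (show p < -(-p - 1) by lia)
      have hC := cell_o (L := L) (b := b) h0 hq (by lia)
      rw [if_pos (by lia)] at hC
      rw [show -(-p - 1) = p + 1 by ring] at hS
      have ha := L.adv_dn p
      rw [← hWh] at ha
      rcases hm : L.mark p with _ | m
      · rw [hm] at hC hWh
        refine .ptr _ _ _ hW (by rw [hS]; rfl) (by rw [hS]; rfl) hNs (Or.inl hWh) (by rw [hS]; rfl)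
          hWz ha ?_
        rw [hC, hWh, ← L.dn_eq hm]; rfl
      · rw [hm] at hC hWh
        exact .cM _ _ m _ _ hW (by rw [hS]; rfl) (by rw [hS]; rfl) hNs hWh (by rw [hS]; rfl)
          hWz ha hC
  rcases hq.lt_or_eq with hq | rfl
  · rcases (show 1 ≤ p by lia).lt_or_eq with h1 | rfl
    · have := h (by lia) q (by lia)
      rwa [LevRule, ← cell_lev' (by lia) (by lia), ← cell_lev' (by lia) (by lia),
        ← cell_lev' (by lia) (by lia), ← cell_lev' (by lia) (by lia),
        ← cell_lev' (by lia) (by lia)] at this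
    · obtain rfl : q = 1 := by lia
      have hS : L.cell b 1 (1 - 1) = .sky (some .Z) none none ⟨.a, 0⟩ := by
        rw [cell_lev (by lia) (by lia) (by lia), sub_self,
          lev_zero (k := 0) (by norm_num) (by norm_num)]
        simp
      have hC : L.cell b 1 1 = .top none (some (.g (if L.last then .J else .O))) ⟨.G, 0⟩ := by
        rw [cell_lev (by lia) (by lia) (by lia), lev_one le_rfl, low_top rfl,
          row_pos le_rfl, mark_one, lowZ_ge (by norm_num), lowS, if_pos (by norm_num)]
        have e := (L.child b).up_zero
        have e1 := (L.child b).up_eq (L.child b).mark_one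
        rw [show (1 : ℤ) - 1 = 0 by ring, e] at e1
        have h2 := L.hn
        have h4 := L.hj
        have h3 := L.hm
        have hc : (L.child b).pend 0 = if L.last then .J else .O := by
          rcases L.child_cases b with ⟨a1, a2, a3, a4⟩ | ⟨a1, a0, a2, a3, a4⟩ | ⟨a1, a0, a2, a3, a4⟩
          · simp [pend, last, a1.ne, a2, a4]; lia
          · simp [pend, last, a1, a2]
          · simp [pend, last, a1, a2]
        simp [ptr, hc, Ptr.letter, ← e1, e]
      rw [show (1 : ℤ) - 1 = 0 by ring] at hS ⊢
      exact .topFirst b L.last (by rw [cell_zero_top]; rfl) (by rw [cell_blank (by lia)]; rfl)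
        (by rw [hS]; rfl) (by rw [cell_zero_top]; rfl) (by rw [cell_zero_top]; rfl) (by rw [hS]; rfl)
        (by rw [hS]; rfl) hC
  · have hS := cell_o (L := L) (b := b) h0 (show (0 : ℤ) - 1 < 0 by lia) (by lia)
    obtain ⟨k, h1, h2⟩ := exists_period (t := p) (by lia)
    have hC := cell_lev' (L := L) (b := b) h0 le_rfl
    rw [lev_zero h1 h2] at hC
    have hW : (L.cell b (p - 1) 0).kd ≠ .blank := by
      rw [cell_kd, if_neg (by lia)]
      split_ifs <;> simp
    have hWh : (L.cell b (p - 1) 0).h = some .Z ∧ (L.cell b (p - 1) 0).z = ⟨.a, 0⟩ := by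
      rcases (show 0 ≤ p - 1 by lia).lt_or_eq with h' | h'
      · obtain ⟨k, h1, h2⟩ := exists_period (t := p - 1) (by lia)
        rw [cell_lev' h' le_rfl, lev_zero h1 h2]; exact ⟨rfl, rfl⟩
      · rw [← h', cell_zero_top]; exact ⟨rfl, rfl⟩
    obtain ⟨hWh, hWz⟩ := hWh
    by_cases hp : p = 2 ^ k ∧ k ≠ 0
    · obtain ⟨rfl, hk⟩ := hp
      obtain ⟨k, rfl⟩ := Nat.exists_eq_succ_of_ne_zero hk
      rw [Nat.succ_eq_add_one] at *
      have e : (2 : ℤ) ^ (k + 1) = 2 * 2 ^ k := by ring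
      have h8 : (1 : ℤ) ≤ 2 ^ k := one_le_pow₀ (by norm_num)
      have hN : (L.cell b (2 ^ (k + 1) - 1) (0 + 1)).s = some ((L.child b).ptr k 1) := by
        rw [cell_lev' (by lia) (by lia), zero_add, lev_one_s (k := k) (by lia) (by lia),
          if_pos (by lia)]
      rw [if_pos ⟨rfl, hk⟩] at hC
      rcases hm : L.mark (2 ^ (k + 1)) with _ | m
      · rw [hm] at hS
        refine .tick _ _ hW (by rw [hS]; rfl) (by rw [hS]; rfl) hN hWh (by rw [hS]; rfl) ?_
        rw [hC, tick_ptr hm]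
      · rw [hm] at hS
        obtain ⟨P, hP, hG⟩ := tick_ptr_some (b := b) hm
        rw [hP] at hN
        refine .lamTick _ P _ hW (by rw [hS]; rfl) (by rw [hS]; rfl) hN hWh (by rw [hS]; rfl) ?_
        rw [hC, hG]
    · have hm : L.mark p = none := by
        rcases hm : L.mark p with _ | m
        · rfl
        · obtain ⟨i, hi, rfl⟩ := L.mark_pow hm
          have a1 : k ≤ i := (pow_le_pow_iff_right₀ (show (1 : ℤ) < 2 by norm_num)).1 h1
          have a2 : i < k + 1 := (pow_lt_pow_iff_right₀ (show (1 : ℤ) < 2 by norm_num)).1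
            (by rw [pow_succ]; lia)
          obtain rfl : i = k := by lia
          exact absurd ⟨rfl, by lia⟩ hp
      have hN : (L.cell b (p - 1) (0 + 1)).s = none := by
        rcases (show 0 ≤ p - 1 by lia).lt_or_eq with h' | h'
        · obtain ⟨i, g1, g2⟩ := exists_period (t := p - 1) (by lia)
          rw [cell_lev' h' (by lia), zero_add, lev_one_s g1 g2, if_neg]
          intro hpi
          have a1 : k < i + 2 := (pow_lt_pow_iff_right₀ (show (1 : ℤ) < 2 by norm_num)).1
            (by rw [pow_add]; lia)
          have a2 : i < k + 1 := (pow_lt_pow_iff_right₀ (show (1 : ℤ) < 2 by norm_num)).1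
            (by rw [pow_succ]; lia)
          rcases (show k = i ∨ k = i + 1 by lia) with rfl | rfl
          · lia
          · exact hp ⟨by rw [pow_succ]; lia, by lia⟩
        · rw [cell_blank (by lia)]; rfl
      rw [hm] at hS
      rw [if_neg hp] at hC
      refine .free hW (by rw [hS]; rfl) (by rw [hS]; rfl) hN ?_ ?_
      · rw [hS, hWh, hWz]
        exact .floor _
      · rw [hC, hWh, hWz]

end Label
namespace Label

variable {L : Label} {b : Bool} {k : ℕ} {t y p q : ℤ}

theorem two_γ_le (h : L.m < k) : 2 * L.γ ≤ (2 : ℤ) ^ k := by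
  simpa using L.γ_le_pow (k := k) (i := 1) (by lia)

theorem low_eq_cell_q (h : L.m < k) (h' : (k - L.m - 1) % 2 = 0) (h1 : 2 ^ k < t)
    (h2 : t < 2 * 2 ^ k) (hy : 2 ^ k ≤ y) (hy' : y ≤ 2 ^ k + 1) (b : Bool) :
    L.low k t y = L.cell b (t - 2 * 2 ^ k) (y - 2 * 2 ^ k) := by
  have e1 := two_γ_le h; have e2 := L.two_mul_β_le; have e3 := L.α_le_β; have e4 := L.two_le_α
  have hr : L.row y = none := by rw [row_pos (by lia), L.mark_big (by lia)]; rfl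
  have hs : L.lowS k t y = none := by rw [lowS, if_neg (by lia)]
  have hz : L.lowZ k t y = ⟨.b (L.up (2 * 2 ^ k - t - 1)), 3⟩ := by
    rw [lowZ_ge (by lia), L.up_big (y := y) (by lia)]
    simp [ptr, h.not_ge, h', Ptr.letter]
  have hv : L.lowV k t y = (L.mark (2 * 2 ^ k - t)).map .mu := by
    rw [lowV, if_neg h1.ne', if_pos ⟨by simp [ptr, h.not_ge, h', Ptr.isQ], by lia⟩]
  have m1 : L.mark (-(y - 2 * 2 ^ k)) = none := L.mark_big (by lia)
  have m2 : L.dn (-(y - 2 * 2 ^ k)) = 3 := L.dn_big (by lia)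
  rcases lt_trichotomy y t with hyt | hyt | hyt
  · rw [low_sky hyt, cell_neg (by lia) (by lia), hr, hs, hz, hv, m1, m2,
      show -(t - 2 * 2 ^ k) = 2 * 2 ^ k - t by ring]
    rfl
  · rw [low_top hyt, cell_neg_top (by lia) (by lia), hr, hs, hz,
      m2, show -(t - 2 * 2 ^ k) = -(y - 2 * 2 ^ k) by lia, m1,
      show -(y - 2 * 2 ^ k) - 1 = 2 * 2 ^ k - t - 1 by lia]
    rfl
  · rw [low_blank hyt, cell_blank (by lia)]

theorem low_eq_cell_c (h : L.m < k) (h' : (k - L.m - 1) % 2 = 1) (h1 : 2 ^ k ≤ t)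
    (h2 : t < 2 * 2 ^ k) (hy : 2 ^ k ≤ 2 * y + 2) (hy' : 2 * y ≤ 2 ^ k ∨ t = 2 * 2 ^ k - 1 ∧ y < 2 ^ k) :
    L.low k t y = L.cell (L.bit k) (t - 2 ^ k) (y - 2 ^ k) := by
  have e1 : 2 ^ 2 * L.γ ≤ 2 ^ k := L.γ_le_pow (by lia)
  have e2 := L.two_mul_β_le; have e3 := L.α_le_β; have e4 := L.two_le_α
  have hr : L.row y = none := by rw [row_pos (by lia), L.mark_big (by lia)]; rfl
  have hP (H) : L.ptr k H = .c (L.bit k) L.last := by simp [ptr, h.not_ge, h']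
  have m0 : L.up y = 3 := L.up_big (by lia)
  have m1 : L.mark (-(y - 2 ^ k)) = none ∨ t = 2 * 2 ^ k - 1 := by
    rcases hy' with hy' | hy'
    · exact Or.inl (L.mark_big (by lia))
    · exact Or.inr hy'.1
  have m2 : L.dn (-(y - 2 ^ k)) = 3 ∨ t = 2 * 2 ^ k - 1 := by
    rcases hy' with hy' | hy'
    · exact Or.inl (L.dn_big (by lia))
    · exact Or.inr hy'.1
  rw [low_sky (by lia), hr]
  rcases h1.lt_or_eq with h1 | h1
  · have hv : L.lowV k t y = none := by
      rw [lowV, if_neg h1.ne', if_neg]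
      simp [hP, Ptr.isQ]
    rw [hv]
    rcases lt_or_ge y (2 * 2 ^ k - t) with hH | hH
    · rw [lowZ_lt hH, lowS, if_neg (by lia), cell_a (by lia) (by lia), m1.resolve_right (by lia),
        m2.resolve_right (by lia), m0]
      rfl
    · rw [lowZ_ge hH, lowS, cell_o (by lia) (by lia) (by lia), hP, m0, L.mark_big (by lia),
        L.dn_big (by lia)]
      have : (y = 2 * 2 ^ k - t) ↔ t - 2 ^ k = -(y - 2 ^ k) := by lia
      simp [this, Ptr.letter]
  · have hv : L.lowV k t y = some (.tick (some .Z) (.c (L.bit k) L.last)) := by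
      rw [lowV, if_pos h1.symm, if_neg (by lia), if_neg (by lia)]
      simp [msg, h.not_ge, h']
    rw [hv, lowZ_lt (by lia), lowS, if_neg (by lia), show t - 2 ^ k = 0 by lia,
      cell_zero (by lia), m1.resolve_right (by lia), m2.resolve_right (by lia), m0]
    rfl

theorem lev_q_low' (h1 : 2 ^ k ≤ t) (h2 : t < 2 * 2 ^ k) (h : L.m < k)
    (h' : (k - L.m - 1) % 2 = 0) (hy : y ≤ 2 ^ k + 1) : lev L t y = L.low k t y := by
  have := eight_le h
  rcases le_or_gt y (2 ^ k) with hy' | hy'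
  · exact lev_q_low h1 h2 h' hy'
  · rcases h1.lt_or_eq with h1 | h1
    · rw [lev_q_cell h1.le h2 h h' hy' false, low_eq_cell_q h h' h1 h2 hy'.le hy]
    · rw [lev_blank (by lia) (by lia), low_blank (by lia)]

theorem lev_q_cell' (h1 : 2 ^ k < t) (h2 : t < 2 * 2 ^ k) (h : L.m < k)
    (h' : (k - L.m - 1) % 2 = 0) (hy : 2 ^ k ≤ y) (b : Bool) :
    lev L t y = L.cell b (t - 2 * 2 ^ k) (y - 2 * 2 ^ k) := by
  rcases hy.lt_or_eq with hy' | rfl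
  · exact lev_q_cell h1.le h2 h h' hy' b
  · rw [lev_q_low h1.le h2 h' le_rfl, low_eq_cell_q h h' h1 h2 le_rfl (by lia)]

theorem lev_c_low' (h1 : 2 ^ k ≤ t) (h2 : t < 2 * 2 ^ k) (h : L.m < k)
    (h' : (k - L.m - 1) % 2 = 1) (hy : 2 * y ≤ 2 ^ k ∨ t = 2 * 2 ^ k - 1 ∧ y < 2 ^ k) :
    lev L t y = L.low k t y := by
  rcases lt_or_ge (2 * y) (2 ^ k) with hy' | hy'
  · exact lev_c_low h1 h2 h' hy'
  · rw [lev_c_cell h1 h2 h h' hy', low_eq_cell_c h h' h1 h2 (by lia) hy]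

theorem lev_c_cell' (h1 : 2 ^ k ≤ t) (h2 : t < 2 * 2 ^ k) (h : L.m < k)
    (h' : (k - L.m - 1) % 2 = 1) (hy : 2 ^ k ≤ 2 * y + 2) :
    lev L t y = L.cell (L.bit k) (t - 2 ^ k) (y - 2 ^ k) := by
  rcases le_or_gt (2 ^ k) (2 * y) with hy' | hy'
  · exact lev_c_cell h1 h2 h h' hy'
  · rw [lev_c_low h1 h2 h' hy', low_eq_cell_c h h' h1 h2 hy (Or.inl hy'.le)]

/-- At the end of a period all the letters differ from `a`, except at the floors of descendants
which are at the end of a period as well. -/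
theorem letter_end (hy : 1 ≤ y) (hy' : y ≤ 2 * 2 ^ k - 1) :
    (lev L (2 * 2 ^ k - 1) y).z.l ≠ .a ∨ (lev L (2 * 2 ^ k - 1) y).h = some .Z ∧
      (lev L (2 * 2 ^ k - 1) (y + 1)).s ≠ none := by
  induction k generalizing L y with
  | zero =>
    left
    rw [lev_g (k := 0) (by norm_num) (by norm_num) (by lia), low_z (by simpa using hy'),
      lowZ_ge (by simpa using hy)]
    exact Ptr.letter_ne (L.ptr 0 (2 * 2 ^ 0 - (2 * 2 ^ 0 - 1))) (L.up (2 * 2 ^ 0 - (2 * 2 ^ 0 - 1) - 1))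
  | succ k ih =>
    have h0 : (1 : ℤ) ≤ 2 ^ (k + 1) := one_le_pow₀ (by norm_num)
    have hl (h : lev L (2 * 2 ^ (k + 1) - 1) y = L.low (k + 1) (2 * 2 ^ (k + 1) - 1) y) :
        (lev L (2 * 2 ^ (k + 1) - 1) y).z.l ≠ .a := by
      rw [h, low_z hy', lowZ_ge (by lia)]
      exact Ptr.letter_ne _ _
    rcases L.ty (k + 1) with h | ⟨h, h'⟩ | ⟨h, h'⟩
    · exact Or.inl (hl (lev_g (by lia) (by lia) h))
    · rcases le_or_gt y (2 ^ (k + 1)) with hy1 | hy1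
      · exact Or.inl (hl (lev_q_low (by lia) (by lia) h' hy1))
      · left
        rw [lev_q_cell (by lia) (by lia) h h' hy1 false]
        rcases (show y - 2 * 2 ^ (k + 1) ≤ 2 * 2 ^ (k + 1) - 1 - 2 * 2 ^ (k + 1) by lia).lt_or_eq
          with hq | hq
        · rw [cell_neg (by lia) hq]; simp
        · rw [cell_neg_top (by lia) hq]; simp
    · rcases lt_trichotomy y (2 ^ (k + 1)) with hy1 | rfl | hy1
      · exact Or.inl (hl (lev_c_low' (by lia) (by lia) h h' (Or.inr ⟨rfl, hy1⟩)))
      · right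
        have e : (2 : ℤ) * 2 ^ (k + 1) - 1 - 2 ^ (k + 1) = 2 * 2 ^ k - 1 := by ring
        have := eight_le h
        have h3 : (2 : ℤ) ^ (k + 1) = 2 * 2 ^ k := by ring
        rw [lev_c_cell (by lia) (by lia) h h' (by lia), lev_c_cell (by lia) (by lia) h h' (by lia),
          e, sub_self, add_sub_cancel_left, cell_lev' (by lia) le_rfl, cell_lev' (by lia) (by lia),
          lev_zero (k := k) (by lia) (by lia), lev_one_s (k := k) (by lia) (by lia), if_pos rfl]
        simp
      · have e : (2 : ℤ) * 2 ^ (k + 1) - 1 - 2 ^ (k + 1) = 2 * 2 ^ k - 1 := by ring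
        have := eight_le h
        have h3 : (2 : ℤ) ^ (k + 1) = 2 * 2 ^ k := by ring
        rw [lev_c_cell (by lia) (by lia) h h' (by lia), lev_c_cell (by lia) (by lia) h h' (by lia),
          e, cell_lev' (by lia) (by lia), cell_lev' (by lia) (by lia), add_sub_right_comm]
        exact ih (by lia) (by lia)

theorem top_end : (lev L (2 * 2 ^ k - 1) (2 * 2 ^ k - 1)).h ≠ some .Z := by
  induction k generalizing L with
  | zero =>
    rw [lev_g (k := 0) (by norm_num) (by norm_num) (by lia), low_h le_rfl, row_pos (by norm_num)]
    exact map_K_ne _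
  | succ k ih =>
    have h0 : (1 : ℤ) ≤ 2 ^ (k + 1) := one_le_pow₀ (by norm_num)
    rcases L.ty (k + 1) with h | ⟨h, h'⟩ | ⟨h, h'⟩
    · rw [lev_g (k := k + 1) (by lia) (by lia) h, low_h le_rfl, row_pos (by lia)]
      exact map_K_ne _
    · have := eight_le h
      rw [lev_q_cell (by lia) (by lia) h h' (by lia) false, cell_neg_top (by lia) rfl]
      exact map_M_ne _
    · have := eight_le h
      have e : (2 : ℤ) * 2 ^ (k + 1) - 1 - 2 ^ (k + 1) = 2 * 2 ^ k - 1 := by ring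
      have h3 : (2 : ℤ) ^ (k + 1) = 2 * 2 ^ k := by ring
      rw [lev_c_cell (by lia) (by lia) h h' (by lia), e, cell_lev' (by lia) (by lia)]
      exact ih

end Label

open Label

theorem levRule (L : Label) (t y : ℤ) (ht : 2 ≤ t) (hy : 1 ≤ y) : LevRule L t y := by
  obtain ⟨n, hn⟩ : ∃ n : ℕ, t.toNat = n := ⟨_, rfl⟩
  induction n using Nat.strong_induction_on generalizing L t y with
  | _ n ih =>
    rcases lt_or_ge t y with hty | hty
    · refine .blank ?_ ?_ (lev_blank (by lia) hty)
      · rw [lev_kd (by lia), if_pos (by lia)]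
      · rw [lev_kd (by lia)]
        split_ifs <;> first | (exfalso; lia) | simp
    obtain ⟨k, h1, h2⟩ := exists_period (t := t) (by lia)
    rw [LevRule]
    rcases h1.lt_or_eq with h1 | h1
    · have g1 : 2 ^ k ≤ t - 1 := by lia
      have g2 : t - 1 < 2 * 2 ^ k := by lia
      rcases L.ty k with h | ⟨h, h'⟩ | ⟨h, h'⟩
      · rw [lev_g g1 g2 h, lev_g g1 g2 h, lev_g g1 g2 h, lev_g h1.le h2 h, lev_g h1.le h2 h]
        exact rule_low h1 h2 hy (Or.inr h)
      · have h8 := eight_le h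
        rcases le_or_gt y (2 ^ k) with hy1 | hy1
        · rw [lev_q_low' g1 g2 h h' (by lia), lev_q_low' g1 g2 h h' (by lia),
            lev_q_low' g1 g2 h h' (by lia), lev_q_low' h1.le h2 h h' (by lia),
            lev_q_low' h1.le h2 h h' (by lia)]
          exact rule_low h1 h2 hy (Or.inl (by lia))
        · rw [lev_q_cell' h1 h2 h h' hy1.le false, lev_q_cell' h1 h2 h h' (by lia) false,
            lev_q_cell g1 g2 h h' (by lia) false, lev_q_cell g1 g2 h h' (by lia) false]
          have := rule_cell (L := L) (b := false) (p := t - 2 * 2 ^ k) (q := y - 2 * 2 ^ k)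
            (fun h => by lia)
          have e1 : y + 1 - 2 * 2 ^ k = y - 2 * 2 ^ k + 1 := by ring
          have e2 : t - 1 - 2 * 2 ^ k = t - 2 * 2 ^ k - 1 := by ring
          have e3 : y - 1 - 2 * 2 ^ k = y - 2 * 2 ^ k - 1 := by ring
          rw [e1, e2, e3]
          have hh : (L.cell false (t - 2 * 2 ^ k - 1) (y - 2 * 2 ^ k - 1)).h ≠ some .Z := by
            rcases (show y - 2 * 2 ^ k - 1 ≤ t - 2 * 2 ^ k - 1 by lia).lt_or_eq with hq | hq
            · rw [cell_neg (by lia) hq]; exact map_M_ne _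
            · rw [cell_neg_top (by lia) hq]; exact map_M_ne _
          refine this.congr_SW ?_ ?_ hh
          · rw [lev_kd (by lia), cell_kd]
            congr 1
            · simp
            · congr 1; simp
          · rcases g1.lt_or_eq with g1 | g1
            · rw [lev_q_cell' g1 g2 h h' (by lia) false, e2, e3]
            · have := two_γ_le h; have := L.two_mul_β_le; have := L.α_le_β; have := L.two_le_α
              rw [lev_q_low g1.le g2 h' (by lia), low_h (by lia), row_pos (by lia),
                cell_neg_top (by lia) (by lia), L.mark_big (show L.γ < y - 1 by lia),
                L.mark_big (show L.γ < -(t - 2 * 2 ^ k - 1) by lia)]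
              rfl
      · have h8 := eight_le h
        obtain ⟨k, rfl⟩ : ∃ i, k = i + 1 := ⟨k - 1, by lia⟩
        have e : (2 : ℤ) ^ (k + 1) = 2 * 2 ^ k := by ring
        rcases lt_or_ge (2 * y) (2 ^ (k + 1)) with hy1 | hy1
        · rw [lev_c_low' g1 g2 h h' (Or.inl (by lia)), lev_c_low' g1 g2 h h' (Or.inl (by lia)),
            lev_c_low' g1 g2 h h' (Or.inl (by lia)), lev_c_low' h1.le h2 h h' (Or.inl (by lia)),
            lev_c_low' h1.le h2 h h' (Or.inl (by lia))]
          exact rule_low h1 h2 hy (Or.inl (by lia))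
        · rw [lev_c_cell' g1 g2 h h' (by lia), lev_c_cell' g1 g2 h h' (by lia),
            lev_c_cell' g1 g2 h h' (by lia), lev_c_cell' h1.le h2 h h' (by lia),
            lev_c_cell' h1.le h2 h h' (by lia)]
          have := rule_cell (L := L) (b := L.bit (k + 1)) (p := t - 2 ^ (k + 1))
            (q := y - 2 ^ (k + 1)) (fun h y hy => ih (t - 2 ^ (k + 1)).toNat (by lia) _ _ _ h hy rfl)
          have e1 : y + 1 - 2 ^ (k + 1) = y - 2 ^ (k + 1) + 1 := by ring
          have e2 : t - 1 - 2 ^ (k + 1) = t - 2 ^ (k + 1) - 1 := by ring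
          have e3 : y - 1 - 2 ^ (k + 1) = y - 2 ^ (k + 1) - 1 := by ring
          rwa [e1, e2, e3]
    · obtain ⟨k, rfl⟩ : ∃ i, k = i + 1 := by
        rcases k with _ | k
        · norm_num at h1; lia
        · exact ⟨k, rfl⟩
      have e : (2 : ℤ) ^ (k + 1) = 2 * 2 ^ k := by ring
      have h0 : (1 : ℤ) ≤ 2 ^ k := one_le_pow₀ (by norm_num)
      obtain rfl : t = 2 * 2 ^ k := by lia
      have g1 : (2 : ℤ) ^ k ≤ 2 * 2 ^ k - 1 := by lia
      have g2 : (2 : ℤ) * 2 ^ k - 1 < 2 * 2 ^ k := by lia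
      by_cases hk : k ≤ L.m
      · rw [lev_g g1 g2 hk, lev_g g1 g2 hk, lev_g g1 g2 hk]
        have hlow (y : ℤ) : lev L (2 * 2 ^ k) y = L.low (k + 1) (2 * 2 ^ k) y := by
          rcases hk.lt_or_eq with h | h
          · exact lev_g h1.le h2 h
          · rcases le_or_gt y (2 ^ (k + 1)) with hy | hy
            · exact lev_q_low h1.le h2 (by lia) hy
            · rw [lev_blank (by lia) (by lia), low_blank (by lia)]
        rw [hlow, hlow]
        rcases hty.lt_or_eq with hty | rfl
        · exact rule_low_tick hy hty (by rw [low_s (by lia), lowS, if_neg (by lia)]) (by lia)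
        · exact rule_low_tick_top hk
      have hk1 : L.m < k := by lia
      have h8 := eight_le hk1
      have hγ := two_γ_le hk1; have hb2 := L.two_mul_β_le; have ha2 := L.α_le_β
      have hb4 := L.two_le_α
      rcases L.ty k with h | ⟨-, h'⟩ | ⟨-, h'⟩
      · exact absurd h hk
      · have h3 : (k + 1 - L.m - 1) % 2 = 1 := by lia
        rcases le_or_gt y (2 ^ k) with hy1 | hy1
        · rw [lev_q_low' g1 g2 hk1 h' (by lia), lev_q_low' g1 g2 hk1 h' (by lia),
            lev_c_low' h1.le h2 (by lia) h3 (Or.inl (by lia)),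
            lev_c_low' h1.le h2 (by lia) h3 (Or.inl (by lia))]
          exact rule_low_tick hy (by lia) (by rw [low_s (by lia), lowS, if_neg (by lia)])
            (fun _ => by lia)
        · rw [lev_q_cell' (by lia) g2 hk1 h' (by lia) (L.bit (k + 1)),
            lev_q_cell' (by lia) g2 hk1 h' (by lia) (L.bit (k + 1)),
            lev_q_cell' (by lia) g2 hk1 h' (by lia) (L.bit (k + 1)),
            lev_c_cell' h1.le h2 (by lia) h3 (by lia), lev_c_cell' h1.le h2 (by lia) h3 (by lia)]
          have := rule_cell (L := L) (b := L.bit (k + 1)) (p := 0) (q := y - 2 ^ (k + 1))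
            (fun h => by lia)
          rw [e] at this ⊢
          have e1 : y + 1 - 2 * 2 ^ k = y - 2 * 2 ^ k + 1 := by ring
          have e2 : (2 : ℤ) * 2 ^ k - 1 - 2 * 2 ^ k = 0 - 1 := by ring
          have e3 : y - 1 - 2 * 2 ^ k = y - 2 * 2 ^ k - 1 := by ring
          rwa [e1, e2, e3, sub_self]
      · have h3 : (k + 1 - L.m - 1) % 2 = 0 := by lia
        obtain ⟨i, rfl⟩ : ∃ i, k = i + 1 := ⟨k - 1, by lia⟩
        have ei : (2 : ℤ) ^ (i + 1) = 2 * 2 ^ i := by ring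
        have hmsg : L.msg (i + 1 + 1) = .tick none (.q (L.bit (i + 1 + 1)) false) := by
          simp [msg, show ¬ i + 1 + 1 ≤ L.m by lia, h3]
        rw [lev_q_low h1.le h2 h3 (by lia), lev_q_low h1.le h2 h3 (by lia)]
        have hS := low_sky (L := L) (k := i + 1 + 1) (t := 2 * 2 ^ (i + 1)) (y := y - 1) (by lia)
        rw [lowZ_lt (by lia), lowV, if_pos e.symm, if_neg (by lia)] at hS
        rcases lt_or_ge y (2 ^ (i + 1)) with hy1 | hy1
        · rw [lev_c_low' g1 g2 hk1 h' (Or.inr ⟨rfl, hy1⟩)]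
          refine rule_low_tick hy (by lia) ?_ (fun _ _ => hy1)
          rcases (show y + 1 ≤ 2 ^ (i + 1) by lia).lt_or_eq with hy2 | hy2
          · rw [lev_c_low' g1 g2 hk1 h' (Or.inr ⟨rfl, hy2⟩), low_s g1, lowS, if_neg (by lia)]
          · rw [hy2, lev_c_cell g1 g2 hk1 h' (by lia), sub_self, cell_lev' (by lia) le_rfl,
              lev_zero (k := i) (by lia) (by lia)]
            rfl
        have hr : L.row y = none := by rw [row_pos hy, L.mark_big (by lia)]; rfl
        rw [L.up_big (y := y - 1) (by lia)] at hS
        rcases hty.lt_or_eq with hty | hty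
        · have hC := low_sky (L := L) (k := i + 1 + 1) (t := 2 * 2 ^ (i + 1)) (y := y) (by lia)
          rw [lowZ_lt (by lia), lowV, if_pos e.symm, if_neg (by lia), lowS, if_neg (by lia),
            if_pos ⟨by lia, h3, by lia⟩, hr, L.up_big (y := y) (by lia)] at hC
          have hW : (lev L (2 * 2 ^ (i + 1) - 1) y).kd ≠ .blank := by
            rw [lev_kd (by lia)]
            split_ifs <;> first | (exfalso; lia) | simp
          rcases hy1.lt_or_eq with hy2 | rfl
          · rw [if_pos ⟨by lia, h3, by lia⟩] at hS
            exact .kill _ 3 hW (by rw [hS]; rfl) (by rw [hS]; rfl) (letter_end hy (by lia))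
              (by rw [hS]; rfl) hC
          · rw [if_neg (fun h => by lia), hmsg] at hS
            have e1 : (2 : ℤ) * 2 ^ (i + 1) - 1 - 2 ^ (i + 1) = 2 * 2 ^ i - 1 := by ring
            refine .killStart _ 3 hW (by rw [hS]; rfl) (by rw [hS]; rfl) ?_ ?_
              (by rw [hS]; rfl) hC
            · rw [lev_c_cell g1 g2 hk1 h' (by lia), add_sub_cancel_left, e1,
                cell_lev' (by lia) (by lia), lev_one_s (k := i) (by lia) (by lia), if_pos rfl]
              simp
            · rw [lev_c_cell g1 g2 hk1 h' (by lia), sub_self, e1,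
                cell_lev' (by lia) (by lia), lev_zero (k := i) (by lia) (by lia)]
              rfl
        · rw [if_pos ⟨by lia, h3, by lia⟩] at hS
          have hC := low_top (L := L) (k := i + 1 + 1) (t := 2 * 2 ^ (i + 1)) (y := y) hty
          have hP : L.ptr (i + 1 + 1) (2 * 2 ^ (i + 1)) = .q (L.bit (i + 1 + 1)) false := by
            simp [ptr, show ¬ i + 1 + 1 ≤ L.m by lia, h3, show ¬ 2 * 2 ^ (i + 1) ≤ L.α by lia]
          rw [lowZ_ge (by lia), hr, lowS, if_pos (by lia),
            show (2 : ℤ) * 2 ^ (i + 1 + 1) - 2 * 2 ^ (i + 1) = 2 * 2 ^ (i + 1) by ring, hP,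
            L.up_big (y := y) (by lia), L.up_big (y := 2 * 2 ^ (i + 1) - 1) (by lia)] at hC
          refine .topKill (L.bit (i + 1 + 1)) ?_ ?_ (by rw [hS]; rfl) ?_ (by rw [hS]; rfl)
            (by rw [hS]; rfl) hC
          · rw [lev_kd (by lia), if_neg (by lia), if_pos (by lia)]
          · rw [lev_kd (by lia), if_pos (by lia)]
          · rw [hty]; exact top_end

/-- The configuration around a birth as a configuration of the subshift. -/
theorem cell_mem_X (L : Label) (b : Bool) : (fun m => L.cell b m.1 m.2) ∈ X :=
  fun _ _ => rule_cell fun h _ hy => levRule _ _ _ h hy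

theorem patLE2_refl {S : Type*} (x : ℤ × ℤ → S) : patLE2 x x := fun _ n => ⟨n, fun _ _ => rfl⟩

theorem patLE2_trans {S : Type*} {x y z : ℤ × ℤ → S} (h : patLE2 x y) (h' : patLE2 y z) :
    patLE2 x z := by
  intro D n
  obtain ⟨n', hn⟩ := h D n
  obtain ⟨n'', hn'⟩ := h' D n'
  exact ⟨n'', fun m hm => (hn' m hm).trans (hn m hm)⟩

namespace Label

/-- The configuration around a birth, as a point of the full shift. -/
def conf (L : Label) (b : Bool) : ℤ × ℤ → Cell := fun m => L.cell b m.1 m.2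

theorem exists_large_period (L : Label) (b : Bool) (K : ℕ) :
    ∃ k, L.m < k ∧ (k + 1 - L.m - 1) % 2 = 1 ∧ L.bit (k + 1) = b ∧ K ≤ k := by
  cases b
  · refine ⟨L.m + 1 + 4 * K, by lia, by lia, ?_, by lia⟩
    simp only [bit, decide_eq_false_iff_not]; lia
  · refine ⟨L.m + 3 + 4 * K, by lia, by lia, ?_, by lia⟩
    simp only [bit, decide_eq_true_eq]; lia

theorem conf_child_le (L : Label) (b b' : Bool) :
    patLE2 ((L.child b).conf b') (L.conf b) := by
  intro D n
  obtain ⟨K, hK⟩ : ∃ K : ℕ, ∀ m ∈ D, |(n + m).1| ≤ K ∧ |(n + m).2| ≤ K := by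
    refine ⟨∑ m ∈ D, ((n + m).1.natAbs + (n + m).2.natAbs), fun m hm => ?_⟩
    have := Finset.single_le_sum (f := fun m => (n + m).1.natAbs + (n + m).2.natAbs)
      (fun _ _ => Nat.zero_le _) hm
    generalize ∑ m ∈ D, ((n + m).1.natAbs + (n + m).2.natAbs) = K at this
    rw [Int.abs_eq_natAbs, Int.abs_eq_natAbs]
    lia
  obtain ⟨k, h1, h2, h3, h4⟩ := exists_large_period (L.child b) b' (K + 1)
  have hk : (K : ℤ) + 1 < 2 ^ k := by
    have := Nat.lt_two_pow_self (n := k)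
    zify at this h4
    lia
  have e : (2 : ℤ) ^ (k + 1) = 2 * 2 ^ k := by ring
  refine ⟨n + (2 ^ (k + 1), 2 ^ (k + 1)), fun m hm => ?_⟩
  obtain ⟨g1, g2⟩ := hK m hm
  rw [add_right_comm]
  generalize n + m = a at g1 g2
  obtain ⟨p, q⟩ := a
  simp only [abs_le] at g1 g2
  simp only [conf, Prod.mk_add_mk]
  rw [cell_lev' (by lia) (by lia)]
  rcases lt_or_ge p 0 with hp | hp
  · rw [lev_q_cell (k := k) (by lia) (by lia) h1 (by lia) (by lia) b']
    congr 1 <;> lia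
  · rw [lev_c_cell (k := k + 1) (by lia) (by lia) (by lia) h2 (by lia), h3]
    congr 1 <;> lia

/-- The configuration encoding a positive natural number. -/
def base (N : ℕ) (h : 1 ≤ N) : Label := ⟨1, N, N + 1, le_rfl, h, by lia⟩

theorem ext {L L' : Label} (h1 : L.j = L'.j) (h2 : L.n = L'.n) (h3 : L.m = L'.m) : L = L' := by
  cases L; cases L'; cases h1; cases h2; cases h3; rfl

theorem exists_last (L : Label) (h : L.j < L.n) (b b' : Bool) : ∃ L' : Label, L'.j = L.n ∧
    L'.n = L.n ∧ L'.m = L.m + (L.n - L.j) ∧ patLE2 (L'.conf b') (L.conf b) := by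
  obtain ⟨i, hi⟩ : ∃ i, i = L.n - L.j := ⟨_, rfl⟩
  induction i generalizing L b with
  | zero => lia
  | succ i ih =>
    rcases L.child_cases b with ⟨h1, h2, h3, h4⟩ | h | h
    · rcases h1.nat_succ_le.lt_or_eq with h5 | h5
      · obtain ⟨L', g1, g2, g3, g4⟩ := ih (L.child b) (by lia) b (by lia)
        exact ⟨L', by lia, by lia, by lia, patLE2_trans g4 (conf_child_le _ _ _)⟩
      · exact ⟨L.child b, by lia, h3, by lia, conf_child_le _ _ _⟩
    · lia
    · lia

theorem base_le_of_multiple {N : ℕ} (h : 2 ≤ N) (c : ℕ) (L : Label) (hj : L.j = 1) (hn : L.n = N)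
    (hm : L.m = (c + 1) * N + 1) : ∃ b, patLE2 (L.conf b) ((base N (by lia)).conf false) := by
  induction c generalizing L with
  | zero =>
    obtain rfl : L = base N (by lia) := ext hj hn (by rw [hm]; simp [base])
    exact ⟨false, patLE2_refl _⟩
  | succ c ih =>
    obtain ⟨L₀, e1, e2, e3⟩ : ∃ L₀ : Label, L₀.j = 1 ∧ L₀.n = N ∧ L₀.m = (c + 1) * N + 1 :=
      ⟨⟨1, N, (c + 1) * N + 1, le_rfl, by lia, by nlinarith⟩, rfl, rfl, rfl⟩
    obtain ⟨b, hb⟩ := ih L₀ e1 e2 e3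
    obtain ⟨L', h1, h2, h3, h4⟩ := exists_last L₀ (by lia) b false
    rcases L'.child_cases false with h5 | h5 | ⟨-, -, h6, h7, h8⟩
    · lia
    · simp at h5
    · obtain rfl : L = L'.child false := ext (by lia) (by rw [hn, h7, h2, e2]) (by
        rw [hm, h8, h3, e1, e2, e3]
        simp only [add_mul, one_mul]
        lia)
      exact ⟨false, patLE2_trans (conf_child_le _ _ _) (patLE2_trans h4 hb)⟩

theorem conf_base_le {N M : ℕ} (hN : 2 ≤ N) (hM : 2 ≤ M) (h : N ∣ M) :
    patLE2 ((base M (by lia)).conf false) ((base N (by lia)).conf false) := by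
  obtain ⟨c, rfl⟩ := h
  obtain _ | _ | c := c
  · lia
  · simpa using patLE2_refl _
  · obtain ⟨L₀, e1, e2, e3⟩ : ∃ L₀ : Label, L₀.j = 1 ∧ L₀.n = N ∧ L₀.m = (c + 1) * N + 1 :=
      ⟨⟨1, N, (c + 1) * N + 1, le_rfl, by lia, by nlinarith⟩, rfl, rfl, rfl⟩
    obtain ⟨b, hb⟩ := base_le_of_multiple hN c L₀ e1 e2 e3
    obtain ⟨L', h1, h2, h3, h4⟩ := exists_last L₀ (by lia) b true
    rcases L'.child_cases true with h5 | ⟨-, -, h6, h7, h8⟩ | h5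
    · lia
    · have e : L'.m = N * (c + 1 + 1) := by
        rw [h3, e1, e2, e3]
        simp only [add_mul, one_mul, mul_comm N]
        lia
      obtain e' : base (N * (c + 1 + 1)) (by lia) = L'.child true :=
        ext (by rw [h6]; rfl) (by rw [h7, e]; rfl) (by rw [h8, e]; rfl)
      rw [e']
      exact patLE2_trans (conf_child_le _ _ _) (patLE2_trans h4 hb)
    · simp at h5

end Label
namespace Label

/-- The descendants of a label. -/
inductive Desc : Label → Label → Prop
  | refl (L : Label) : Desc L L
  | step (L : Label) (b : Bool) {L' : Label} (h : Desc (L.child b) L') : Desc L L'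

theorem Desc.dvd {N : ℕ} {L L' : Label} (h : Desc L L') (h1 : N ∣ L.n) (h2 : N ∣ L.m - L.j) :
    N ∣ L'.n := by
  induction h with
  | refl => exact h1
  | step L b _ ih =>
    have g1 := L.hn; have g2 := L.hm
    have hm : L.j = L.n → N ∣ L.m := fun e => by
      have := Nat.dvd_add h2 h1
      rwa [e, Nat.sub_add_cancel g2.le] at this
    rcases L.child_cases b with ⟨-, e1, e2, e3⟩ | ⟨e, -, e1, e2, e3⟩ | ⟨e, -, e1, e2, e3⟩
    · exact ih (e2 ▸ h1) (by rwa [e1, e3, Nat.add_sub_add_right])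
    · exact ih (e2 ▸ hm e) (by rw [e1, e3]; exact hm e)
    · exact ih (e2 ▸ h1) (by rw [e1, e3]; exact hm e)

theorem eq_n_of_mark {L : Label} {k : ℕ} (h : L.mark (2 ^ k) = some .N) : k = L.n := by
  rw [mark_eq_pow] at h
  by_contra hk
  rw [if_neg hk] at h
  split_ifs at h <;> simp at h

/-- Below a birth on the diagonal one sees the marks of a descendant. -/
theorem birth (L : Label) {t : ℤ} (ht : 1 ≤ t) (hZ : (lev L t t).h = some .Z) :
    ∃ L', Desc L L' ∧ ∀ d, 1 ≤ d → d ≤ L'.γ → d < t ∧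
      (lev L (t - d) (t - d)).h = (L'.mark d).map .M := by
  obtain ⟨n, hn⟩ : ∃ n : ℕ, t.toNat = n := ⟨_, rfl⟩
  induction n using Nat.strong_induction_on generalizing L t with
  | _ n ih =>
    obtain ⟨k, h1, h2⟩ := exists_period ht
    have h0 : (1 : ℤ) ≤ 2 ^ k := one_le_pow₀ (by norm_num)
    rcases L.ty k with h | ⟨h, h'⟩ | ⟨h, h'⟩
    · rw [lev_g h1 h2 h, low_h le_rfl, row_pos (by lia)] at hZ
      exact absurd hZ (map_K_ne _)
    · rcases h1.lt_or_eq with h3 | h3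
      · rw [lev_q_cell h1 h2 h h' h3 false, cell_neg_top (by lia) rfl] at hZ
        exact absurd hZ (map_M_ne _)
      · rw [lev_q_low h1 h2 h' h3.ge, low_h le_rfl, row_pos (by lia)] at hZ
        exact absurd hZ (map_K_ne _)
    · rcases h1.lt_or_eq with h3 | rfl
      · have h4 := h1
        rw [lev_c_cell h1 h2 h h' (by lia), cell_lev' (by lia) (by lia)] at hZ
        obtain ⟨L', hL, hd⟩ := ih (t - 2 ^ k).toNat (by lia) _ (by lia) hZ rfl
        refine ⟨L', .step _ _ hL, fun d hd1 hd2 => ?_⟩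
        obtain ⟨g1, g2⟩ := hd d hd1 hd2
        refine ⟨by lia, ?_⟩
        rw [lev_c_cell (k := k) (by lia) (by lia) h h' (by lia), cell_lev' (by lia) (by lia), ← g2,
          sub_right_comm]
      · obtain ⟨k, rfl⟩ : ∃ i, k = i + 1 := ⟨k - 1, by lia⟩
        refine ⟨L, .refl _, fun d hd1 hd2 => ?_⟩
        have := L.γ_le_pow (k := k) (i := 1) (by lia)
        have e : (2 : ℤ) ^ (k + 1) = 2 * 2 ^ k := by ring
        refine ⟨by lia, ?_⟩
        rw [lev_q_cell (k := k) (by lia) (by lia) (by lia) (by lia) (by lia) false,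
          cell_neg_top (by lia) rfl]
        simp [e]

theorem dvd_of_conf_le {N M : ℕ} (hN : 1 ≤ N) (hM : 2 ≤ M)
    (h : patLE2 ((base M (by lia)).conf false) ((base N hN).conf false)) : N ∣ M := by
  set A := base M (by lia) with hA
  set B := base N hN with hB
  obtain ⟨⟨p, q⟩, hp⟩ := h ((Finset.Icc 0 A.γ).image fun d => (-d, -d)) (0, 0)
  replace hp : ∀ d, 0 ≤ d → d ≤ A.γ → B.cell false (p - d) (q - d) = A.cell false (-d) (-d) :=
    fun d h1 h2 => by
      simpa [conf, ← sub_eq_add_neg] using hp (-d, -d)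
        (Finset.mem_image_of_mem _ (Finset.mem_Icc.2 ⟨h1, h2⟩))
  have hγ : 0 < A.γ := by simp only [γ]; positivity
  have h0 := hp 0 le_rfl hγ.le
  simp only [sub_zero, neg_zero, cell_zero_top] at h0
  obtain rfl : q = p := by
    have := congrArg Cell.kd h0
    rw [cell_kd, Cell.kd_top] at this
    split_ifs at this with _ h
    exact h
  replace h0 := congrArg Cell.h h0
  rw [Cell.h_top] at h0
  have hp' : ∀ d, 1 ≤ d → d ≤ A.γ → (B.cell false (q - d) (q - d)).h = (A.mark d).map .M :=
    fun d h1 h2 => by rw [hp d (by lia) h2, cell_neg_top (by lia) rfl]; simp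
  have hinj : Function.Injective (Option.map Row.M) :=
    Option.map_injective fun _ _ h => Row.M.inj h
  have hAM : A.mark (2 ^ M) = some .N := by
    rw [mark_eq_pow]; simp [hA, base]; lia
  have one_le (i : ℕ) : (1 : ℤ) ≤ 2 ^ i := one_le_pow₀ (by norm_num)
  have hMγ : (2 : ℤ) ^ M ≤ A.γ := A.pow_le_γ (by simp [hA, base])
  rcases lt_trichotomy q 0 with hq | rfl | hq
  · rw [cell_neg_top hq rfl] at h0
    exact absurd h0 (map_M_ne _)
  · have := hp' _ (one_le M) hMγ
    have h1 := one_le M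
    rw [cell_neg_top (by lia) rfl, Cell.h_top, zero_sub, neg_neg] at this
    replace this := hinj this
    rw [hAM] at this
    exact (eq_n_of_mark this).symm.dvd
  · rw [cell_lev hq hq.le le_rfl] at h0
    obtain ⟨L', hL, hd⟩ := birth _ hq h0
    have key : ∀ d, 1 ≤ d → d ≤ A.γ → d ≤ L'.γ → L'.mark d = A.mark d := fun d h1 h2 h3 => by
      obtain ⟨g1, g2⟩ := hd d h1 h3
      apply hinj
      rw [← g2, ← hp' d h1 h2, cell_lev' (by lia) (by lia)]
    rcases le_or_gt M L'.m with hm | hm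
    · have := key _ (one_le M) hMγ (L'.pow_le_γ hm)
      rw [hAM] at this
      rw [eq_n_of_mark this]
      exact (Desc.step B false hL).dvd dvd_rfl dvd_rfl
    · have := key _ (one_le L'.m) (A.pow_le_γ (by simp [hA, base]; lia)) le_rfl
      have g1 := L'.hm; have g2 := L'.hn
      rw [mark_eq_pow, if_neg (by lia), if_neg (by lia), if_pos rfl, mark_eq_pow] at this
      simp only [hA, base] at this
      split_ifs at this <;> lia

end Label

open Label

theorem conf_le_iff {N M : ℕ} (hN : 2 ≤ N) (hM : 2 ≤ M) :
    patLE2 ((base M (by lia)).conf false) ((base N (by lia)).conf false) ↔ N ∣ M :=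
  ⟨dvd_of_conf_le _ hM, conf_base_le hN hM⟩

/-- A finite poset embeds into the positive integers under reverse divisibility. -/
theorem exists_dvd_embedding (P : Type) [Fintype P] [PartialOrder P] :
    ∃ f : P → ℕ, (∀ p, 2 ≤ f p) ∧ ∀ p q, p ≤ q ↔ f q ∣ f p := by
  classical
  obtain ⟨e⟩ := Fintype.truncEquivFin P
  let pr : P → ℕ := fun p => Nat.nth Nat.Prime (e p)
  have hpr (p) : (pr p).Prime := Nat.prime_nth_prime _
  have hin : Function.Injective pr := (Nat.nth_injective Nat.infinite_setOfPred_prime).comp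
    (Fin.val_injective.comp e.injective)
  refine ⟨fun p => ∏ r ∈ Finset.univ.filter (p ≤ ·), pr r, fun p => ?_, fun p q => ⟨?_, ?_⟩⟩
  · refine (hpr p).two_le.trans (Nat.le_of_dvd (Finset.prod_pos fun r _ => (hpr r).pos) ?_)
    exact Finset.dvd_prod_of_mem _ (by simp)
  · intro h
    exact Finset.prod_dvd_prod_of_subset _ _ _ fun r hr => by
      simp only [Finset.mem_filter, Finset.mem_univ, true_and] at hr ⊢
      exact h.trans hr
  · intro h
    have h1 : pr q ∣ ∏ r ∈ Finset.univ.filter (p ≤ ·), pr r :=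
      (Finset.dvd_prod_of_mem _ (by simp)).trans h
    obtain ⟨r, hr, hd⟩ := (hpr q).prime.exists_mem_finset_dvd h1
    rw [hin ((Nat.prime_dvd_prime_iff_eq (hpr q) (hpr r)).1 hd)]
    simpa using hr

end ChildSFT

/-- There is a single countable two-dimensional SFT, deterministic in some
direction, whose subpattern poset contains an order-embedded copy of every finite poset. -/
theorem all_finite_posets_embed_in_one_SFT :
    ∃ (S : Type) (_ : Fintype S) (X : Set (ℤ × ℤ → S)),
      IsSFT2 X ∧ X.Countable ∧ DetSomeDir X ∧
      ∀ (P : Type) [Fintype P] [PartialOrder P],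
        ∃ φ : P → ℤ × ℤ → S, (∀ p, φ p ∈ X) ∧
          ∀ p q : P, p ≤ q ↔ patLE2 (φ p) (φ q) := by
  refine ⟨ChildSFT.Cell, inferInstance, ChildSFT.X, ChildSFT.isSFT2_X, ChildSFT.countable_X,
    ChildSFT.detSomeDir_X, fun P _ _ => ?_⟩
  obtain ⟨f, hf, h⟩ := ChildSFT.exists_dvd_embedding P
  refine ⟨fun p => (ChildSFT.Label.base (f p) (by have := hf p; lia)).conf false,
    fun p => ChildSFT.cell_mem_X _ _, fun p q => ?_⟩
  rw [h, ← ChildSFT.conf_le_iff (hf q) (hf p)]
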